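/- Let n ≥ 2 be an integer and let p be a real number with 1 < p < n. Then for every smooth function u : ℝⁿ → ℝ with compact support contained in the open unit ball Bⁿ, writing dV = (2/(1−|x|²))ⁿ dx, one has ((n−1)/p)^n ( ∫_{Bⁿ} |u|^p dV )^{n/p} + S(n,p)^n ( ∫_{Bⁿ} |u|^{np/(n−p)} dV )^{(n−p)/p} ≤ ( ∫_{Bⁿ} ((1−|x|²)/2)^p |∇u|^p dV )^{n/p}. -/

import Mathlib

open Real MeasureTheory

/-- Volume of the Euclidean unit ball in `ℝⁿ`. -/
noncomputable def unitBallVol (n : ℕ) : ℝ := π ^ ((n : ℝ) / 2) / Real.Gamma ((n : ℝ) / 2 + 1)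

/-- The sharp constant `S(n,p)` in the `Lᵖ` Sobolev inequality in `ℝⁿ`. -/
noncomputable def sobolevConst (n : ℕ) (p : ℝ) : ℝ :=
  ((1 / (n : ℝ)) * (((n : ℝ) * (p - 1)) / ((n : ℝ) - p)) ^ (1 - 1 / p) *
    (Real.Gamma (n : ℝ) /
      (Real.Gamma ((n : ℝ) / p) * Real.Gamma ((n : ℝ) + 1 - (n : ℝ) / p) * unitBallVol n)) ^
        (1 / (n : ℝ)))⁻¹

section

open Set Filter Topology

/-- A continuous function positive on the open interval has a primitive extending to an order
isomorphism of `ℝ`. -/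
theorem exists_orderIso_primitive {A B : ℝ} (hAB : A < B) {k : ℝ → ℝ}
    (hk : ContinuousOn k (Icc A B)) (hkpos : ∀ x ∈ Ioo A B, 0 < k x) :
    ∃ e : ℝ ≃o ℝ, (∀ x ∈ Icc A B, e x = ∫ t in A..x, k t) ∧
      ∀ x ∈ Ioo A B, HasDerivAt e (k x) x := by
  have hInt : IntervalIntegrable k volume A B := (hk.mono (by rw [uIcc_of_le hAB.le])).intervalIntegrable
  set K : ℝ → ℝ := fun x => ∫ t in A..x, k t with hK
  have hKc : ContinuousOn K (Icc A B) := by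
    have := intervalIntegral.continuousOn_primitive_interval' hInt (left_mem_uIcc)
    rwa [uIcc_of_le hAB.le] at this
  have hKd : ∀ x ∈ Ioo A B, HasDerivAt K (k x) x := by
    intro x hx
    have hkx : ContinuousAt k x := hk.continuousAt (Icc_mem_nhds hx.1 hx.2)
    refine intervalIntegral.integral_hasDerivAt_right ?_ ?_ hkx
    · exact hInt.mono_set (by rw [uIcc_of_le hAB.le, uIcc_of_le hx.1.le]; exact Icc_subset_Icc_right hx.2.le)
    · exact (hk.mono Ioo_subset_Icc_self).stronglyMeasurableAtFilter isOpen_Ioo x hx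
  have hKm : StrictMonoOn K (Icc A B) := by
    refine strictMonoOn_of_deriv_pos (convex_Icc A B) hKc ?_
    intro x hx
    rw [interior_Icc] at hx
    rw [(hKd x hx).deriv]; exact hkpos x hx
  set P : ℝ → ℝ := fun x => max A (min B x) with hP
  have hPm : ∀ x, P x ∈ Icc A B := fun x =>
    ⟨le_max_left _ _, max_le hAB.le (min_le_left _ _)⟩
  have hPid : ∀ x ∈ Icc A B, P x = x := fun x hx => by
    simp only [hP]; rw [min_eq_right hx.2, max_eq_right hx.1]
  have hPc : Continuous P := by fun_prop
  have hPmono : Monotone P := fun x y h => by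
    simp only [hP]; gcongr
  have hPlip : ∀ x y, x ≤ y → P y - P x ≤ y - x := by
    intro x y h
    simp only [hP]
    rcases le_total B x with h1 | h1 <;> rcases le_total B y with h2 | h2 <;>
    rcases le_total A x with h3 | h3 <;> rcases le_total A y with h4 | h4 <;>
    simp [h1, h2, h3, h4, hAB.le] <;> linarith
  set e0 : ℝ → ℝ := fun x => K (P x) + (x - P x) with he0
  have hc : Continuous e0 := by
    have : Continuous fun x => K (P x) := hKc.comp_continuous hPc hPm
    exact this.add (continuous_id.sub hPc)
  have hmono : StrictMono e0 := by
    intro x y hxy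
    simp only [he0]
    rcases (hPmono hxy.le).eq_or_lt with h | h
    · rw [h]; linarith
    · have := hKm (hPm x) (hPm y) h
      have := hPlip x y hxy.le
      linarith
  have hsurj : Function.Surjective e0 := by
    apply hc.surjective
    · refine tendsto_atTop_mono (f := fun x => K A + x - B) ?_ ?_
      · intro x
        have h1 := hKm.monotoneOn (left_mem_Icc.2 hAB.le) (hPm x) (hPm x).1
        have h2 := (hPm x).2
        simp only [he0]; linarith
      · have : Tendsto (fun x : ℝ => x + (K A - B)) atTop atTop := tendsto_atTop_add_const_right _ _ tendsto_id
        convert this using 2; ring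
    · refine tendsto_atBot_mono (g := e0) (f := fun x => K B + x - A) ?_ ?_
      · intro x
        have h1 := hKm.monotoneOn (hPm x) (right_mem_Icc.2 hAB.le) (hPm x).2
        have h2 := (hPm x).1
        simp only [he0]; linarith
      · have : Tendsto (fun x : ℝ => x + (K B - A)) atBot atBot := tendsto_atBot_add_const_right _ _ tendsto_id
        convert this using 2; ring
  refine ⟨hmono.orderIsoOfSurjective e0 hsurj, ?_, ?_⟩
  · intro x hx
    simp only [StrictMono.coe_orderIsoOfSurjective, he0, hPid x hx, hK]; ring
  · intro x hx
    have h1 : HasDerivAt K (k x) x := hKd x hx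
    refine h1.congr_of_eventuallyEq ?_
    filter_upwards [Icc_mem_nhds hx.1 hx.2] with y hy
    simp only [StrictMono.coe_orderIsoOfSurjective, he0, hPid y hy]; ring

/-- One-dimensional monotone transport of the density `ρ` on `[α, β]` to the density `k` on
`[A, B]`. -/
theorem exists_monotone_transport {α β A B : ℝ} (hαβ : α < β) (hAB : A < B) {ρ k : ℝ → ℝ}
    (hρ : ContinuousOn ρ (Icc α β)) (hρ0 : ∀ t ∈ Icc α β, 0 ≤ ρ t)
    (hk : ContinuousOn k (Icc A B)) (hkpos : ∀ x ∈ Ioo A B, 0 < k x)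
    (hmass : ∫ t in α..β, ρ t = ∫ x in A..B, k x) :
    ∃ z : ℝ → ℝ, ∃ a b : ℝ, α ≤ a ∧ a < b ∧ b ≤ β ∧ Continuous z ∧ (∀ t, z t ∈ Icc A B) ∧
      Monotone z ∧ z α = A ∧
      (∀ t ∈ Ioo a b, z t ∈ Ioo A B ∧ HasDerivAt z (ρ t / k (z t)) t) ∧
      (∀ t ∈ Icc α β, t ∉ Ioo a b → ρ t = 0 ∨ t = α ∨ t = β) ∧
      IntervalIntegrable (fun t => ρ t / k (z t)) volume a b ∧
      ∀ φ : ℝ → ℝ, ContinuousOn φ (Icc A B) →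
        ∫ t in α..β, φ (z t) * ρ t = ∫ x in A..B, φ x * k x := by
  obtain ⟨e, he, hed⟩ := exists_orderIso_primitive hAB hk hkpos
  have hInt : IntervalIntegrable ρ volume α β :=
    (hρ.mono (by rw [uIcc_of_le hαβ.le])).intervalIntegrable
  have hintk : IntervalIntegrable k volume A B :=
    (hk.mono (by rw [uIcc_of_le hAB.le])).intervalIntegrable
  set F : ℝ → ℝ := fun x => ∫ t in α..x, ρ t with hF
  set m : ℝ := ∫ x in A..B, k x with hm
  have hFc : ContinuousOn F (Icc α β) := by
    have := intervalIntegral.continuousOn_primitive_interval' hInt (left_mem_uIcc)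
    rwa [uIcc_of_le hαβ.le] at this
  have hii : ∀ s ∈ Icc α β, ∀ t ∈ Icc α β, IntervalIntegrable ρ volume s t := by
    intro s hs t ht
    exact (hρ.mono (by rw [← uIcc_of_le hαβ.le] at hs ht ⊢; exact uIcc_subset_uIcc hs ht)).intervalIntegrable
  have hFm : MonotoneOn F (Icc α β) := by
    intro s hs t ht hst
    have : F t - F s = ∫ x in s..t, ρ x :=
      intervalIntegral.integral_interval_sub_left (hii _ (left_mem_Icc.2 hαβ.le) _ ht) (hii _ (left_mem_Icc.2 hαβ.le) _ hs)
    have h2 : 0 ≤ ∫ x in s..t, ρ x := intervalIntegral.integral_nonneg hst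
      (fun u hu => hρ0 u ⟨hs.1.trans hu.1, hu.2.trans ht.2⟩)
    linarith
  have hFα : F α = 0 := by simp [hF]
  have hFβ : F β = m := hmass
  have heA : e A = 0 := by rw [he A (left_mem_Icc.2 hAB.le)]; simp
  have heB : e B = m := by rw [he B (right_mem_Icc.2 hAB.le)]
  have hmpos : 0 < m := by rw [← heA, ← heB]; exact e.strictMono hAB
  set P : ℝ → ℝ := fun x => max α (min β x) with hP
  have hPm : ∀ x, P x ∈ Icc α β := fun x =>
    ⟨le_max_left _ _, max_le hαβ.le (min_le_left _ _)⟩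
  have hPid : ∀ x ∈ Icc α β, P x = x := fun x hx => by
    simp only [hP]; rw [min_eq_right hx.2, max_eq_right hx.1]
  have hPc : Continuous P := by fun_prop
  have hPmono : Monotone P := fun x y h => by
    simp only [hP]; gcongr
  have hFP : Continuous fun t => F (P t) := hFc.comp_continuous hPc hPm
  set z : ℝ → ℝ := fun t => e.symm (F (P t)) with hz
  have hzc : Continuous z := e.symm.continuous.comp hFP
  have hzm : Monotone z := fun s t h => e.symm.monotone (hFm (hPm _) (hPm _) (hPmono h))
  have hzα : z α = A := by
    simp only [hz]; rw [hPid α (left_mem_Icc.2 hαβ.le), hFα, ← heA, e.symm_apply_apply]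
  have hzIcc : ∀ t, z t ∈ Icc A B := by
    intro t
    have h1 : 0 ≤ F (P t) := by rw [← hFα]; exact hFm (left_mem_Icc.2 hαβ.le) (hPm t) (hPm t).1
    have h2 : F (P t) ≤ m := by rw [← hFβ]; exact hFm (hPm t) (right_mem_Icc.2 hαβ.le) (hPm t).2
    constructor
    · rw [← e.symm_apply_apply A, heA]; exact e.symm.monotone h1
    · rw [← e.symm_apply_apply B, heB]; exact e.symm.monotone h2
  -- endpoints of the set where `0 < F < m`
  obtain ⟨a, ⟨haI, haF⟩, hamax⟩ : ∃ a, IsGreatest (Icc α β ∩ F ⁻¹' {0}) a := by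
    refine IsCompact.exists_isGreatest ?_ ⟨α, left_mem_Icc.2 hαβ.le, hFα⟩
    exact isCompact_Icc.of_isClosed_subset (hFc.preimage_isClosed_of_isClosed isClosed_Icc isClosed_singleton) inter_subset_left
  obtain ⟨b, ⟨hbI, hbF⟩, hbmin⟩ : ∃ b, IsLeast (Icc α β ∩ F ⁻¹' {m}) b := by
    refine IsCompact.exists_isLeast ?_ ⟨β, right_mem_Icc.2 hαβ.le, hFβ⟩
    exact isCompact_Icc.of_isClosed_subset (hFc.preimage_isClosed_of_isClosed isClosed_Icc isClosed_singleton) inter_subset_left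
  simp only [mem_preimage, mem_singleton_iff] at haF hbF
  have hab : a < b := by
    by_contra! h
    have := hFm hbI haI h
    linarith
  have hJ : ∀ t ∈ Ioo a b, t ∈ Icc α β := fun t ht => ⟨haI.1.trans ht.1.le, ht.2.le.trans hbI.2⟩
  have hFJ : ∀ t ∈ Ioo a b, 0 < F t ∧ F t < m := by
    intro t ht
    have h1 := hFm haI (hJ t ht) ht.1.le
    have h2 := hFm (hJ t ht) hbI ht.2.le
    rw [haF] at h1; rw [hbF] at h2
    refine ⟨lt_of_le_of_ne h1 fun h => ?_, lt_of_le_of_ne h2 fun h => ?_⟩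
    · exact absurd (hamax ⟨hJ t ht, h.symm⟩) (not_le.2 ht.1)
    · exact absurd (hbmin ⟨hJ t ht, h⟩) (not_le.2 ht.2)
  have hzJ : ∀ t ∈ Ioo a b, z t ∈ Ioo A B ∧ HasDerivAt z (ρ t / k (z t)) t := by
    intro t ht
    have hFt := hFJ t ht
    have hzt : z t ∈ Ioo A B := by
      simp only [hz]; rw [hPid t (hJ t ht)]
      constructor
      · rw [← e.symm_apply_apply A, heA]; exact e.symm.strictMono hFt.1
      · rw [← e.symm_apply_apply B, heB]; exact e.symm.strictMono hFt.2
    refine ⟨hzt, ?_⟩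
    have hnhds : Icc α β ∈ 𝓝 t := Icc_mem_nhds (haI.1.trans_lt ht.1) (ht.2.trans_le hbI.2)
    have hFd : HasDerivAt F (ρ t) t := by
      refine intervalIntegral.integral_hasDerivAt_right (hii _ (left_mem_Icc.2 hαβ.le) _ (hJ t ht)) ?_ (hρ.continuousAt hnhds)
      exact (hρ.mono Ioo_subset_Icc_self).stronglyMeasurableAtFilter isOpen_Ioo t
        ⟨haI.1.trans_lt ht.1, ht.2.trans_le hbI.2⟩
    have hsd : HasDerivAt e.symm (k (z t))⁻¹ (F t) := by
      refine HasDerivAt.of_local_left_inverse (f := e) e.symm.continuous.continuousAt ?_ (hkpos _ hzt).ne' (Eventually.of_forall fun y => e.apply_symm_apply y)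
      have := hed _ hzt
      simp only [hz, hPid t (hJ t ht)] at this ⊢
      exact this
    have hcomp : HasDerivAt (fun s => e.symm (F s)) ((k (z t))⁻¹ * ρ t) t := hsd.comp t hFd
    rw [div_eq_inv_mul]
    refine hcomp.congr_of_eventuallyEq ?_
    filter_upwards [hnhds] with y hy
    simp only [hz, hPid y hy]
  have hza : z a = A := by
    simp only [hz]; rw [hPid a haI, haF, ← heA, e.symm_apply_apply]
  have hzb : z b = B := by
    simp only [hz]; rw [hPid b hbI, hbF, ← heB, e.symm_apply_apply]
  have hzero : ∀ s ∈ Icc α β, ∀ t ∈ Icc α β, s < t → F s = F t → ∀ x ∈ Icc s t, ρ x = 0 := by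
    intro s hs t ht hst hFst x hx
    have hxI : x ∈ Icc α β := ⟨hs.1.trans hx.1, hx.2.trans ht.2⟩
    by_contra hne
    have hpos : 0 < ρ x := lt_of_le_of_ne (hρ0 x hxI) (Ne.symm hne)
    have h0 : 0 < ∫ y in s..t, ρ y := intervalIntegral.integral_pos hst
      (hρ.mono (Icc_subset_Icc hs.1 ht.2)) (fun y hy => hρ0 y ⟨hs.1.trans hy.1.le, hy.2.trans ht.2⟩) ⟨x, hx, hpos⟩
    have : F t - F s = ∫ x in s..t, ρ x :=
      intervalIntegral.integral_interval_sub_left (hii _ (left_mem_Icc.2 hαβ.le) _ ht) (hii _ (left_mem_Icc.2 hαβ.le) _ hs)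
    linarith
  have hzeroL : ∀ x ∈ Icc α a, ρ x = 0 ∨ x = α := by
    intro x hx
    rcases haI.1.eq_or_lt with h | h
    · right; rw [← h] at hx; exact le_antisymm hx.2 hx.1
    · left; exact hzero α (left_mem_Icc.2 hαβ.le) a haI h (by rw [hFα, haF]) x hx
  have hzeroR : ∀ x ∈ Icc b β, ρ x = 0 ∨ x = β := by
    intro x hx
    rcases hbI.2.eq_or_lt with h | h
    · right; rw [h] at hx; exact le_antisymm hx.2 hx.1
    · left; exact hzero b hbI β (right_mem_Icc.2 hαβ.le) h (by rw [hFβ, hbF]) x hx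
  refine ⟨z, a, b, haI.1, hab, hbI.2, hzc, hzIcc, hzm, hzα, hzJ, ?_, ?_, ?_⟩
  · intro t ht htn
    rcases le_or_gt t a with h | h
    · rcases hzeroL t ⟨ht.1, h⟩ with h | h <;> simp [h]
    · have : b ≤ t := by
        by_contra! h'
        exact htn ⟨h, h'⟩
      rcases hzeroR t ⟨this, ht.2⟩ with h | h <;> simp [h]
  · rw [intervalIntegrable_iff_integrableOn_Ioc_of_le hab.le]
    exact intervalIntegral.integrableOn_deriv_of_nonneg hzc.continuousOn (fun t ht => (hzJ t ht).2)
      (fun t ht => div_nonneg (hρ0 t (hJ t ht)) (hkpos _ (hzJ t ht).1).le)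
  · intro φ hφ
    have hφz : Continuous fun t => φ (z t) := hφ.comp_continuous hzc hzIcc
    have hcont : ContinuousOn (fun t => φ (z t) * ρ t) (Icc α β) := hφz.continuousOn.mul hρ
    have hI : ∀ s ∈ Icc α β, ∀ t ∈ Icc α β, IntervalIntegrable (fun t => φ (z t) * ρ t) volume s t := by
      intro s hs t ht
      exact (hcont.mono (by rw [← uIcc_of_le hαβ.le] at hs ht ⊢; exact uIcc_subset_uIcc hs ht)).intervalIntegrable
    have hαI := left_mem_Icc.2 hαβ.le
    have hβI := right_mem_Icc.2 hαβ.le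
    have hL : ∫ t in α..a, φ (z t) * ρ t = 0 := by
      refine intervalIntegral.integral_zero_ae (Eventually.of_forall fun x hx => ?_)
      rw [uIoc_of_le haI.1] at hx
      rcases hzeroL x ⟨hx.1.le, hx.2⟩ with h | h
      · simp [h]
      · exact absurd h hx.1.ne'
    have hR : ∫ t in b..β, φ (z t) * ρ t = 0 := by
      have : ∀ᵐ x : ℝ, x ≠ β := by simp [ae_iff]
      refine intervalIntegral.integral_zero_ae (this.mono fun x hxβ hx => ?_)
      rw [uIoc_of_le hbI.2] at hx
      rcases hzeroR x ⟨hx.1.le, hx.2⟩ with h | h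
      · simp [h]
      · exact absurd h hxβ
    rw [← intervalIntegral.integral_add_adjacent_intervals (hI α hαI a haI) (hI a haI β hβI),
      ← intervalIntegral.integral_add_adjacent_intervals (hI a haI b hbI) (hI b hbI β hβI), hL, hR, zero_add, add_zero]
    have hcong : ∫ t in a..b, φ (z t) * ρ t = ∫ t in a..b, ((fun x => φ x * k x) ∘ z) t * (ρ t / k (z t)) := by
      have : ∀ᵐ x : ℝ, x ≠ b := by simp [ae_iff]
      refine intervalIntegral.integral_congr_ae (this.mono fun x hxb hx => ?_)
      rw [uIoc_of_le hab.le] at hx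
      have := (hkpos _ (hzJ x ⟨hx.1, lt_of_le_of_ne hx.2 hxb⟩).1).ne'
      simp only [Function.comp]
      field_simp
    have himg : z '' uIcc a b ⊆ Icc A B := by
      rintro _ ⟨x, -, rfl⟩; exact hzIcc x
    have hcg : ContinuousOn (fun x => φ x * k x) (Icc A B) := hφ.mul hk
    rw [hcong, intervalIntegral.integral_comp_mul_deriv''' hzc.continuousOn
      (fun x hx => ((hzJ x (by simpa [hab.le] using hx)).2).hasDerivWithinAt) (hcg.mono ?_) ?_ ?_, hza, hzb]
    · rintro _ ⟨x, -, rfl⟩; exact hzIcc x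
    · exact (hcg.integrableOn_Icc).mono_set himg
    · rw [uIcc_of_le hab.le, integrableOn_Icc_iff_integrableOn_Ioo]
      have h0 : IntegrableOn (fun t => φ (z t) * ρ t) (Ioo a b) :=
        (hcont.mono (Icc_subset_Icc haI.1 hbI.2)).integrableOn_Icc.mono_set Ioo_subset_Icc_self
      refine h0.congr_fun (fun x hx => ?_) measurableSet_Ioo
      have := (hkpos _ (hzJ x hx).1).ne'
      simp only [Function.comp]
      field_simp

/-- Euclidean space of dimension `m`. -/
abbrev Euc (m : ℕ) : Type := EuclideanSpace ℝ (Fin m)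

/-- Splitting off the first coordinate of Euclidean space. -/
noncomputable def consE (m : ℕ) : (ℝ × Euc m) ≃L[ℝ] Euc (m + 1) :=
  ((ContinuousLinearEquiv.refl ℝ ℝ).prodCongr (PiLp.continuousLinearEquiv 2 ℝ (fun _ : Fin m => ℝ))).trans
    ((Fin.consEquivL ℝ (fun _ : Fin (m + 1) => ℝ)).trans
      (PiLp.continuousLinearEquiv 2 ℝ (fun _ : Fin (m + 1) => ℝ)).symm)

theorem consE_zero {m : ℕ} (p : ℝ × Euc m) : consE m p 0 = p.1 := rfl

theorem consE_succ {m : ℕ} (p : ℝ × Euc m) (i : Fin m) : consE m p i.succ = p.2 i := rfl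

theorem norm_sq_consE {m : ℕ} (p : ℝ × Euc m) : ‖consE m p‖ ^ 2 = p.1 ^ 2 + ‖p.2‖ ^ 2 := by
  rw [EuclideanSpace.norm_sq_eq, EuclideanSpace.norm_sq_eq, Fin.sum_univ_succ]
  simp [consE_zero, consE_succ]

theorem norm_snd_le_consE {m : ℕ} (p : ℝ × Euc m) : ‖p.2‖ ≤ ‖consE m p‖ := by
  have := norm_sq_consE p
  exact abs_le_of_sq_le_sq' (by nlinarith [sq_nonneg p.1]) (norm_nonneg _) |>.2

theorem measurePreserving_consE (m : ℕ) :
    MeasurePreserving (consE m) (volume : Measure (ℝ × Euc m)) volume := by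
  have h1 := (MeasurePreserving.id (volume : Measure ℝ)).prod (PiLp.volume_preserving_ofLp (Fin m))
  have h2 := (volume_preserving_piFinSuccAbove (fun _ : Fin (m + 1) => ℝ) 0).symm
  have h3 := PiLp.volume_preserving_toLp (Fin (m + 1))
  have h := h3.comp (h2.comp h1)
  have he : (consE m : ℝ × Euc m → Euc (m + 1)) = WithLp.toLp 2 ∘
      ((MeasurableEquiv.piFinSuccAbove (fun _ : Fin (m + 1) => ℝ) 0).symm ∘
        Prod.map id WithLp.ofLp) := by
    funext p
    ext i
    refine Fin.cases ?_ (fun i => ?_) i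
    · simp [consE_zero, MeasurableEquiv.piFinSuccAbove, Fin.insertNthEquiv]
    · simp [consE_succ, MeasurableEquiv.piFinSuccAbove, Fin.insertNthEquiv]
  rw [he]
  exact h

theorem integral_eq_integral_consE {m : ℕ} {F : Euc (m + 1) → ℝ} (hF : Integrable F) :
    ∫ x, F x = ∫ t : ℝ, ∫ y : Euc m, F (consE m (t, y)) := by
  have hme : MeasurableEmbedding (consE m) :=
    (consE m).toHomeomorph.measurableEmbedding
  rw [← (measurePreserving_consE m).integral_comp hme]
  have hi : Integrable (fun p => F (consE m p)) (volume : Measure (ℝ × Euc m)) :=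
    ((measurePreserving_consE m).integrable_comp_emb hme).2 hF
  exact integral_prod _ hi

theorem exists_slice_bound {m : ℕ} {F : Euc (m + 1) → ℝ} (hF : HasCompactSupport F) :
    ∃ R : ℝ, ∀ t : ℝ, ∀ y : Euc m, y ∉ Metric.closedBall (0 : Euc m) R → F (consE m (t, y)) = 0 := by
  obtain ⟨R, hR⟩ := hF.isCompact.isBounded.subset_closedBall 0
  refine ⟨R, fun t y hy => ?_⟩
  by_contra h
  have := hR (subset_tsupport _ h)
  rw [mem_closedBall_zero_iff] at this hy
  exact hy ((norm_snd_le_consE (t, y)).trans this)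

theorem hasCompactSupport_slice {m : ℕ} {F : Euc (m + 1) → ℝ} (hF : HasCompactSupport F) (t : ℝ) :
    HasCompactSupport fun y => F (consE m (t, y)) := by
  obtain ⟨R, hR⟩ := exists_slice_bound hF
  exact HasCompactSupport.of_support_subset_isCompact (isCompact_closedBall (0 : Euc m) R)
    (fun y hy => by by_contra h; exact hy (hR t y h))

theorem continuous_slice_integral {m : ℕ} {F : Euc (m + 1) → ℝ} (hc : Continuous F)
    (hF : HasCompactSupport F) : Continuous fun t : ℝ => ∫ y : Euc m, F (consE m (t, y)) := by
  obtain ⟨R, hR⟩ := exists_slice_bound hF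
  have h : ∀ t : ℝ, ∫ y : Euc m, F (consE m (t, y)) =
      ∫ y in Metric.closedBall (0 : Euc m) R, F (consE m (t, y)) := fun t =>
    (setIntegral_eq_integral_of_forall_compl_eq_zero fun y hy => hR t y hy).symm
  simp_rw [h]
  refine continuous_parametric_integral_of_continuous (f := fun (t : ℝ) (y : Euc m) => F (consE m (t, y))) ?_ (isCompact_closedBall _ _)
  exact hc.comp (consE m).continuous

theorem hasDerivAt_slice {m : ℕ} {f : Euc (m + 1) → ℝ} (hf : Differentiable ℝ f) (t : ℝ) (y : Euc m) :
    HasDerivAt (fun t => f (consE m (t, y))) (fderiv ℝ f (consE m (t, y)) (consE m (1, 0))) t := by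
  have h1 : HasDerivAt (fun t : ℝ => consE m (t, y)) (consE m (1, 0)) t := by
    have := ((hasDerivAt_id t).prodMk (hasDerivAt_const t y))
    exact ((consE m).toContinuousLinearMap.hasFDerivAt.comp_hasDerivAt t this)
  exact (hf _).hasFDerivAt.comp_hasDerivAt t h1

theorem hasDerivAt_slice_integral {m : ℕ} {f : Euc (m + 1) → ℝ} (hf : ContDiff ℝ 1 f)
    (hs : HasCompactSupport f) (t : ℝ) :
    HasDerivAt (fun t : ℝ => ∫ y : Euc m, f (consE m (t, y)))
      (∫ y : Euc m, fderiv ℝ f (consE m (t, y)) (consE m (1, 0))) t := by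
  obtain ⟨R, hR⟩ := exists_slice_bound hs
  have hd' : Continuous fun x => fderiv ℝ f x (consE m (1, 0)) :=
    (hf.continuous_fderiv one_ne_zero).clm_apply continuous_const
  have hs' : HasCompactSupport fun x => fderiv ℝ f x (consE m (1, 0)) :=
    hs.fderiv_apply ℝ _
  have hInt : ∀ (F : Euc (m + 1) → ℝ), Continuous F → HasCompactSupport F → ∀ t : ℝ,
      Integrable fun y => F (consE m (t, y)) := fun F hc hF t =>
    (hc.comp ((consE m).continuous.comp (by fun_prop))).integrable_of_hasCompactSupport
      (hasCompactSupport_slice hF t)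
  obtain ⟨R', hR'⟩ := exists_slice_bound hs'
  obtain ⟨C, hC⟩ := hs'.exists_bound_of_continuous hd'
  refine (hasDerivAt_integral_of_dominated_loc_of_deriv_le (s := univ)
    (bound := (Metric.closedBall (0 : Euc m) R').indicator fun _ => C) univ_mem ?_ (hInt f hf.continuous hs t)
    (F' := fun t y => fderiv ℝ f (consE m (t, y)) (consE m (1, 0)))
    (hInt _ hd' hs' t).aestronglyMeasurable ?_ ?_ ?_).2
  · exact Eventually.of_forall fun s => (hInt f hf.continuous hs s).aestronglyMeasurable
  · refine Eventually.of_forall fun y s _ => ?_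
    by_cases hy : y ∈ Metric.closedBall (0 : Euc m) R'
    · rw [indicator_of_mem hy]; exact hC _
    · rw [indicator_of_notMem hy, hR' s y hy, norm_zero]
  · exact (integrable_indicator_iff measurableSet_closedBall).2 (integrableOn_const (measure_closedBall_lt_top.ne) (by simp))
  · exact Eventually.of_forall fun y s _ => hasDerivAt_slice (hf.differentiable one_ne_zero) s y

theorem slice_gradient_le {m : ℕ} (f : Euc (m + 1) → ℝ) (hf : Differentiable ℝ f) (t : ℝ) (y : Euc m)
    {r z : ℝ} (hr : 0 ≤ r) (hrz : r ^ 2 + z ^ 2 = 1) :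
    r * ‖fderiv ℝ (fun y => f (consE m (t, y))) y‖ - z * fderiv ℝ f (consE m (t, y)) (consE m (1, 0)) ≤
      ‖fderiv ℝ f (consE m (t, y))‖ := by
  set L := fderiv ℝ f (consE m (t, y)) with hL
  have h1 : HasFDerivAt (fun y => f (consE m (t, y)))
      (L.comp ((consE m).toContinuousLinearMap.comp (ContinuousLinearMap.inr ℝ ℝ (Euc m)))) y := by
    have := ((consE m).toContinuousLinearMap.hasFDerivAt (x := (t, y))).comp y (hasFDerivAt_prodMk_right t y)
    exact (hf _).hasFDerivAt.comp y this
  rw [h1.fderiv]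
  set T := L.comp ((consE m).toContinuousLinearMap.comp (ContinuousLinearMap.inr ℝ ℝ (Euc m)))
  have key : ∀ v : Euc m, ‖v‖ ≤ 1 → r * T v ≤ ‖L‖ + z * L (consE m (1, 0)) := by
    intro v hv
    have h2 : ‖consE m (-z, r • v)‖ ≤ 1 := by
      have := norm_sq_consE ((-z, r • v) : ℝ × Euc m)
      rw [norm_smul, Real.norm_of_nonneg hr] at this
      have hv2 : ‖v‖ ^ 2 ≤ 1 := by nlinarith [norm_nonneg v]
      have : ‖consE m (-z, r • v)‖ ^ 2 ≤ 1 := by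
        rw [this]; nlinarith [mul_le_mul_of_nonneg_left hv2 (sq_nonneg r)]
      nlinarith [norm_nonneg (consE m (-z, r • v))]
    have h3 : L (consE m (-z, r • v)) = -z * L (consE m (1, 0)) + r * T v := by
      have : ((-z, r • v) : ℝ × Euc m) = (-z) • ((1, 0) : ℝ × Euc m) + r • ((0, v) : ℝ × Euc m) := by
        ext <;> simp
      rw [this, map_add, map_smul, map_smul, map_add, map_smul, map_smul]
      rfl
    have h4 := L.le_of_opNorm_le_of_le le_rfl h2
    have h5 := le_abs_self (L (consE m (-z, r • v)))
    rw [Real.norm_eq_abs] at h4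
    linarith
  rcases hr.eq_or_lt with h0 | h0
  · have := key 0 (by simp)
    rw [← h0] at this ⊢
    linarith
  · have hle : ‖T‖ ≤ (‖L‖ + z * L (consE m (1, 0))) / r := by
      refine ContinuousLinearMap.opNorm_le_of_unit_norm ?_ ?_
      · have := key 0 (by simp)
        simp at this
        positivity
      · intro v hv
        rw [le_div_iff₀ h0, Real.norm_eq_abs]
        rcases abs_cases (T v) with ⟨h, _⟩ | ⟨h, _⟩
        · rw [h]; have := key v hv.le; linarith
        · rw [h]; have := key (-v) (by rw [norm_neg]; exact hv.le)
          rw [map_neg] at this; linarith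
    rw [le_div_iff₀ h0] at hle
    linarith

theorem unitBallVol_pos (n : ℕ) : 0 < unitBallVol n := by
  unfold unitBallVol
  have : 0 < Real.Gamma ((n : ℝ) / 2 + 1) := Real.Gamma_pos_of_pos (by positivity)
  positivity

theorem volume_real_closedBall_euc {m : ℕ} (hm : 1 ≤ m) {r : ℝ} (hr : 0 ≤ r) :
    volume.real (Metric.closedBall (0 : Euc m) r) = unitBallVol m * r ^ m := by
  have : Nonempty (Fin m) := ⟨⟨0, hm⟩⟩
  rw [measureReal_def, EuclideanSpace.volume_closedBall, ENNReal.toReal_mul, ENNReal.toReal_pow,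
    ENNReal.toReal_ofReal hr, ENNReal.toReal_ofReal, Fintype.card_fin, mul_comm]
  · congr 1
    unfold unitBallVol
    rw [Real.sqrt_eq_rpow, ← Real.rpow_natCast, ← Real.rpow_mul pi_pos.le]
    congr 2; ring
  · have : 0 < Real.Gamma ((Fintype.card (Fin m) : ℝ) / 2 + 1) := Real.Gamma_pos_of_pos (by positivity)
    positivity

theorem unitBallVol_one : unitBallVol 1 = 2 := by
  have h : Real.Gamma ((1 : ℝ) / 2 + 1) = 1 / 2 * √π := by
    rw [Real.Gamma_add_one (by norm_num), Real.Gamma_one_half_eq]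
  unfold unitBallVol
  rw [Nat.cast_one, h, ← Real.sqrt_eq_rpow]
  have : √π ≠ 0 := by positivity
  field_simp

theorem unitBallVol_succ {m : ℕ} (hm : 1 ≤ m) :
    unitBallVol (m + 1) = ∫ z in (-1 : ℝ)..1, unitBallVol m * √(1 - z ^ 2) ^ m := by
  have h1 := volume_real_closedBall_euc (m := m + 1) (by omega) zero_le_one
  rw [one_pow, mul_one] at h1
  have hi : Integrable ((Metric.closedBall (0 : Euc (m + 1)) 1).indicator fun _ => (1 : ℝ)) :=
    (integrable_indicator_iff measurableSet_closedBall).2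
      (integrableOn_const (measure_closedBall_lt_top.ne) (by simp))
  have h2 := integral_eq_integral_consE hi
  rw [integral_indicator measurableSet_closedBall, setIntegral_const, smul_eq_mul, mul_one, h1] at h2
  rw [h2, intervalIntegral.integral_of_le (by norm_num), ← integral_Icc_eq_integral_Ioc,
    ← integral_indicator measurableSet_Icc]
  congr 1
  ext t
  by_cases ht : t ∈ Icc (-1 : ℝ) 1
  · have ht2 : 0 ≤ 1 - t ^ 2 := by nlinarith [ht.1, ht.2]
    rw [indicator_of_mem ht, ← volume_real_closedBall_euc hm (Real.sqrt_nonneg _)]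
    have : (fun y => (Metric.closedBall (0 : Euc (m + 1)) 1).indicator (fun _ => (1 : ℝ)) (consE m (t, y))) =
        (Metric.closedBall (0 : Euc m) √(1 - t ^ 2)).indicator fun _ => (1 : ℝ) := by
      ext y
      have hiff : consE m (t, y) ∈ Metric.closedBall (0 : Euc (m + 1)) 1 ↔
          y ∈ Metric.closedBall (0 : Euc m) √(1 - t ^ 2) := by
        have := norm_sq_consE (t, y)
        rw [mem_closedBall_zero_iff, mem_closedBall_zero_iff, Real.le_sqrt (norm_nonneg _) ht2,
          ← sq_le_one_iff₀ (norm_nonneg _), this]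
        simp only
        constructor <;> intro h <;> linarith
      by_cases hy : y ∈ Metric.closedBall (0 : Euc m) √(1 - t ^ 2)
      · rw [indicator_of_mem hy, indicator_of_mem (hiff.2 hy)]
      · rw [indicator_of_notMem hy, indicator_of_notMem (fun h => hy (hiff.1 h))]
    rw [this, integral_indicator measurableSet_closedBall, setIntegral_const, smul_eq_mul, mul_one]
  · rw [indicator_of_notMem ht]
    refine integral_eq_zero_of_ae (Eventually.of_forall fun y => indicator_of_notMem ?_ _)
    intro h
    have := norm_sq_consE (t, y)
    rw [mem_closedBall_zero_iff, ← sq_le_one_iff₀ (norm_nonneg _), this] at h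
    refine ht (abs_le.1 ?_)
    rw [← sq_le_one_iff_abs_le_one]
    simp only at h
    nlinarith [sq_nonneg ‖y‖]

/-- The functional form of the Euclidean isoperimetric inequality in dimension `m`. -/
def FunctionalIsoperimetric (m : ℕ) : Prop :=
  ∀ f : Euc m → ℝ, ContDiff ℝ 1 f → HasCompactSupport f → (∀ x, 0 ≤ f x) →
    m * unitBallVol m ^ (1 / (m : ℝ)) * ∫ x, f x ^ (1 + 1 / (m : ℝ)) ≤
      (∫ x, ‖fderiv ℝ f x‖) * (∫ x, f x) ^ (1 / (m : ℝ))

theorem weighted_am_gm_pow {m : ℕ} {X Z : ℝ} (hX : 0 ≤ X) (hZ : 0 ≤ Z) :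
    ((m : ℝ) + 1) * (X ^ m * Z) ^ (1 / ((m : ℝ) + 1)) ≤ m * X + Z := by
  have hn : (0 : ℝ) < (m : ℝ) + 1 := by positivity
  have h := Real.geom_mean_le_arith_mean2_weighted (w₁ := m / ((m : ℝ) + 1)) (w₂ := 1 / ((m : ℝ) + 1))
    (by positivity) (by positivity) hX hZ (by field_simp)
  rw [Real.mul_rpow (by positivity) hZ, ← Real.rpow_natCast, ← Real.rpow_mul hX, mul_one_div]
  calc _ ≤ ((m : ℝ) + 1) * (m / ((m : ℝ) + 1) * X + 1 / ((m : ℝ) + 1) * Z) :=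
        mul_le_mul_of_nonneg_left h hn.le
    _ = _ := by field_simp

/-- The pointwise estimate behind the slicing argument, with `w = f y`, `M` the slice mass, `T` the
weight and `g` the density. -/
theorem slice_am_gm {m : ℕ} (hm : 1 ≤ m) {σ M T g r w : ℝ} (hσ : 0 < σ) (hM : 0 < M) (hT : 0 < T)
    (hg : 0 < g) (hr : 0 < r) (hw : 0 ≤ w) :
    ((m : ℝ) + 1) * (w ^ (1 + 1 / ((m : ℝ) + 1)) * g ^ (-(1 / ((m : ℝ) + 1))) * T ^ (((m : ℝ) + 1) / m)) ≤
      T * (r * (m * σ ^ (1 / (m : ℝ)) * w ^ (1 + 1 / (m : ℝ)) / M ^ (1 / (m : ℝ))) +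
        w * (M * T ^ (((m : ℝ) + 1) / m) / (σ * r ^ m * g))) := by
  have hm0 : (0 : ℝ) < m := by exact_mod_cast hm
  rcases hw.eq_or_lt with h0 | hw
  · rw [← h0, Real.zero_rpow (by positivity), Real.zero_rpow (by positivity)]; simp
  set X := r * (σ ^ (1 / (m : ℝ)) * w ^ (1 / (m : ℝ)) / M ^ (1 / (m : ℝ)))
  set Z := M * T ^ (((m : ℝ) + 1) / m) / (σ * r ^ m * g)
  have hX : 0 ≤ X := by positivity
  have hZ : 0 ≤ Z := by positivity
  have h := weighted_am_gm_pow (m := m) hX hZ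
  have hXm : X ^ m * Z = w * T ^ (((m : ℝ) + 1) / m) * g⁻¹ := by
    simp only [X, Z]
    have e : ∀ s : ℝ, 0 < s → (s ^ (1 / (m : ℝ))) ^ m = s := fun s hs => by
      rw [← Real.rpow_natCast, ← Real.rpow_mul hs.le, one_div_mul_cancel hm0.ne', Real.rpow_one]
    rw [mul_pow, div_pow, mul_pow, e σ hσ, e w hw, e M hM]
    field_simp
  have hXm2 : (X ^ m * Z) ^ (1 / ((m : ℝ) + 1)) =
      w ^ (1 / ((m : ℝ) + 1)) * g ^ (-(1 / ((m : ℝ) + 1))) * T ^ (1 / (m : ℝ)) := by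
    rw [hXm, Real.mul_rpow (by positivity) (by positivity), Real.mul_rpow (by positivity) (by positivity),
      Real.inv_rpow hg.le, Real.rpow_neg hg.le, ← Real.rpow_mul hT.le]
    have : ((m : ℝ) + 1) / m * (1 / ((m : ℝ) + 1)) = 1 / m := by field_simp
    rw [this]; ring
  have e1 : w ^ (1 + 1 / ((m : ℝ) + 1)) = w * w ^ (1 / ((m : ℝ) + 1)) := by
    rw [Real.rpow_add hw, Real.rpow_one]
  have e2 : w ^ (1 + 1 / (m : ℝ)) = w * w ^ (1 / (m : ℝ)) := by
    rw [Real.rpow_add hw, Real.rpow_one]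
  have e3 : T ^ (((m : ℝ) + 1) / m) = T * T ^ (1 / (m : ℝ)) := by
    rw [show ((m : ℝ) + 1) / m = 1 + 1 / m by field_simp, Real.rpow_add hT, Real.rpow_one]
  rw [hXm2] at h
  calc _ = T * w * (((m : ℝ) + 1) * (w ^ (1 / ((m : ℝ) + 1)) * g ^ (-(1 / ((m : ℝ) + 1))) * T ^ (1 / (m : ℝ)))) := by
        rw [e1, e3]; ring
    _ ≤ T * w * (m * X + Z) := mul_le_mul_of_nonneg_left h (by positivity)
    _ = _ := by rw [e2]; simp only [X]; ring

theorem integral_mul_coord_zero {m : ℕ} {F : Euc (m + 1) → ℝ} (hc : Continuous F)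
    (hs : HasCompactSupport F) {w : ℝ → ℝ} (hw : Continuous w) :
    ∫ x, F x * w (x 0) = ∫ t : ℝ, w t * ∫ y : Euc m, F (consE m (t, y)) := by
  have hi : Integrable fun x : Euc (m + 1) => F x * w (x 0) :=
    (hc.mul (hw.comp (by fun_prop))).integrable_of_hasCompactSupport hs.mul_right
  rw [integral_eq_integral_consE hi]
  congr 1
  ext t
  rw [← integral_const_mul]
  congr 1
  ext y
  rw [consE_zero, mul_comm]

theorem integral_eq_intervalIntegral_of_eq_zero {S : ℝ → ℝ} {α β : ℝ} (hαβ : α ≤ β)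
    (h : ∀ t ∉ Ioo α β, S t = 0) : ∫ t, S t = ∫ t in α..β, S t := by
  rw [intervalIntegral.integral_of_le hαβ]
  exact (setIntegral_eq_integral_of_forall_compl_eq_zero fun t ht =>
    h t fun h' => ht (Ioo_subset_Ioc_self h')).symm

theorem eq_zero_of_integral_slice_eq_zero {m : ℕ} {f : Euc (m + 1) → ℝ} (hc : Continuous f)
    (hs : HasCompactSupport f) (hf0 : ∀ x, 0 ≤ f x) {t : ℝ}
    (h : ∫ y : Euc m, f (consE m (t, y)) = 0) (y : Euc m) : f (consE m (t, y)) = 0 := by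
  have hcs : Continuous fun y : Euc m => f (consE m (t, y)) :=
    hc.comp ((consE m).continuous.comp (by fun_prop))
  have := (integral_eq_zero_iff_of_nonneg (fun y => hf0 (consE m (t, y)))
    (hcs.integrable_of_hasCompactSupport (hasCompactSupport_slice hs t))).1 h
  exact congrFun ((hcs.ae_eq_iff_eq volume continuous_const).1 this) y

theorem slice_lower_bound {m : ℕ} (hm : 1 ≤ m) (hiso : FunctionalIsoperimetric m)
    {f : Euc (m + 1) → ℝ} (hf : ContDiff ℝ 1 f) (hs : HasCompactSupport f) (hf0 : ∀ x, 0 ≤ f x)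
    (t : ℝ) {z g T : ℝ} (hz : z ∈ Ioo (-1 : ℝ) 1) (hg : 0 < g) (hT : 0 < T) :
    ((m : ℝ) + 1) * ((∫ y, f (consE m (t, y)) ^ (1 + 1 / ((m : ℝ) + 1))) *
        g ^ (-(1 / ((m : ℝ) + 1))) * T ^ (((m : ℝ) + 1) / m)) ≤
      T * ((∫ y, ‖fderiv ℝ f (consE m (t, y))‖) + z * (∫ y, fderiv ℝ f (consE m (t, y)) (consE m (1, 0))) +
        (∫ y, f (consE m (t, y))) * ((∫ y, f (consE m (t, y))) * T ^ (((m : ℝ) + 1) / m) /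
          (unitBallVol m * √(1 - z ^ 2) ^ m * g))) := by
  have hm0 : (0 : ℝ) < m := by exact_mod_cast hm
  have hσ := unitBallVol_pos m
  have hz2 : 0 < 1 - z ^ 2 := by nlinarith [hz.1, hz.2]
  set r := √(1 - z ^ 2) with hr
  have hr0 : 0 < r := Real.sqrt_pos.2 hz2
  have hrz : r ^ 2 + z ^ 2 = 1 := by rw [hr, Real.sq_sqrt hz2.le]; ring
  have hsl : Continuous fun y : Euc m => consE m (t, y) := (consE m).continuous.comp (by fun_prop)
  have hInt : ∀ (F : Euc (m + 1) → ℝ), Continuous F → HasCompactSupport F →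
      Integrable fun y => F (consE m (t, y)) := fun F hc hF =>
    (hc.comp hsl).integrable_of_hasCompactSupport (hasCompactSupport_slice hF t)
  have hd' : Continuous fun x => fderiv ℝ f x := hf.continuous_fderiv one_ne_zero
  have hfs : ContDiff ℝ 1 fun y : Euc m => f (consE m (t, y)) :=
    hf.comp ((consE m).contDiff.comp (contDiff_prodMk_right t))
  have hss := hasCompactSupport_slice hs t
  have hi1 : Integrable fun y => ‖fderiv ℝ f (consE m (t, y))‖ :=
    hInt (fun x => ‖fderiv ℝ f x‖) hd'.norm (hs.fderiv ℝ).norm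
  have hi2 : Integrable fun y => fderiv ℝ f (consE m (t, y)) (consE m (1, 0)) :=
    hInt (fun x => fderiv ℝ f x (consE m (1, 0))) (hd'.clm_apply continuous_const) (hs.fderiv_apply ℝ _)
  have hi3 : Integrable fun y => ‖fderiv ℝ (fun y => f (consE m (t, y))) y‖ :=
    (hfs.continuous_fderiv one_ne_zero).norm.integrable_of_hasCompactSupport (hss.fderiv ℝ).norm
  have hA : r * (∫ y, ‖fderiv ℝ (fun y => f (consE m (t, y))) y‖) ≤
      (∫ y, ‖fderiv ℝ f (consE m (t, y))‖) + z * (∫ y, fderiv ℝ f (consE m (t, y)) (consE m (1, 0))) := by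
    rw [← integral_const_mul, ← integral_const_mul, ← integral_add hi1 (hi2.const_mul z)]
    refine integral_mono (hi3.const_mul r) (hi1.add (hi2.const_mul z)) fun y => ?_
    have := slice_gradient_le f (hf.differentiable one_ne_zero) t y hr0.le hrz
    linarith
  set M := ∫ y, f (consE m (t, y)) with hM
  have hM0 : 0 ≤ M := integral_nonneg fun y => hf0 _
  rcases hM0.eq_or_lt with h0 | hMpos
  · have hz0 := eq_zero_of_integral_slice_eq_zero hf.continuous hs hf0 h0.symm
    have : ∫ y : Euc m, f (consE m (t, y)) ^ (1 + 1 / ((m : ℝ) + 1)) = 0 := by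
      simp_rw [hz0]
      rw [Real.zero_rpow (by positivity)]; simp
    rw [this, ← h0]
    have h1 : 0 ≤ r * (∫ y, ‖fderiv ℝ (fun y => f (consE m (t, y))) y‖) :=
      mul_nonneg hr0.le (integral_nonneg fun y => norm_nonneg _)
    simp only [zero_mul, mul_zero, add_zero]
    exact mul_nonneg hT.le (h1.trans hA)
  · have hpw : ∀ q : ℝ, 0 < q → Integrable fun y => f (consE m (t, y)) ^ (1 + q) := fun q hq =>
      hInt (fun x => f x ^ (1 + q)) (hf.continuous.rpow_const fun _ => Or.inr (by positivity))
        (hs.comp_left (g := fun s : ℝ => s ^ (1 + q)) (Real.zero_rpow (by positivity)))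
    have hN := hiso _ hfs hss fun y => hf0 _
    rw [← hM] at hN
    have hMp : 0 < M ^ (1 / (m : ℝ)) := by positivity
    rw [← div_le_iff₀ hMp] at hN
    have hB : ((m : ℝ) + 1) * ((∫ y, f (consE m (t, y)) ^ (1 + 1 / ((m : ℝ) + 1))) *
        g ^ (-(1 / ((m : ℝ) + 1))) * T ^ (((m : ℝ) + 1) / m)) ≤
        T * (r * (m * unitBallVol m ^ (1 / (m : ℝ)) * (∫ y, f (consE m (t, y)) ^ (1 + 1 / (m : ℝ))) /
          M ^ (1 / (m : ℝ))) + M * (M * T ^ (((m : ℝ) + 1) / m) / (unitBallVol m * r ^ m * g))) := by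
      have hle := integral_mono
        (f := fun y => ((m : ℝ) + 1) * (f (consE m (t, y)) ^ (1 + 1 / ((m : ℝ) + 1)) *
          g ^ (-(1 / ((m : ℝ) + 1))) * T ^ (((m : ℝ) + 1) / m)))
        (g := fun y => T * (r * (m * unitBallVol m ^ (1 / (m : ℝ)) * f (consE m (t, y)) ^ (1 + 1 / (m : ℝ)) /
          M ^ (1 / (m : ℝ))) + f (consE m (t, y)) * (M * T ^ (((m : ℝ) + 1) / m) / (unitBallVol m * r ^ m * g))))
        ((((hpw _ (by positivity)).mul_const _).mul_const _).const_mul _)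
        ((((((hpw _ (by positivity)).const_mul _).div_const _).const_mul _).add
          ((hInt f hf.continuous hs).mul_const _)).const_mul _)
        fun y => slice_am_gm hm hσ hMpos hT hg hr0 (hf0 _)
      rw [integral_const_mul, integral_mul_const, integral_mul_const, integral_const_mul, integral_add,
        integral_const_mul, integral_div, integral_const_mul, integral_mul_const] at hle
      · exact hle
      · exact (((hpw _ (by positivity)).const_mul _).div_const _).const_mul _
      · exact (hInt f hf.continuous hs).mul_const _
    refine hB.trans (mul_le_mul_of_nonneg_left ?_ hT.le)
    have := mul_le_mul_of_nonneg_left hN hr0.le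
    linarith

theorem exists_slice_transport {m : ℕ} (hm : 1 ≤ m) (hiso : FunctionalIsoperimetric m)
    {f : Euc (m + 1) → ℝ} (hf : ContDiff ℝ 1 f) (hs : HasCompactSupport f) (hf0 : ∀ x, 0 ≤ f x)
    {α β : ℝ} (hαβ : α < β) (hsupp : ∀ x, f x ≠ 0 → x 0 ∈ Ioo α β)
    {τ τ' : ℝ → ℝ} (hτc : Continuous τ) (hτ0 : ∀ t, 0 < τ t) (hτc' : Continuous τ')
    (hτd : ∀ t ∈ Ioo α β, HasDerivAt τ (τ' t) t)
    {G : ℝ → ℝ} (hG : ContinuousOn G (Icc (-1) 1)) (hG0 : ∀ z ∈ Icc (-1 : ℝ) 1, 0 < G z)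
    (hmass : ∫ x, f x * τ (x 0) ^ (((m : ℝ) + 1) / m) =
      ∫ z in (-1 : ℝ)..1, unitBallVol m * √(1 - z ^ 2) ^ m * G z) :
    ∃ z : ℝ → ℝ, Continuous z ∧ (∀ t, z t ∈ Icc (-1 : ℝ) 1) ∧
      (∀ φ : ℝ → ℝ, ContinuousOn φ (Icc (-1) 1) →
        ∫ x, f x * (φ (z (x 0)) * τ (x 0) ^ (((m : ℝ) + 1) / m)) =
          ∫ z in (-1 : ℝ)..1, φ z * (unitBallVol m * √(1 - z ^ 2) ^ m * G z)) ∧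
      ((m : ℝ) + 1) * (∫ x, f x ^ (1 + 1 / ((m : ℝ) + 1)) *
          (G (z (x 0)) ^ (-(1 / ((m : ℝ) + 1))) * τ (x 0) ^ (((m : ℝ) + 1) / m))) +
        ∫ x, f x * (z (x 0) * τ' (x 0)) ≤ ∫ x, ‖fderiv ℝ f x‖ * τ (x 0) := by
  have hm0 : (0 : ℝ) < m := by exact_mod_cast hm
  have hσ := unitBallVol_pos m
  have hτhat : Continuous fun t => τ t ^ (((m : ℝ) + 1) / m) :=
    hτc.rpow_const fun t => Or.inl (hτ0 t).ne'
  have hτhat0 : ∀ t, 0 < τ t ^ (((m : ℝ) + 1) / m) := fun t => Real.rpow_pos_of_pos (hτ0 t) _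
  have hd' : Continuous fun x => fderiv ℝ f x := hf.continuous_fderiv one_ne_zero
  set M : ℝ → ℝ := fun t => ∫ y : Euc m, f (consE m (t, y)) with hMdef
  set A : ℝ → ℝ := fun t => ∫ y : Euc m, ‖fderiv ℝ f (consE m (t, y))‖ with hAdef
  set M' : ℝ → ℝ := fun t => ∫ y : Euc m, fderiv ℝ f (consE m (t, y)) (consE m (1, 0)) with hM'def
  set E : ℝ → ℝ := fun t => ∫ y : Euc m, f (consE m (t, y)) ^ (1 + 1 / ((m : ℝ) + 1)) with hEdef
  have hfp : Continuous fun x => f x ^ (1 + 1 / ((m : ℝ) + 1)) :=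
    hf.continuous.rpow_const fun _ => Or.inr (by positivity)
  have hfps : HasCompactSupport fun x => f x ^ (1 + 1 / ((m : ℝ) + 1)) :=
    hs.comp_left (g := fun s : ℝ => s ^ (1 + 1 / ((m : ℝ) + 1))) (Real.zero_rpow (by positivity))
  have hMc : Continuous M := continuous_slice_integral hf.continuous hs
  have hAc : Continuous A := continuous_slice_integral (F := fun x => ‖fderiv ℝ f x‖) hd'.norm (hs.fderiv ℝ).norm
  have hM'c : Continuous M' := continuous_slice_integral (F := fun x => fderiv ℝ f x (consE m (1, 0)))
    (hd'.clm_apply continuous_const) (hs.fderiv_apply ℝ _)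
  have hEc : Continuous E := continuous_slice_integral hfp hfps
  have hM0 : ∀ t, 0 ≤ M t := fun t => integral_nonneg fun y => hf0 _
  have hA0 : ∀ t, 0 ≤ A t := fun t => integral_nonneg fun y => norm_nonneg _
  have hfout : ∀ t ∉ Ioo α β, ∀ y, f (consE m (t, y)) = 0 := fun t ht y => by
    by_contra h
    exact ht (by simpa [consE_zero] using hsupp _ h)
  have hMout : ∀ t ∉ Ioo α β, M t = 0 := fun t ht => by simp [hMdef, hfout t ht]
  have hEM : ∀ t, M t = 0 → E t = 0 := fun t ht => by
    have := eq_zero_of_integral_slice_eq_zero hf.continuous hs hf0 ht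
    simp only [hEdef, this]
    rw [Real.zero_rpow (by positivity)]; simp
  have hfubM : ∀ w : ℝ → ℝ, Continuous w → ∫ x, f x * w (x 0) = ∫ t in α..β, w t * M t := fun w hw => by
    rw [integral_mul_coord_zero hf.continuous hs hw]
    exact integral_eq_intervalIntegral_of_eq_zero hαβ.le fun t ht => by
      have := hMout t ht
      simp only [hMdef] at this
      rw [this, mul_zero]
  have hk : ContinuousOn (fun z : ℝ => unitBallVol m * √(1 - z ^ 2) ^ m * G z) (Icc (-1) 1) :=
    (Continuous.continuousOn (by fun_prop)).mul hG
  have hkpos : ∀ z ∈ Ioo (-1 : ℝ) 1, 0 < unitBallVol m * √(1 - z ^ 2) ^ m * G z := fun z hz => by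
    have : 0 < √(1 - z ^ 2) := Real.sqrt_pos.2 (by nlinarith [hz.1, hz.2])
    have := hG0 z (Ioo_subset_Icc_self hz)
    positivity
  obtain ⟨z, a, b, haα, hab, hbβ, hzc, hzI, hzmono, hzα, hzd, hzout, hzi, hzφ⟩ :=
    exists_monotone_transport hαβ (by norm_num : (-1 : ℝ) < 1)
      (ρ := fun t => M t * τ t ^ (((m : ℝ) + 1) / m)) (hMc.mul hτhat).continuousOn
      (fun t _ => mul_nonneg (hM0 t) (hτhat0 t).le) hk hkpos
      (by rw [← hmass, hfubM _ hτhat]; simp_rw [mul_comm])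
  have hMab : ∀ t ∉ Ioo a b, M t = 0 := by
    intro t ht
    by_cases htα : t ∈ Ioo α β
    · rcases hzout t (Ioo_subset_Icc_self htα) ht with h | h | h
      · exact (mul_eq_zero.1 h).resolve_right (hτhat0 t).ne'
      · exact absurd h htα.1.ne'
      · exact absurd h htα.2.ne
    · exact hMout t htα
  refine ⟨z, hzc, hzI, ?_, ?_⟩
  · intro φ hφ
    have hφz : Continuous fun t => φ (z t) := hφ.comp_continuous hzc hzI
    rw [hfubM (fun t => φ (z t) * τ t ^ (((m : ℝ) + 1) / m)) (hφz.mul hτhat), ← hzφ φ hφ]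
    congr 1; ext t; ring
  · have hGz : Continuous fun t => G (z t) ^ (-(1 / ((m : ℝ) + 1))) :=
      (hG.comp_continuous hzc hzI).rpow_const fun t => Or.inl (hG0 _ (hzI t)).ne'
    have e1 : ∫ x, f x ^ (1 + 1 / ((m : ℝ) + 1)) *
          (G (z (x 0)) ^ (-(1 / ((m : ℝ) + 1))) * τ (x 0) ^ (((m : ℝ) + 1) / m)) =
        ∫ t in a..b, G (z t) ^ (-(1 / ((m : ℝ) + 1))) * τ t ^ (((m : ℝ) + 1) / m) * E t := by
      rw [integral_mul_coord_zero hfp hfps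
        (w := fun t => G (z t) ^ (-(1 / ((m : ℝ) + 1))) * τ t ^ (((m : ℝ) + 1) / m)) (hGz.mul hτhat)]
      exact integral_eq_intervalIntegral_of_eq_zero hab.le fun t ht => by
        have := hEM t (hMab t ht)
        simp only [hEdef] at this
        rw [this, mul_zero]
    have e2 : ∫ x, f x * (z (x 0) * τ' (x 0)) = ∫ t in a..b, z t * τ' t * M t := by
      rw [integral_mul_coord_zero hf.continuous hs (w := fun t => z t * τ' t) (hzc.mul hτc')]
      exact integral_eq_intervalIntegral_of_eq_zero hab.le fun t ht => by
        have := hMab t ht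
        simp only [hMdef] at this
        rw [this, mul_zero]
    have e3 : ∫ t in a..b, τ t * A t ≤ ∫ x, ‖fderiv ℝ f x‖ * τ (x 0) := by
      rw [integral_mul_coord_zero (F := fun x => ‖fderiv ℝ f x‖) hd'.norm (hs.fderiv ℝ).norm hτc,
        intervalIntegral.integral_of_le hab.le]
      refine setIntegral_le_integral ?_ (Eventually.of_forall fun t => mul_nonneg (hτ0 t).le (hA0 t))
      refine (hτc.mul hAc).integrable_of_hasCompactSupport ?_
      obtain ⟨K, hK⟩ := (hs.fderiv ℝ).isCompact.isBounded.subset_closedBall 0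
      refine HasCompactSupport.of_support_subset_isCompact (isCompact_Icc (a := -K) (b := K)) ?_
      intro t ht
      by_contra hcon
      refine ht ?_
      have : A t = 0 := integral_eq_zero_of_ae (Eventually.of_forall fun y => by
        by_contra hne
        have hmem := hK (subset_tsupport _ (norm_ne_zero_iff.1 hne))
        rw [mem_closedBall_zero_iff] at hmem
        have h1 := norm_sq_consE (t, y)
        have h2 : t ^ 2 ≤ K ^ 2 := by
          have : ‖consE m (t, y)‖ ^ 2 ≤ K ^ 2 := pow_le_pow_left₀ (norm_nonneg _) hmem 2
          simp only at h1
          nlinarith [sq_nonneg ‖y‖]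
        have hK0 : 0 ≤ K := (norm_nonneg _).trans hmem
        exact hcon (abs_le.1 (abs_le_of_sq_le_sq h2 hK0)))
      simp [this]
    rw [e1, e2]
    refine le_trans ?_ e3
    have hz'i : IntervalIntegrable (fun t => M t * τ t ^ (((m : ℝ) + 1) / m) /
        (unitBallVol m * √(1 - z t ^ 2) ^ m * G (z t))) volume a b := hzi
    set z' : ℝ → ℝ := fun t => M t * τ t ^ (((m : ℝ) + 1) / m) /
        (unitBallVol m * √(1 - z t ^ 2) ^ m * G (z t)) with hz'def
    have hparts : ∫ t in a..b, (τ' t * M t + τ t * M' t) * z t + τ t * M t * z' t = 0 := by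
      have := intervalIntegral.integral_eq_sub_of_hasDerivAt_of_le hab.le
        (f := fun t => τ t * M t * z t) (f' := fun t => (τ' t * M t + τ t * M' t) * z t + τ t * M t * z' t)
        ((hτc.mul hMc).mul hzc).continuousOn
        (fun t ht => (((hτd t ⟨haα.trans_lt ht.1, ht.2.trans_le hbβ⟩).mul
          (hasDerivAt_slice_integral hf hs t)).mul (hzd t ht).2))
        (((((hτc'.mul hMc).add (hτc.mul hM'c)).mul hzc).intervalIntegrable _ _).add
          (hz'i.continuousOn_mul (hτc.mul hMc).continuousOn))
      rw [this, hMab a (by simp), hMab b (by simp)]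
      simp
    have hi1 : IntervalIntegrable (fun t => G (z t) ^ (-(1 / ((m : ℝ) + 1))) * τ t ^ (((m : ℝ) + 1) / m) * E t)
        volume a b := ((hGz.mul hτhat).mul hEc).intervalIntegrable _ _
    have hi2 : IntervalIntegrable (fun t => z t * τ' t * M t) volume a b :=
      ((hzc.mul hτc').mul hMc).intervalIntegrable _ _
    have hi3 : IntervalIntegrable (fun t => (τ' t * M t + τ t * M' t) * z t + τ t * M t * z' t) volume a b :=
      ((((hτc'.mul hMc).add (hτc.mul hM'c)).mul hzc).intervalIntegrable _ _).add
          (hz'i.continuousOn_mul (hτc.mul hMc).continuousOn)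
    have hi4 : IntervalIntegrable (fun t => τ t * A t) volume a b := (hτc.mul hAc).intervalIntegrable _ _
    have hmono := intervalIntegral.integral_mono_on_of_le_Ioo hab.le
      ((hi1.const_mul ((m : ℝ) + 1)).add hi2) (hi4.add hi3) fun t ht => by
        have := slice_lower_bound hm hiso hf hs hf0 t (hzd t ht).1 (hG0 _ (hzI t)) (hτ0 t)
        change ((m : ℝ) + 1) * (E t * G (z t) ^ (-(1 / ((m : ℝ) + 1))) * τ t ^ (((m : ℝ) + 1) / m)) ≤
          τ t * (A t + z t * M' t + M t * z' t) at this
        linarith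
    rw [intervalIntegral.integral_add (hi1.const_mul _) hi2, intervalIntegral.integral_add hi4 hi3, hparts,
      intervalIntegral.integral_const_mul, add_zero] at hmono
    exact hmono

theorem two_mul_le_integral_abs_deriv {g : ℝ → ℝ} (hg : ContDiff ℝ 1 g) (hs : HasCompactSupport g) (t : ℝ) :
    2 * g t ≤ ∫ s, |deriv g s| := by
  have hd : Continuous (deriv g) := hg.continuous_deriv le_rfl
  have hi : Integrable (deriv g) := hd.integrable_of_hasCompactSupport hs.deriv
  have h1 := hs.integral_Iic_deriv_eq hg t
  have h2 := hs.integral_Ioi_deriv_eq hg t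
  have h3 : ∫ s, |deriv g s| = (∫ s in Iic t, |deriv g s|) + ∫ s in Ioi t, |deriv g s| := by
    rw [← compl_Iic, integral_add_compl measurableSet_Iic hi.abs]
  have h4 := norm_integral_le_integral_norm (μ := volume.restrict (Iic t)) (deriv g)
  have h5 := norm_integral_le_integral_norm (μ := volume.restrict (Ioi t)) (deriv g)
  simp only [Real.norm_eq_abs] at h4 h5
  rw [h1] at h4
  rw [h2, abs_neg] at h5
  have := le_abs_self (g t)
  linarith

theorem exists_isometry_real_euc_one : ∃ L : ℝ →L[ℝ] Euc 1, (∀ t, ‖L t‖ = |t|) ∧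
    ∀ F : Euc 1 → ℝ, ∫ x, F x = ∫ t, F (L t) := by
  let e : ℝ ≃ᵐ Euc 1 := (MeasurableEquiv.funUnique (Fin 1) ℝ).symm.trans (MeasurableEquiv.toLp 2 _)
  have he : MeasurePreserving e :=
    (PiLp.volume_preserving_toLp (Fin 1)).comp (volume_preserving_funUnique (Fin 1) ℝ).symm
  refine ⟨ContinuousLinearMap.toSpanSingleton ℝ (EuclideanSpace.single 0 1), fun t => ?_, fun F => ?_⟩
  · rw [ContinuousLinearMap.toSpanSingleton_apply, norm_smul, PiLp.norm_single]
    simp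
  · have heL : ∀ t, e t = ContinuousLinearMap.toSpanSingleton ℝ (EuclideanSpace.single 0 1 : Euc 1) t := by
      intro t
      ext i
      have : i = 0 := Subsingleton.elim _ _
      subst this
      have h1 : e t 0 = t := rfl
      rw [h1]
      simp [ContinuousLinearMap.toSpanSingleton_apply]
    rw [← he.integral_comp e.measurableEmbedding]
    simp_rw [heL]

theorem integral_abs_deriv_comp_le {E : Type*} [NormedAddCommGroup E] [NormedSpace ℝ E] {f : E → ℝ}
    (hf : ContDiff ℝ 1 f) (hs : HasCompactSupport f) (L : ℝ →L[ℝ] E) (hL : ∀ t, ‖L t‖ = ‖t‖) :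
    ∫ s, |deriv (fun t => f (L t)) s| ≤ ∫ t, ‖fderiv ℝ f (L t)‖ := by
  have hcl : IsClosedEmbedding L := (AddMonoidHomClass.isometry_of_norm L hL).isClosedEmbedding
  have hd' : Continuous fun x => ‖fderiv ℝ f x‖ := (hf.continuous_fderiv one_ne_zero).norm
  have hi : Integrable fun t => ‖fderiv ℝ f (L t)‖ :=
    (hd'.comp L.continuous).integrable_of_hasCompactSupport
      ((hs.fderiv ℝ).norm.comp_isClosedEmbedding hcl)
  refine integral_mono_of_nonneg (Eventually.of_forall fun _ => abs_nonneg _) hi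
    (Eventually.of_forall fun t => ?_)
  have h1 : HasDerivAt (fun t => f (L t)) (fderiv ℝ f (L t) (L 1)) t :=
    ((hf.differentiable one_ne_zero) _).hasFDerivAt.comp_hasDerivAt t L.hasDerivAt
  have h2 := (fderiv ℝ f (L t)).le_opNorm (L 1)
  rw [hL, norm_one, mul_one] at h2
  change |deriv (fun t => f (L t)) t| ≤ ‖fderiv ℝ f (L t)‖
  rw [h1.deriv, ← Real.norm_eq_abs]
  exact h2

theorem two_mul_integral_sq_le_mul {g : ℝ → ℝ} (hg : Continuous g) (hgs : HasCompactSupport g)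
    {C : ℝ} (h : ∀ t, 2 * g t ≤ C) (h0 : ∀ t, 0 ≤ g t) : 2 * ∫ t, g t ^ 2 ≤ C * ∫ t, g t := by
  have hgi : Integrable g := hg.integrable_of_hasCompactSupport hgs
  have hg2 : Continuous fun t => g t ^ 2 := hg.pow 2
  have hgs2 : HasCompactSupport fun t => g t ^ 2 :=
    hgs.comp_left (g := fun s : ℝ => s ^ 2) (zero_pow two_ne_zero)
  have hgi2 : Integrable fun t => g t ^ 2 := hg2.integrable_of_hasCompactSupport hgs2
  rw [← integral_const_mul, ← integral_const_mul]
  exact integral_mono (hgi2.const_mul 2) (hgi.const_mul C) fun t => by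
    have h3 := mul_le_mul_of_nonneg_right (h t) (h0 t)
    have : 2 * g t ^ 2 ≤ C * g t := by linarith [sq (g t)]
    exact this

theorem two_mul_integral_sq_le {f : Euc 1 → ℝ} (hf : ContDiff ℝ 1 f) (hs : HasCompactSupport f)
    (hf0 : ∀ x, 0 ≤ f x) :
    2 * ∫ x, f x ^ 2 ≤ (∫ x, ‖fderiv ℝ f x‖) * ∫ x, f x := by
  obtain ⟨L, hnorm, hcomp⟩ := exists_isometry_real_euc_one
  have hcl : IsClosedEmbedding L := (AddMonoidHomClass.isometry_of_norm L hnorm).isClosedEmbedding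
  have hg : ContDiff ℝ 1 fun t => f (L t) := hf.comp L.contDiff
  have hgs : HasCompactSupport fun t => f (L t) := hs.comp_isClosedEmbedding hcl
  have hle := integral_abs_deriv_comp_le hf hs L hnorm
  rw [hcomp fun x => ‖fderiv ℝ f x‖, hcomp fun x => f x ^ 2, hcomp f]
  exact two_mul_integral_sq_le_mul hg.continuous hgs
    (fun t => (two_mul_le_integral_abs_deriv hg hgs t).trans hle) fun t => hf0 _

theorem functionalIsoperimetric_one : FunctionalIsoperimetric 1 := by
  intro f hf hs hf0
  have h := two_mul_integral_sq_le hf hs hf0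
  have e1 : ∫ x, f x ^ (1 + 1 / ((1 : ℕ) : ℝ)) = ∫ x, f x ^ 2 := by
    refine integral_congr_ae (Eventually.of_forall fun t => ?_)
    change f t ^ (1 + 1 / ((1 : ℕ) : ℝ)) = f t ^ 2
    rw [Nat.cast_one, div_one, one_add_one_eq_two, Real.rpow_two]
  rw [e1, unitBallVol_one, Nat.cast_one, div_one, Real.rpow_one, Real.rpow_one, one_mul]
  exact h

theorem exists_slab {m : ℕ} {f : Euc (m + 1) → ℝ} (hs : HasCompactSupport f) :
    ∃ K > 0, ∀ x, f x ≠ 0 → x 0 ∈ Ioo (-K) K := by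
  obtain ⟨K, hK⟩ := hs.isCompact.isBounded.subset_closedBall 0
  refine ⟨|K| + 1, by positivity, fun x hx => abs_lt.1 ?_⟩
  have := hK (subset_tsupport _ hx)
  rw [mem_closedBall_zero_iff] at this
  have h2 := PiLp.norm_apply_le x 0
  rw [Real.norm_eq_abs] at h2
  linarith [le_abs_self K]

theorem functionalIsoperimetric_succ {m : ℕ} (hm : 1 ≤ m) (h : FunctionalIsoperimetric m) :
    FunctionalIsoperimetric (m + 1) := by
  intro f hf hs hf0
  have hσ := unitBallVol_pos (m + 1)
  have hM0 : 0 ≤ ∫ x, f x := integral_nonneg hf0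
  rcases hM0.eq_or_lt with h0 | hM
  · have hf1 : f =ᵐ[volume] 0 := (integral_eq_zero_iff_of_nonneg hf0
      (hf.continuous.integrable_of_hasCompactSupport hs)).1 h0.symm
    have : ∫ x, f x ^ (1 + 1 / ((m + 1 : ℕ) : ℝ)) = 0 := by
      refine integral_eq_zero_of_ae (hf1.mono fun x hx => ?_)
      simp only [hx, Pi.zero_apply]
      exact Real.zero_rpow (by positivity)
    rw [this, mul_zero]
    exact mul_nonneg (integral_nonneg fun _ => norm_nonneg _) (Real.rpow_nonneg hM0 _)
  · set M := ∫ x, f x with hMdef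
    obtain ⟨K, hK0, hK⟩ := exists_slab hs
    obtain ⟨z, -, -, -, hz⟩ := exists_slice_transport hm h hf hs hf0 (by linarith : -K < K) hK
      (τ := fun _ => 1) (τ' := fun _ => 0) continuous_const (fun _ => one_pos) continuous_const
      (fun t _ => hasDerivAt_const t 1) (G := fun _ => M / unitBallVol (m + 1)) continuousOn_const
      (fun _ _ => by positivity) (by
        rw [intervalIntegral.integral_mul_const, ← unitBallVol_succ hm]
        simp only [Real.one_rpow, mul_one]
        rw [← hMdef]
        field_simp)
    simp only [Real.one_rpow, mul_one, mul_zero, integral_zero, add_zero] at hz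
    rw [integral_mul_const] at hz
    push_cast
    have e : (M / unitBallVol (m + 1)) ^ (-(1 / ((m : ℝ) + 1))) =
        unitBallVol (m + 1) ^ (1 / ((m : ℝ) + 1)) / M ^ (1 / ((m : ℝ) + 1)) := by
      rw [Real.rpow_neg (by positivity), Real.div_rpow hM.le hσ.le, inv_div]
    rw [e] at hz
    have hMp : 0 < M ^ (1 / ((m : ℝ) + 1)) := by positivity
    calc _ = ((m : ℝ) + 1) * ((∫ x, f x ^ (1 + 1 / ((m : ℝ) + 1))) *
          (unitBallVol (m + 1) ^ (1 / ((m : ℝ) + 1)) / M ^ (1 / ((m : ℝ) + 1)))) * M ^ (1 / ((m : ℝ) + 1)) := by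
          field_simp
      _ ≤ _ := mul_le_mul_of_nonneg_right hz hMp.le

theorem functionalIsoperimetric {m : ℕ} (hm : 1 ≤ m) : FunctionalIsoperimetric m := by
  induction m, hm using Nat.le_induction with
  | base => exact functionalIsoperimetric_one
  | succ m hm ih => exact functionalIsoperimetric_succ hm ih

/-- Volume of the hyperbolic ball parametrised by `c`, in the half-space model. -/
noncomputable def hypVol (m : ℕ) (c : ℝ) : ℝ :=
  ∫ z in (-1 : ℝ)..1, unitBallVol m * √(1 - z ^ 2) ^ m * ((c + z) ^ (m + 1))⁻¹

/-- Perimeter of the hyperbolic ball parametrised by `c`, in the half-space model. -/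
noncomputable def hypPer (m : ℕ) (c : ℝ) : ℝ :=
  ∫ z in (-1 : ℝ)..1, (((m : ℝ) + 1) * c + z) * (unitBallVol m * √(1 - z ^ 2) ^ m * ((c + z) ^ (m + 1))⁻¹)

theorem exists_positive_slab {m : ℕ} {K : Set (Euc (m + 1))} (hK : IsCompact K)
    (hpos : ∀ x ∈ K, 0 < x 0) : ∃ α β : ℝ, 0 < α ∧ α < β ∧ ∀ x ∈ K, x 0 ∈ Ioo α β := by
  rcases K.eq_empty_or_nonempty with rfl | hne
  · exact ⟨1, 2, by norm_num, by norm_num, by simp⟩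
  have hc : Continuous fun x : Euc (m + 1) => x 0 := by fun_prop
  obtain ⟨p, hp, hpmin⟩ := hK.exists_isMinOn hne hc.continuousOn
  obtain ⟨q, hq, hqmax⟩ := hK.exists_isMaxOn hne hc.continuousOn
  have h1 := hpos p hp
  have h2 : p 0 ≤ q 0 := hpmin hq
  refine ⟨p 0 / 2, q 0 + 1, by linarith, by linarith, fun x hx => ⟨?_, ?_⟩⟩
  · have : p 0 ≤ x 0 := hpmin hx
    linarith
  · have : x 0 ≤ q 0 := hqmax hx
    linarith

theorem sub_indicator_le_rpow {w q : ℝ} (h0 : 0 ≤ w) (h1 : w ≤ 1) (hq : 0 < q) :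
    w - {s : ℝ | 0 < s ∧ s < 1}.indicator (fun _ => 1) w ≤ w ^ (1 + q) := by
  by_cases h : w ∈ {s : ℝ | 0 < s ∧ s < 1}
  · rw [indicator_of_mem h]
    have := Real.rpow_nonneg h0 (1 + q)
    linarith
  · rw [indicator_of_notMem h]
    rcases h0.eq_or_lt with h0 | h0
    · rw [← h0, Real.zero_rpow (by positivity)]; simp
    · have : w = 1 := le_antisymm h1 (not_lt.1 fun h' => h ⟨h0, h'⟩)
      rw [this]; simp

theorem hypPer_sub_le_integral {m : ℕ} (hm : 1 ≤ m) {w : Euc (m + 1) → ℝ} (hw : ContDiff ℝ 1 w)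
    (hs : HasCompactSupport w) (hpos : ∀ x ∈ tsupport w, 0 < x 0) (hw0 : ∀ x, 0 ≤ w x)
    (hw1 : ∀ x, w x ≤ 1) {c h : ℝ} (hc : 1 < c)
    (hmass : ∫ x, w x * (x 0 ^ (m + 1))⁻¹ = hypVol m c)
    (hh : ∫ x in {x | 0 < w x ∧ w x < 1}, (x 0 ^ (m + 1))⁻¹ ≤ h) :
    hypPer m c - ((m : ℝ) + 1) * (c + 1) * h ≤ ∫ x, ‖fderiv ℝ w x‖ * (x 0 ^ m)⁻¹ := by
  have hm0 : (0 : ℝ) < m := by exact_mod_cast hm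
  obtain ⟨α, β, hα, hαβ, hslab⟩ := exists_positive_slab hs.isCompact hpos
  set τ : ℝ → ℝ := fun t => (max t α ^ m)⁻¹ with hτdef
  set τh : ℝ → ℝ := fun t => (max t α ^ (m + 1))⁻¹ with hτhdef
  have hmax : ∀ t, 0 < max t α := fun t => lt_max_of_lt_right hα
  have hτc : Continuous τ := Continuous.inv₀ (by fun_prop) fun t => (pow_pos (hmax t) _).ne'
  have hτhc : Continuous τh := Continuous.inv₀ (by fun_prop) fun t => (pow_pos (hmax t) _).ne'
  have hτ0 : ∀ t, 0 < τ t := fun t => inv_pos.2 (pow_pos (hmax t) _)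
  have hτh0 : ∀ t, 0 < τh t := fun t => inv_pos.2 (pow_pos (hmax t) _)
  have hττh : ∀ t, τ t ^ (((m : ℝ) + 1) / m) = τh t := fun t => by
    simp only [hτdef, hτhdef]
    rw [Real.inv_rpow (pow_pos (hmax t) _).le, ← Real.rpow_natCast, ← Real.rpow_natCast,
      ← Real.rpow_mul (hmax t).le]
    congr 2
    push_cast
    field_simp
  have hmaxeq : ∀ x ∈ tsupport w, max (x 0) α = x 0 := fun x hx => max_eq_left (hslab x hx).1.le
  have hτd : ∀ t ∈ Ioo α β, HasDerivAt τ (-(m : ℝ) * τh t) t := fun t ht => by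
    have ht0 : 0 < t := hα.trans ht.1
    have h1 : HasDerivAt (fun s : ℝ => (s ^ m)⁻¹) (-(m : ℝ) * (t ^ (m + 1))⁻¹) t := by
      have h := (hasDerivAt_pow m t).inv (pow_pos ht0 m).ne'
      have e : -(m : ℝ) * (t ^ (m + 1))⁻¹ = -(m * t ^ (m - 1)) / (t ^ m) ^ 2 := by
        have e1 : t ^ m = t ^ (m - 1) * t := by rw [← pow_succ, Nat.sub_add_cancel hm]
        rw [pow_succ, e1]
        field_simp
      rw [e]
      exact h
    have h2 : -(m : ℝ) * τh t = -(m : ℝ) * (t ^ (m + 1))⁻¹ := by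
      simp only [hτhdef, max_eq_left ht.1.le]
    rw [h2]
    refine h1.congr_of_eventuallyEq ?_
    filter_upwards [lt_mem_nhds ht.1] with s hs
    simp only [hτdef, max_eq_left hs.le]
  have hG : ContinuousOn (fun z : ℝ => ((c + z) ^ (m + 1))⁻¹) (Icc (-1) 1) :=
    ContinuousOn.inv₀ (by fun_prop) fun z hz => (pow_pos (by linarith [hz.1]) _).ne'
  have hG0 : ∀ z ∈ Icc (-1 : ℝ) 1, 0 < ((c + z) ^ (m + 1))⁻¹ := fun z hz =>
    inv_pos.2 (pow_pos (by linarith [hz.1]) _)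
  have hwt : ∀ (g g' : ℝ → ℝ), (∀ t, α < t → g t = g' t) → ∀ x, w x * g (x 0) = w x * g' (x 0) := by
    intro g g' hgg x
    by_cases hx : w x = 0
    · rw [hx, zero_mul, zero_mul]
    · rw [hgg _ (hslab x (subset_tsupport _ hx)).1]
  obtain ⟨z, hzc, hzI, hzφ, hz⟩ := exists_slice_transport hm (functionalIsoperimetric hm) hw hs hw0 hαβ
    (fun x hx => hslab x (subset_tsupport _ hx)) hτc hτ0 (continuous_const.mul hτhc) hτd hG hG0 (by
      change _ = hypVol m c
      rw [← hmass]
      refine integral_congr_ae (Eventually.of_forall fun x => ?_)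
      simp only [hττh]
      exact hwt τh (fun t => (t ^ (m + 1))⁻¹) (fun t ht => by simp only [hτhdef, max_eq_left ht.le]) x)
  have hGp : ∀ t, ((c + z t) ^ (m + 1))⁻¹ ^ (-(1 / ((m : ℝ) + 1))) = c + z t := fun t => by
    have h0 : 0 < c + z t := by linarith [(hzI t).1]
    rw [Real.rpow_neg (by positivity), Real.inv_rpow (by positivity), inv_inv, ← Real.rpow_natCast,
      ← Real.rpow_mul h0.le]
    push_cast
    rw [mul_one_div_cancel (by positivity), Real.rpow_one]
  simp only [hττh, hGp] at hz
  have hzx : Continuous fun x : Euc (m + 1) => z (x 0) := hzc.comp (by fun_prop)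
  have hτx : Continuous fun x : Euc (m + 1) => τh (x 0) := hτhc.comp (by fun_prop)
  have hwc := hw.continuous
  set S : Set (Euc (m + 1)) := {x | 0 < w x ∧ w x < 1} with hSdef
  have hSm : MeasurableSet S :=
    ((isOpen_lt continuous_const hwc).inter (isOpen_lt hwc continuous_const)).measurableSet
  have hS : S ⊆ tsupport w := fun x hx => subset_tsupport _ (ne_of_gt hx.1)
  have hInt : ∀ g : Euc (m + 1) → ℝ, Continuous g → Integrable fun x => w x * g x := fun g hg => by
    have h1 : Continuous fun x => w x * g x := hwc.mul hg
    exact h1.integrable_of_hasCompactSupport hs.mul_right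
  have hiS : Integrable (S.indicator fun x => τh (x 0)) := by
    rw [integrable_indicator_iff hSm]
    exact (hτx.continuousOn.integrableOn_compact hs.isCompact).mono_set hS
  have hhS : ∫ x, S.indicator (fun x => τh (x 0)) x ≤ h := by
    rw [integral_indicator hSm]
    refine le_trans (le_of_eq (setIntegral_congr_fun hSm fun x hx => ?_)) hh
    simp only [hτhdef, hmaxeq x (hS hx)]
  have hP : hypPer m c = ∫ x, w x * ((((m : ℝ) + 1) * c + z (x 0)) * τh (x 0)) := by
    have := hzφ (fun z => ((m : ℝ) + 1) * c + z) (by fun_prop)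
    simp only [hττh] at this
    exact this.symm
  have hpwi : Integrable fun x => w x ^ (1 + 1 / ((m : ℝ) + 1)) * ((c + z (x 0)) * τh (x 0)) := by
    have h1 : Continuous fun x => w x ^ (1 + 1 / ((m : ℝ) + 1)) :=
      hwc.rpow_const fun _ => Or.inr (by positivity)
    have h2 : HasCompactSupport fun x => w x ^ (1 + 1 / ((m : ℝ) + 1)) :=
      hs.comp_left (g := fun s : ℝ => s ^ (1 + 1 / ((m : ℝ) + 1))) (Real.zero_rpow (by positivity))
    have h3 : Continuous fun x => w x ^ (1 + 1 / ((m : ℝ) + 1)) * ((c + z (x 0)) * τh (x 0)) := by fun_prop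
    exact h3.integrable_of_hasCompactSupport h2.mul_right
  have hi2 : Integrable fun x => w x * (z (x 0) * (-(m : ℝ) * τh (x 0))) :=
    hInt (fun x => z (x 0) * (-(m : ℝ) * τh (x 0))) (by fun_prop)
  have hi3 : Integrable fun x => w x * ((((m : ℝ) + 1) * c + z (x 0)) * τh (x 0)) :=
    hInt (fun x => (((m : ℝ) + 1) * c + z (x 0)) * τh (x 0)) (by fun_prop)
  have hmain : hypPer m c - ((m : ℝ) + 1) * (c + 1) * ∫ x, S.indicator (fun x => τh (x 0)) x ≤
      ((m : ℝ) + 1) * (∫ x, w x ^ (1 + 1 / ((m : ℝ) + 1)) * ((c + z (x 0)) * τh (x 0))) +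
        ∫ x, w x * (z (x 0) * (-(m : ℝ) * τh (x 0))) := by
    rw [hP, ← integral_const_mul, ← integral_const_mul, ← integral_sub hi3 (hiS.const_mul _),
      ← integral_add (hpwi.const_mul _) hi2]
    refine integral_mono (hi3.sub (hiS.const_mul _)) ((hpwi.const_mul _).add hi2) fun x => ?_
    have hind : S.indicator (fun x => τh (x 0)) x =
        {s : ℝ | 0 < s ∧ s < 1}.indicator (fun _ => 1) (w x) * τh (x 0) := by
      by_cases hx : x ∈ S
      · rw [indicator_of_mem hx, indicator_of_mem (show w x ∈ {s : ℝ | 0 < s ∧ s < 1} from hx), one_mul]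
      · rw [indicator_of_notMem hx, indicator_of_notMem (show w x ∉ {s : ℝ | 0 < s ∧ s < 1} from hx), zero_mul]
    have h1 := sub_indicator_le_rpow (q := 1 / ((m : ℝ) + 1)) (hw0 x) (hw1 x) (by positivity)
    have hi0 : 0 ≤ {s : ℝ | 0 < s ∧ s < 1}.indicator (fun _ => (1 : ℝ)) (w x) :=
      indicator_nonneg (fun _ _ => zero_le_one) _
    simp only [hind]
    set I := {s : ℝ | 0 < s ∧ s < 1}.indicator (fun _ => (1 : ℝ)) (w x)
    have hcz : 0 ≤ c + z (x 0) := by linarith [(hzI (x 0)).1]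
    have h2 := mul_le_mul_of_nonneg_right h1 (mul_nonneg hcz (hτh0 (x 0)).le)
    have h3 : I * ((c + z (x 0)) * τh (x 0)) ≤ I * ((c + 1) * τh (x 0)) :=
      mul_le_mul_of_nonneg_left (mul_le_mul_of_nonneg_right (by linarith [(hzI (x 0)).2]) (hτh0 _).le) hi0
    have h4 : (w x - I) * ((c + z (x 0)) * τh (x 0)) ≥
        w x * ((c + z (x 0)) * τh (x 0)) - I * ((c + 1) * τh (x 0)) := by
      rw [sub_mul]; linarith
    have h5 := mul_le_mul_of_nonneg_left (h4.le.trans h2) (by positivity : (0 : ℝ) ≤ (m : ℝ) + 1)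
    linarith
  have hτeq : ∫ x, ‖fderiv ℝ w x‖ * τ (x 0) = ∫ x, ‖fderiv ℝ w x‖ * (x 0 ^ m)⁻¹ := by
    refine integral_congr_ae (Eventually.of_forall fun x => ?_)
    by_cases hx : x ∈ tsupport w
    · simp only [hτdef, hmaxeq x hx]
    · have : fderiv ℝ w x = 0 := fderiv_of_notMem_tsupport ℝ hx
      simp only [this, norm_zero, zero_mul]
  rw [← hτeq]
  refine le_trans ?_ (hmain.trans hz)
  have := mul_le_mul_of_nonneg_left hhS (by positivity : (0 : ℝ) ≤ ((m : ℝ) + 1) * (c + 1))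
  linarith

theorem integral_moebius {m : ℕ} {c q : ℝ} (hc : 1 < c) (hq : 0 < q) (hcq : c ^ 2 - 1 = q ^ 2) :
    ∫ z in (-1 : ℝ)..1, √(1 - z ^ 2) ^ m =
      q ^ (m + 2) * ∫ z in (-1 : ℝ)..1, √(1 - z ^ 2) ^ m * ((c + z) ^ (m + 2))⁻¹ := by
  have hne : ∀ z ∈ Icc (-1 : ℝ) 1, 0 < c + z := fun z hz => by linarith [hz.1]
  have hu : uIcc (-1 : ℝ) 1 = Icc (-1) 1 := uIcc_of_le (by norm_num)
  have h := intervalIntegral.integral_comp_mul_deriv (a := -1) (b := 1)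
    (f := fun z => (1 + c * z) / (c + z)) (f' := fun z => q ^ 2 / (c + z) ^ 2)
    (g := fun z => √(1 - z ^ 2) ^ m)
    (fun z hz => by
      rw [hu] at hz
      have h1 : HasDerivAt (fun z : ℝ => 1 + c * z) c z := by
        simpa using ((hasDerivAt_id z).const_mul c).const_add 1
      have h2 : HasDerivAt (fun z : ℝ => c + z) 1 z := (hasDerivAt_id z).const_add c
      have h3 := h1.div h2 (hne z hz).ne'
      have e : q ^ 2 / (c + z) ^ 2 = (c * (c + z) - (1 + c * z) * 1) / (c + z) ^ 2 := by
        rw [← hcq]; ring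
      rw [e]
      exact h3)
    (by
      rw [hu]
      exact ContinuousOn.div (by fun_prop) (by fun_prop) fun z hz => (pow_pos (hne z hz) 2).ne')
    (by fun_prop)
  have e1 : (1 + c * (-1)) / (c + -1) = -1 := by
    rw [div_eq_iff (by linarith)]; ring
  have e2 : (1 + c * 1) / (c + 1) = 1 := by
    rw [div_eq_iff (by linarith)]; ring
  simp only [e1, e2] at h
  rw [← h, ← intervalIntegral.integral_const_mul]
  refine intervalIntegral.integral_congr fun z hz => ?_
  rw [hu] at hz
  have h0 := hne z hz
  have h1 : 0 ≤ 1 - z ^ 2 := by nlinarith [hz.1, hz.2]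
  have h2 : 1 - ((1 + c * z) / (c + z)) ^ 2 = (q / (c + z)) ^ 2 * (1 - z ^ 2) := by
    rw [div_pow, div_pow, ← hcq]
    field_simp
    ring
  simp only [Function.comp_apply]
  rw [h2, Real.sqrt_mul (sq_nonneg _), Real.sqrt_sq (by positivity)]
  rw [pow_add q, pow_add (c + z), mul_pow, div_pow]
  field_simp

theorem hasDerivAt_sqrt_one_sub_sq_pow (m : ℕ) {z : ℝ} (hz : z ∈ Ioo (-1 : ℝ) 1) :
    HasDerivAt (fun z : ℝ => √(1 - z ^ 2) ^ (m + 2)) (-((m : ℝ) + 2) * z * √(1 - z ^ 2) ^ m) z := by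
  have h0 : 0 < 1 - z ^ 2 := by nlinarith [hz.1, hz.2]
  have hs : 0 < √(1 - z ^ 2) := Real.sqrt_pos.2 h0
  have h1 : HasDerivAt (fun z : ℝ => 1 - z ^ 2) (-(2 * z)) z := by
    simpa using (hasDerivAt_pow 2 z).const_sub 1
  have h2 := (h1.sqrt h0.ne').pow (m + 2)
  have e : -((m : ℝ) + 2) * z * √(1 - z ^ 2) ^ m =
      ((m + 2 : ℕ) : ℝ) * √(1 - z ^ 2) ^ (m + 2 - 1) * (-(2 * z) / (2 * √(1 - z ^ 2))) := by
    rw [show m + 2 - 1 = m + 1 by omega, pow_succ]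
    push_cast
    field_simp
    ring
  rw [e]
  exact h2

theorem hypPer_eq {m : ℕ} (hm : 1 ≤ m) {c q : ℝ} (hc : 1 < c) (hq : 0 < q) (hcq : c ^ 2 - 1 = q ^ 2) :
    hypPer m c = ((m : ℝ) + 1) * unitBallVol (m + 1) * (q ^ m)⁻¹ := by
  have hne : ∀ z ∈ Icc (-1 : ℝ) 1, 0 < c + z := fun z hz => by linarith [hz.1]
  have hu : uIcc (-1 : ℝ) 1 = Icc (-1) 1 := uIcc_of_le (by norm_num)
  have hcont : ∀ k : ℕ, ContinuousOn (fun z : ℝ => ((c + z) ^ k)⁻¹) (Icc (-1) 1) := fun k =>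
    ContinuousOn.inv₀ (by fun_prop) fun z hz => (pow_pos (hne z hz) _).ne'
  set F : ℝ → ℝ := fun z => √(1 - z ^ 2) ^ m * ((c + z) ^ (m + 2))⁻¹ *
    (-((m : ℝ) + 2) * z * (c + z) - ((m : ℝ) + 1) * (1 - z ^ 2)) with hF
  have hFc : ContinuousOn F (Icc (-1) 1) :=
    ((Continuous.continuousOn (by fun_prop)).mul (hcont _)).mul (by fun_prop)
  have hzero : ∫ z in (-1 : ℝ)..1, F z = 0 := by
    rw [intervalIntegral.integral_eq_sub_of_hasDerivAt_of_le (by norm_num)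
      (f := fun z => √(1 - z ^ 2) ^ (m + 2) * ((c + z) ^ (m + 1))⁻¹)
      ((Continuous.continuousOn (by fun_prop)).mul (hcont _)) ?_ ?_]
    · norm_num
    · intro z hz
      have h0 := hne z (Ioo_subset_Icc_self hz)
      have h1 : HasDerivAt (fun z : ℝ => (c + z) ^ (m + 1)) (((m : ℝ) + 1) * (c + z) ^ m) z := by
        have := ((hasDerivAt_id' z).const_add c).fun_pow (m + 1)
        simpa using this
      have h2 := (hasDerivAt_sqrt_one_sub_sq_pow m hz).mul (h1.inv (pow_pos h0 _).ne')
      have hs : √(1 - z ^ 2) ^ 2 = 1 - z ^ 2 := Real.sq_sqrt (by nlinarith [hz.1, hz.2])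
      have e : F z = -((m : ℝ) + 2) * z * √(1 - z ^ 2) ^ m * ((c + z) ^ (m + 1))⁻¹ +
          √(1 - z ^ 2) ^ (m + 2) * (-(((m : ℝ) + 1) * (c + z) ^ m) / ((c + z) ^ (m + 1)) ^ 2) := by
        simp only [hF]
        rw [pow_add (√(1 - z ^ 2)), hs, pow_add (c + z) m 2, pow_add (c + z) m 1]
        field_simp
        ring
      rw [e]
      exact h2
    · exact ContinuousOn.intervalIntegrable (by rwa [hu])
  set J := ∫ z in (-1 : ℝ)..1, √(1 - z ^ 2) ^ m * ((c + z) ^ (m + 2))⁻¹ with hJ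
  have hsum : hypPer m c = unitBallVol m * (((m : ℝ) + 1) * q ^ 2 * J - ∫ z in (-1 : ℝ)..1, F z) := by
    rw [hypPer, hJ, ← intervalIntegral.integral_const_mul, ← intervalIntegral.integral_sub,
      ← intervalIntegral.integral_const_mul]
    · refine intervalIntegral.integral_congr fun z hz => ?_
      rw [hu] at hz
      have h0 := hne z hz
      simp only [hF]
      rw [← hcq, pow_add (c + z) m 2, pow_add (c + z) m 1]
      field_simp
      ring
    · refine ContinuousOn.intervalIntegrable ?_
      rw [hu]
      exact continuousOn_const.mul ((Continuous.continuousOn (by fun_prop)).mul (hcont _))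
    · exact ContinuousOn.intervalIntegrable (by rwa [hu])
  have hmo := integral_moebius (m := m) hc hq hcq
  rw [hsum, hzero, unitBallVol_succ hm, intervalIntegral.integral_const_mul, hmo, ← hJ, pow_add]
  field_simp
  ring

theorem hypVol_nonneg_le {m : ℕ} (hm : 1 ≤ m) {c : ℝ} (hc : 1 < c) :
    hypVol m c * (c - 1) ^ (m + 1) ≤ unitBallVol (m + 1) := by
  have hσ := unitBallVol_pos m
  have hu : uIcc (-1 : ℝ) 1 = Icc (-1) 1 := uIcc_of_le (by norm_num)
  rw [hypVol, unitBallVol_succ hm, ← intervalIntegral.integral_mul_const]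
  refine intervalIntegral.integral_mono_on (by norm_num) ?_ ?_ fun z hz => ?_
  · refine ContinuousOn.intervalIntegrable ?_
    rw [hu]
    refine ((Continuous.continuousOn (by fun_prop)).mul ?_).mul continuousOn_const
    exact ContinuousOn.inv₀ (by fun_prop) fun z hz => (pow_pos (by linarith [hz.1]) _).ne'
  · exact Continuous.intervalIntegrable (by fun_prop) _ _
  · have h1 : (c - 1) ^ (m + 1) ≤ (c + z) ^ (m + 1) := pow_le_pow_left₀ (by linarith) (by linarith [hz.1]) _
    have h2 : 0 < (c + z) ^ (m + 1) := pow_pos (by linarith [hz.1]) _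
    have h3 : ((c + z) ^ (m + 1))⁻¹ * (c - 1) ^ (m + 1) ≤ 1 := by
      rw [inv_mul_le_iff₀ h2, mul_one]; exact h1
    rw [mul_assoc]
    exact mul_le_of_le_one_right (by positivity) h3

theorem hypVol_nonneg {m : ℕ} {c : ℝ} (hc : 1 < c) : 0 ≤ hypVol m c := by
  have hσ := unitBallVol_pos m
  refine intervalIntegral.integral_nonneg (by norm_num) fun z hz => ?_
  have : 0 < c + z := by linarith [hz.1]
  positivity

theorem hasDerivAt_hypVol {m : ℕ} (hm : 1 ≤ m) {c q : ℝ} (hc : 1 < c) (hq : 0 < q)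
    (hcq : c ^ 2 - 1 = q ^ 2) :
    HasDerivAt (hypVol m) (-(((m : ℝ) + 1) * unitBallVol (m + 1) * (q ^ (m + 2))⁻¹)) c := by
  have hσ := unitBallVol_pos m
  have hu : uIcc (-1 : ℝ) 1 = Icc (-1) 1 := uIcc_of_le (by norm_num)
  set ε := (c - 1) / 2 with hε
  have hε0 : 0 < ε := by rw [hε]; linarith
  have hball : ∀ x ∈ Metric.ball c ε, ∀ z ∈ Icc (-1 : ℝ) 1, ε < x + z := fun x hx z hz => by
    have := abs_lt.1 (Real.dist_eq x c ▸ Metric.mem_ball.1 hx)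
    linarith [hz.1, this.1]
  have hsub : uIoc (-1 : ℝ) 1 ⊆ Icc (-1) 1 := by rw [← hu]; exact uIoc_subset_uIcc
  have hcont : ∀ k : ℕ, ∀ x ∈ Metric.ball c ε, ContinuousOn (fun z : ℝ =>
      unitBallVol m * √(1 - z ^ 2) ^ m * ((x + z) ^ k)⁻¹) (uIcc (-1) 1) := fun k x hx => by
    rw [hu]
    refine (Continuous.continuousOn (by fun_prop)).mul ?_
    exact ContinuousOn.inv₀ (by fun_prop) fun z hz => (pow_pos (hε0.trans (hball x hx z hz)) _).ne'
  have hcm : c ∈ Metric.ball c ε := Metric.mem_ball_self hε0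
  have h := intervalIntegral.hasDerivAt_integral_of_dominated_loc_of_deriv_le
    (F := fun x z => unitBallVol m * √(1 - z ^ 2) ^ m * ((x + z) ^ (m + 1))⁻¹)
    (F' := fun x z => -((m : ℝ) + 1) * (unitBallVol m * √(1 - z ^ 2) ^ m * ((x + z) ^ (m + 2))⁻¹))
    (x₀ := c) (s := Metric.ball c ε) (a := -1) (b := 1) (μ := volume)
    (bound := fun z => ((m : ℝ) + 1) * (unitBallVol m * √(1 - z ^ 2) ^ m * (ε ^ (m + 2))⁻¹))
    (Metric.ball_mem_nhds c hε0)
    (by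
      filter_upwards [Metric.ball_mem_nhds c hε0] with x hx
      exact ((hcont _ x hx).mono uIoc_subset_uIcc).aestronglyMeasurable measurableSet_uIoc)
    (hcont _ c hcm).intervalIntegrable
    ((continuousOn_const.mul ((hcont _ c hcm).mono uIoc_subset_uIcc)).aestronglyMeasurable measurableSet_uIoc)
    (by
      refine Eventually.of_forall fun z hz x hx => ?_
      have h1 := hball x hx z (hsub hz)
      have h2 : 0 < x + z := hε0.trans h1
      rw [norm_mul, norm_neg, Real.norm_of_nonneg (by positivity), Real.norm_of_nonneg (by positivity)]
      gcongr)
    (Continuous.intervalIntegrable (by fun_prop) _ _)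
    (by
      refine Eventually.of_forall fun z hz x hx => ?_
      have h2 : 0 < x + z := hε0.trans (hball x hx z (hsub hz))
      have h1 : HasDerivAt (fun x : ℝ => (x + z) ^ (m + 1)) (((m : ℝ) + 1) * (x + z) ^ m) x := by
        have := ((hasDerivAt_id' x).add_const z).fun_pow (m + 1)
        simpa using this
      have h3 := (h1.inv (pow_pos h2 _).ne').const_mul (unitBallVol m * √(1 - z ^ 2) ^ m)
      have e : -((m : ℝ) + 1) * (unitBallVol m * √(1 - z ^ 2) ^ m * ((x + z) ^ (m + 2))⁻¹) =
          unitBallVol m * √(1 - z ^ 2) ^ m * (-(((m : ℝ) + 1) * (x + z) ^ m) / ((x + z) ^ (m + 1)) ^ 2) := by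
        rw [pow_add (x + z) m 2, pow_add (x + z) m 1]
        field_simp
      simp only [e]
      exact h3)
  have e : -(((m : ℝ) + 1) * unitBallVol (m + 1) * (q ^ (m + 2))⁻¹) =
      ∫ z in (-1 : ℝ)..1, -((m : ℝ) + 1) * (unitBallVol m * √(1 - z ^ 2) ^ m * ((c + z) ^ (m + 2))⁻¹) := by
    rw [intervalIntegral.integral_const_mul, unitBallVol_succ hm, intervalIntegral.integral_const_mul,
      integral_moebius hc hq hcq]
    simp_rw [mul_assoc]
    rw [intervalIntegral.integral_const_mul]
    field_simp
  rw [e]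
  exact h.2

/-- The volume of a hyperbolic ball as a function of `s = sinh (radius)`. -/
noncomputable def sinhVol (m : ℕ) (s : ℝ) : ℝ :=
  ((m : ℝ) + 1) * unitBallVol (m + 1) * ∫ x in (0 : ℝ)..s, x ^ m / √(1 + x ^ 2)

theorem continuous_pow_div_sqrt (m : ℕ) : Continuous fun x : ℝ => x ^ m / √(1 + x ^ 2) :=
  Continuous.div (by fun_prop) (by fun_prop) fun x => (Real.sqrt_pos.2 (by positivity)).ne'

theorem hasDerivAt_sinhVol (m : ℕ) (s : ℝ) :
    HasDerivAt (sinhVol m) (((m : ℝ) + 1) * unitBallVol (m + 1) * (s ^ m / √(1 + s ^ 2))) s :=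
  (intervalIntegral.integral_hasDerivAt_right ((continuous_pow_div_sqrt m).intervalIntegrable _ _)
    ((continuous_pow_div_sqrt m).stronglyMeasurableAtFilter _ _)
    (continuous_pow_div_sqrt m).continuousAt).const_mul _

theorem sinhVol_zero (m : ℕ) : sinhVol m 0 = 0 := by simp [sinhVol]

theorem sinhVol_strictMonoOn (m : ℕ) : StrictMonoOn (sinhVol m) (Ici 0) := by
  have hσ := unitBallVol_pos (m + 1)
  refine strictMonoOn_of_deriv_pos (convex_Ici 0)
    (fun s _ => (hasDerivAt_sinhVol m s).continuousAt.continuousWithinAt) fun s hs => ?_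
  rw [interior_Ici] at hs
  have hs0 : 0 < s := hs
  rw [(hasDerivAt_sinhVol m s).deriv]
  positivity

theorem exists_sinhVol_eq {m : ℕ} (hm : 1 ≤ m) {V : ℝ} (hV : 0 < V) : ∃ s, 0 < s ∧ sinhVol m s = V := by
  have hσ := unitBallVol_pos (m + 1)
  set k := ((m : ℝ) + 1) * unitBallVol (m + 1) with hk
  have hk0 : 0 < k := by positivity
  set s₁ := 1 + 2 * V / k with hs₁
  have h1 : 1 ≤ s₁ := by
    have : 0 ≤ 2 * V / k := by positivity
    linarith
  have hI : ∀ a b, IntervalIntegrable (fun x : ℝ => x ^ m / √(1 + x ^ 2)) volume a b := fun a b =>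
    (continuous_pow_div_sqrt m).intervalIntegrable _ _
  have hV1 : V ≤ sinhVol m s₁ := by
    rw [sinhVol, ← intervalIntegral.integral_add_adjacent_intervals (hI 0 1) (hI 1 s₁)]
    have h2 : 0 ≤ ∫ x in (0 : ℝ)..1, x ^ m / √(1 + x ^ 2) :=
      intervalIntegral.integral_nonneg zero_le_one fun x hx => by
        have := hx.1
        positivity
    have h3 : ∫ x in (1 : ℝ)..s₁, (1 / 2 : ℝ) ≤ ∫ x in (1 : ℝ)..s₁, x ^ m / √(1 + x ^ 2) := by
      refine intervalIntegral.integral_mono_on h1 (by simp) (hI _ _) fun x hx => ?_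
      have hx1 := hx.1
      have h4 : √(1 + x ^ 2) ≤ 2 * x := Real.sqrt_le_iff.2 ⟨by linarith, by nlinarith⟩
      have h5 : x ≤ x ^ m := le_self_pow₀ hx1 (by omega)
      rw [div_le_div_iff₀ (by norm_num) (Real.sqrt_pos.2 (by positivity))]
      linarith
    rw [intervalIntegral.integral_const, smul_eq_mul] at h3
    have h6 : (s₁ - 1) * (1 / 2) = V / k := by rw [hs₁]; ring
    rw [h6] at h3
    calc V = k * (V / k) := by field_simp
      _ ≤ _ := mul_le_mul_of_nonneg_left (by linarith) hk0.le
  have hc : ContinuousOn (sinhVol m) (Icc 0 s₁) := fun s _ =>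
    (hasDerivAt_sinhVol m s).continuousAt.continuousWithinAt
  obtain ⟨s, hs, hsV⟩ := intermediate_value_Icc (by linarith) hc
    (show V ∈ Icc (sinhVol m 0) (sinhVol m s₁) from ⟨by rw [sinhVol_zero]; exact hV.le, hV1⟩)
  refine ⟨s, hs.1.lt_of_ne fun h => ?_, hsV⟩
  rw [← h, sinhVol_zero] at hsV
  exact hV.ne hsV

theorem one_lt_coth {s : ℝ} (hs : 0 < s) : 1 < √(1 + s ^ 2) / s := by
  rw [lt_div_iff₀ hs, one_mul]
  exact Real.lt_sqrt_of_sq_lt (by linarith)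

theorem coth_sq_sub_one {s : ℝ} (hs : 0 < s) : (√(1 + s ^ 2) / s) ^ 2 - 1 = s⁻¹ ^ 2 := by
  rw [div_pow, Real.sq_sqrt (by positivity)]
  field_simp
  ring

theorem hypVol_coth {m : ℕ} (hm : 1 ≤ m) {s : ℝ} (hs : 0 < s) :
    hypVol m (√(1 + s ^ 2) / s) = sinhVol m s := by
  have hσ := unitBallVol_pos (m + 1)
  have hd : ∀ s : ℝ, 0 < s → HasDerivAt (fun s => hypVol m (√(1 + s ^ 2) / s) - sinhVol m s) 0 s := by
    intro s hs
    have hr : 0 < √(1 + s ^ 2) := Real.sqrt_pos.2 (by positivity)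
    have hr2 : √(1 + s ^ 2) ^ 2 = 1 + s ^ 2 := Real.sq_sqrt (by positivity)
    have h1 : HasDerivAt (fun s : ℝ => 1 + s ^ 2) (2 * s) s := by
      simpa using (hasDerivAt_pow 2 s).const_add 1
    have h2 : HasDerivAt (fun s : ℝ => √(1 + s ^ 2) / s) (-(1 / (s ^ 2 * √(1 + s ^ 2)))) s := by
      have h := (h1.sqrt (by positivity)).div (hasDerivAt_id' s) hs.ne'
      have e : -(1 / (s ^ 2 * √(1 + s ^ 2))) =
          (2 * s / (2 * √(1 + s ^ 2)) * s - √(1 + s ^ 2) * 1) / s ^ 2 := by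
        field_simp
        rw [hr2]; ring
      rw [e]
      exact h
    have h3 := HasDerivAt.comp (h₂ := hypVol m) (h := fun s : ℝ => √(1 + s ^ 2) / s) s
      (hasDerivAt_hypVol hm (one_lt_coth hs) (inv_pos.2 hs) (coth_sq_sub_one hs)) h2
    have h4 := h3.sub (hasDerivAt_sinhVol m s)
    have e : (0 : ℝ) = -(((m : ℝ) + 1) * unitBallVol (m + 1) * (s⁻¹ ^ (m + 2))⁻¹) *
        -(1 / (s ^ 2 * √(1 + s ^ 2))) - ((m : ℝ) + 1) * unitBallVol (m + 1) * (s ^ m / √(1 + s ^ 2)) := by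
      rw [inv_pow, inv_inv, pow_add]
      field_simp
      ring
    rw [e]
    exact h4
  have hconst : ∀ t ∈ Ioi (0 : ℝ), hypVol m (√(1 + t ^ 2) / t) - sinhVol m t =
      hypVol m (√(1 + s ^ 2) / s) - sinhVol m s := fun t ht =>
    isOpen_Ioi.is_const_of_deriv_eq_zero isPreconnected_Ioi
      (fun x hx => (hd x hx).differentiableAt.differentiableWithinAt)
      (fun x hx => (hd x hx).deriv) ht hs
  have hlim : Tendsto (fun t : ℝ => hypVol m (√(1 + t ^ 2) / t) - sinhVol m t) (𝓝[>] 0) (𝓝 (0 - 0)) := by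
    refine Tendsto.sub ?_ ?_
    · have hub : Tendsto (fun t : ℝ => unitBallVol (m + 1) * t ^ (m + 1) / (√(1 + t ^ 2) - t) ^ (m + 1))
          (𝓝[>] 0) (𝓝 0) := by
        have hc : ContinuousAt (fun t : ℝ => unitBallVol (m + 1) * t ^ (m + 1) /
            (√(1 + t ^ 2) - t) ^ (m + 1)) 0 := by
          refine ContinuousAt.div (by fun_prop) (by fun_prop) ?_
          simp
        have := hc.tendsto
        simp at this
        exact this.mono_left nhdsWithin_le_nhds
      refine tendsto_of_tendsto_of_tendsto_of_le_of_le' tendsto_const_nhds hub ?_ ?_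
      · filter_upwards [self_mem_nhdsWithin] with t ht
        exact hypVol_nonneg (one_lt_coth ht)
      · filter_upwards [self_mem_nhdsWithin] with t ht
        have ht0 : (0 : ℝ) < t := ht
        have h1 := one_lt_coth ht0
        have h2 : 0 < √(1 + t ^ 2) - t := by
          rw [lt_div_iff₀ ht0] at h1
          linarith
        have h3 := hypVol_nonneg_le hm h1
        have e : √(1 + t ^ 2) / t - 1 = (√(1 + t ^ 2) - t) / t := by field_simp
        rw [e, div_pow, mul_div_assoc', div_le_iff₀ (by positivity)] at h3
        rw [le_div_iff₀ (by positivity)]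
        exact h3
    · have := (hasDerivAt_sinhVol m 0).continuousAt.tendsto
      rw [sinhVol_zero] at this
      exact this.mono_left nhdsWithin_le_nhds
  have hev : (fun t : ℝ => hypVol m (√(1 + t ^ 2) / t) - sinhVol m t) =ᶠ[𝓝[>] 0]
      fun _ => hypVol m (√(1 + s ^ 2) / s) - sinhVol m s := by
    filter_upwards [self_mem_nhdsWithin] with t ht
    exact hconst t ht
  have := tendsto_nhds_unique (hlim.congr' hev) tendsto_const_nhds
  linarith

theorem young_for_radius {m : ℕ} (hm : 1 ≤ m) {x : ℝ} (hx0 : 0 < x) :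
    2 * m * x ^ (m - 1) ≤ ((m : ℝ) + 1) + (m - 1) * x ^ (2 * m) := by
  have hm0 : (1 : ℝ) ≤ m := by exact_mod_cast hm
  have h := Real.geom_mean_le_arith_mean2_weighted (w₁ := ((m : ℝ) + 1) / (2 * m))
    (w₂ := ((m : ℝ) - 1) / (2 * m)) (p₁ := 1) (p₂ := x ^ (2 * m)) (by positivity)
    (div_nonneg (by linarith) (by linarith)) zero_le_one (by positivity) (by field_simp; ring)
  rw [Real.one_rpow, one_mul, ← Real.rpow_natCast, ← Real.rpow_mul hx0.le] at h
  have e : ((2 * m : ℕ) : ℝ) * (((m : ℝ) - 1) / (2 * m)) = ((m - 1 : ℕ) : ℝ) := by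
    rw [Nat.cast_sub hm]; push_cast; field_simp
  rw [e, Real.rpow_natCast, Real.rpow_natCast] at h
  calc 2 * m * x ^ (m - 1) ≤ 2 * m * (((m : ℝ) + 1) / (2 * m) * 1 + ((m : ℝ) - 1) / (2 * m) * x ^ (2 * m)) :=
        mul_le_mul_of_nonneg_left h (by positivity)
    _ = _ := by field_simp

theorem one_add_div_le_sqrt {m : ℕ} (hm : 1 ≤ m) {x : ℝ} (hx0 : 0 < x) (hx1 : x < 1) :
    1 + x ^ (m + 1) / m ≤
      √(((1 - x ^ (m + 1)) ^ (1 / (m : ℝ))) ^ 2 + (((m : ℝ) + 1) / m * x) ^ 2) := by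
  have hm0 : (1 : ℝ) ≤ m := by exact_mod_cast hm
  set X := x ^ (m + 1) with hX
  have hX0 : 0 < X := by positivity
  have hX1 : X < 1 := pow_lt_one₀ hx0.le hx1 (by omega)
  have h1 : 1 - X ≤ (1 - X) ^ (1 / (m : ℝ)) := by
    have := Real.rpow_le_rpow_of_exponent_ge (by linarith : 0 < 1 - X) (by linarith : 1 - X ≤ 1)
      (show 1 / (m : ℝ) ≤ 1 by rw [div_le_one (by linarith)]; exact hm0)
    rwa [Real.rpow_one] at this
  refine Real.le_sqrt_of_sq_le ?_
  have h2 : (1 - X) ^ 2 ≤ ((1 - X) ^ (1 / (m : ℝ))) ^ 2 := pow_le_pow_left₀ (by linarith) h1 2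
  refine le_trans ?_ (add_le_add h2 le_rfl)
  have hy := mul_le_mul_of_nonneg_right (young_for_radius hm hx0) (sq_nonneg x)
  have e1 : x ^ (m - 1) * x ^ 2 = X := by
    rw [hX, ← pow_add]; congr 1; omega
  have e2 : x ^ (2 * m) * x ^ 2 = X ^ 2 := by
    rw [hX, ← pow_add, ← pow_mul]; congr 1; ring
  have hy' : 2 * m * X ≤ ((m : ℝ) + 1) * x ^ 2 + (m - 1) * X ^ 2 := by
    calc 2 * m * X = 2 * m * x ^ (m - 1) * x ^ 2 := by rw [← e1]; ring
      _ ≤ _ := hy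
      _ = _ := by rw [add_mul, mul_assoc ((m : ℝ) - 1), e2]
  have hmm : (0 : ℝ) < (m : ℝ) ^ 2 := by positivity
  rw [← mul_le_mul_iff_right₀ hmm]
  have e3 : (m : ℝ) ^ 2 * (1 + X / m) ^ 2 = (m + X) ^ 2 := by field_simp
  have e4 : (m : ℝ) ^ 2 * ((1 - X) ^ 2 + (((m : ℝ) + 1) / m * x) ^ 2) =
      m ^ 2 * (1 - X) ^ 2 + (((m : ℝ) + 1) * x) ^ 2 := by field_simp
  rw [e3, e4]
  nlinarith [mul_le_mul_of_nonneg_left hy' (by positivity : (0 : ℝ) ≤ (m : ℝ) + 1)]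

theorem sinhVol_comparison {m : ℕ} (hm : 1 ≤ m) {x : ℝ} (hx0 : 0 < x) (hx1 : x < 1) :
    sinhVol m (((m : ℝ) + 1) / m * x * ((1 - x ^ (m + 1)) ^ (1 / (m : ℝ)))⁻¹) ≤
      unitBallVol (m + 1) * ((((m : ℝ) + 1) / m) ^ (m + 1) * (x ^ (m + 1) / (1 - x ^ (m + 1)))) := by
  have hm0 : (0 : ℝ) < m := by exact_mod_cast hm
  have hσ := unitBallVol_pos (m + 1)
  set S : ℝ → ℝ := fun x => ((m : ℝ) + 1) / m * x * ((1 - x ^ (m + 1)) ^ (1 / (m : ℝ)))⁻¹ with hS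
  set N : ℝ → ℝ := fun x => unitBallVol (m + 1) *
    ((((m : ℝ) + 1) / m) ^ (m + 1) * (x ^ (m + 1) / (1 - x ^ (m + 1)))) with hN
  have hlt : ∀ x ∈ Ico (0 : ℝ) 1, 0 < 1 - x ^ (m + 1) := fun x hx => by
    have := pow_lt_one₀ hx.1 hx.2 (n := m + 1) (by omega)
    linarith
  have hSc : ContinuousOn S (Ico 0 1) := by
    refine ContinuousOn.mul (by fun_prop) (ContinuousOn.inv₀ ?_ fun x hx => (Real.rpow_pos_of_pos (hlt x hx) _).ne')
    exact ContinuousOn.rpow_const (by fun_prop) fun x hx => Or.inl (hlt x hx).ne'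
  have hNc : ContinuousOn N (Ico 0 1) :=
    continuousOn_const.mul (continuousOn_const.mul
      (ContinuousOn.div (by fun_prop) (by fun_prop) fun x hx => (hlt x hx).ne'))
  have hTc : Continuous (sinhVol m) := continuous_iff_continuousAt.2 fun s => (hasDerivAt_sinhVol m s).continuousAt
  have hmono : MonotoneOn (fun x => N x - sinhVol m (S x)) (Ico 0 1) := by
    refine monotoneOn_of_hasDerivWithinAt_nonneg (f' := fun x =>
      unitBallVol (m + 1) * ((((m : ℝ) + 1) / m) ^ (m + 1) * (((m : ℝ) + 1) * x ^ m / (1 - x ^ (m + 1)) ^ 2)) -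
        ((m : ℝ) + 1) * unitBallVol (m + 1) * (S x ^ m / √(1 + S x ^ 2)) *
        (((m : ℝ) + 1) / m * ((1 + x ^ (m + 1) / m) *
          ((1 - x ^ (m + 1)) ^ (1 / (m : ℝ)))⁻¹ / (1 - x ^ (m + 1)))))
      (convex_Ico 0 1) (hNc.sub (hTc.comp_continuousOn hSc)) ?_ ?_
    · intro x hx
      rw [interior_Ico] at hx
      have hx0 := hx.1
      have hl := hlt x ⟨hx.1.le, hx.2⟩
      set L := 1 - x ^ (m + 1) with hL
      have hLd : HasDerivAt (fun x : ℝ => 1 - x ^ (m + 1)) (-(((m : ℝ) + 1) * x ^ m)) x := by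
        simpa using (hasDerivAt_pow (m + 1) x).const_sub 1
      have hpd : HasDerivAt (fun x : ℝ => x ^ (m + 1)) (((m : ℝ) + 1) * x ^ m) x := by
        simpa using hasDerivAt_pow (m + 1) x
      have h1 := (((hpd.div hLd hl.ne').const_mul ((((m : ℝ) + 1) / m) ^ (m + 1))).const_mul
        (unitBallVol (m + 1)))
      have hLp : 0 < L ^ (1 / (m : ℝ)) := Real.rpow_pos_of_pos hl _
      have h2 := (((hasDerivAt_id' x).const_mul (((m : ℝ) + 1) / m)).mul
        ((hLd.rpow_const (p := 1 / (m : ℝ)) (Or.inl hl.ne')).inv hLp.ne'))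
      have h3 := h1.sub (HasDerivAt.comp (h₂ := sinhVol m) (h := S) x (hasDerivAt_sinhVol m (S x)) h2)
      refine HasDerivAt.hasDerivWithinAt ?_
      have e : unitBallVol (m + 1) * ((((m : ℝ) + 1) / m) ^ (m + 1) * (((m : ℝ) + 1) * x ^ m / L ^ 2)) -
        ((m : ℝ) + 1) * unitBallVol (m + 1) * (S x ^ m / √(1 + S x ^ 2)) *
        (((m : ℝ) + 1) / m * ((1 + x ^ (m + 1) / m) * (L ^ (1 / (m : ℝ)))⁻¹ / L)) =
        unitBallVol (m + 1) * ((((m : ℝ) + 1) / m) ^ (m + 1) *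
          ((((m : ℝ) + 1) * x ^ m * L - x ^ (m + 1) * -(((m : ℝ) + 1) * x ^ m)) / L ^ 2)) -
        ((m : ℝ) + 1) * unitBallVol (m + 1) * (S x ^ m / √(1 + S x ^ 2)) *
        (((m : ℝ) + 1) / m * 1 * (L ^ (1 / (m : ℝ)))⁻¹ + ((m : ℝ) + 1) / m * x *
          (-(-(((m : ℝ) + 1) * x ^ m) * (1 / (m : ℝ)) * L ^ (1 / (m : ℝ) - 1)) / (L ^ (1 / (m : ℝ))) ^ 2)) := by
        have e1 : ((m : ℝ) + 1) * x ^ m * L - x ^ (m + 1) * -(((m : ℝ) + 1) * x ^ m) = ((m : ℝ) + 1) * x ^ m := by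
          rw [hL]; ring
        rw [e1, Real.rpow_sub_one hl.ne']
        congr 2
        have e2 : x ^ (m + 1) = x * x ^ m := by ring
        have e3 : L = 1 - x * x ^ m := by rw [hL, e2]
        rw [e2]
        field_simp
        rw [e3]
        ring
      rw [e]
      exact h3
    · intro x hx
      rw [interior_Ico] at hx
      have hx0 := hx.1
      have hl := hlt x ⟨hx.1.le, hx.2⟩
      have key := one_add_div_le_sqrt hm hx.1 hx.2
      simp only [hS]
      set L := 1 - x ^ (m + 1) with hL
      set R := L ^ (1 / (m : ℝ)) with hR
      have hR0 : 0 < R := Real.rpow_pos_of_pos hl _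
      have hRm : R ^ m = L := by
        rw [hR, ← Real.rpow_natCast, ← Real.rpow_mul hl.le, one_div_mul_cancel hm0.ne', Real.rpow_one]
      set D := √(R ^ 2 + (((m : ℝ) + 1) / m * x) ^ 2) with hD
      have hD0 : 0 < D := Real.sqrt_pos.2 (by positivity)
      have hsq : √(1 + (((m : ℝ) + 1) / m * x * R⁻¹) ^ 2) = D * R⁻¹ := by
        rw [hD, ← Real.sqrt_sq (inv_pos.2 hR0).le, ← Real.sqrt_mul (by positivity)]
        congr 1
        rw [Real.sqrt_sq (inv_pos.2 hR0).le]
        field_simp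
      rw [hsq, sub_nonneg]
      have e : ((m : ℝ) + 1) * unitBallVol (m + 1) * ((((m : ℝ) + 1) / m * x * R⁻¹) ^ m / (D * R⁻¹)) *
        (((m : ℝ) + 1) / m * ((1 + x ^ (m + 1) / m) * R⁻¹ / L)) =
        unitBallVol (m + 1) * ((((m : ℝ) + 1) / m) ^ (m + 1) * (((m : ℝ) + 1) * x ^ m / L ^ 2)) *
          ((1 + x ^ (m + 1) / m) / D) := by
        rw [mul_pow _ R⁻¹, inv_pow, hRm, mul_pow _ x, pow_succ (((m : ℝ) + 1) / m)]
        generalize (((m : ℝ) + 1) / m) ^ m = A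
        generalize (1 + x ^ (m + 1) / (m : ℝ)) = B
        field_simp
      rw [e]
      exact mul_le_of_le_one_right (by positivity) ((div_le_one hD0).2 key)
  have h := hmono (left_mem_Ico.2 zero_lt_one) ⟨hx0.le, hx1⟩ hx0.le
  have hS0 : S 0 = 0 := by simp [hS]
  have hN0 : N 0 = 0 := by simp [hN]
  simp only [hS0, hN0, sinhVol_zero] at h
  linarith

/-- The isoperimetric lower bound: `n`-th power of the comparison perimeter. -/
noncomputable def isoPow (m : ℕ) (V : ℝ) : ℝ :=
  ((m : ℝ) * V) ^ (m + 1) + ((m : ℝ) + 1) ^ (m + 1) * unitBallVol (m + 1) * V ^ m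

theorem exists_hypVol_eq {m : ℕ} (hm : 1 ≤ m) {V : ℝ} (hV : 0 < V) :
    ∃ c, 1 < c ∧ hypVol m c = V ∧ isoPow m V ≤ hypPer m c ^ (m + 1) ∧ 0 ≤ hypPer m c := by
  have hm0 : (0 : ℝ) < m := by exact_mod_cast hm
  have hσ := unitBallVol_pos (m + 1)
  set σ := unitBallVol (m + 1) with hσd
  set κ := (((m : ℝ) + 1) / m) ^ (m + 1) with hκ
  have hκ0 : 0 < κ := by positivity
  set ν := V / σ with hν
  have hν0 : 0 < ν := by positivity
  set y := ν / (ν + κ) with hy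
  have hy0 : 0 < y := by positivity
  have hy1 : y < 1 := by rw [hy, div_lt_one (by positivity)]; linarith
  set x := y ^ (1 / ((m : ℝ) + 1)) with hx
  have hx0 : 0 < x := Real.rpow_pos_of_pos hy0 _
  have hx1 : x < 1 := Real.rpow_lt_one hy0.le hy1 (by positivity)
  have hxy : x ^ (m + 1) = y := by
    rw [hx, ← Real.rpow_natCast, ← Real.rpow_mul hy0.le]
    push_cast
    rw [one_div_mul_cancel (by positivity), Real.rpow_one]
  have hcmp := sinhVol_comparison hm hx0 hx1
  rw [hxy, ← hκ, ← hσd] at hcmp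
  have hyk : κ * (y / (1 - y)) = ν := by
    have h1 : 1 - y = κ / (ν + κ) := by rw [hy]; field_simp; ring
    rw [h1, hy]; field_simp
  rw [hyk, hν, mul_div_cancel₀ _ hσ.ne'] at hcmp
  obtain ⟨s, hs0, hsV⟩ := exists_sinhVol_eq hm hV
  set R := (1 - y) ^ (1 / (m : ℝ)) with hR
  have hl : 0 < 1 - y := by linarith
  have hR0 : 0 < R := Real.rpow_pos_of_pos hl _
  have hRm : R ^ m = 1 - y := by
    rw [hR, ← Real.rpow_natCast, ← Real.rpow_mul hl.le, one_div_mul_cancel hm0.ne', Real.rpow_one]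
  set S := ((m : ℝ) + 1) / m * x * R⁻¹ with hS
  have hS0 : 0 < S := by positivity
  rw [← hsV] at hcmp
  have hSs : S ≤ s := (sinhVol_strictMonoOn m).le_iff_le hS0.le hs0.le |>.1 hcmp
  have hP := hypPer_eq hm (one_lt_coth hs0) (inv_pos.2 hs0) (coth_sq_sub_one hs0)
  rw [inv_pow, inv_inv] at hP
  refine ⟨√(1 + s ^ 2) / s, one_lt_coth hs0, (hypVol_coth hm hs0).trans hsV, ?_, ?_⟩
  · rw [hP, ← hσd]
    have h1 : (((m : ℝ) + 1) * σ * S ^ m) ^ (m + 1) ≤ (((m : ℝ) + 1) * σ * s ^ m) ^ (m + 1) := by gcongr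
    refine le_trans (le_of_eq ?_) h1
    have hSm : S ^ m = (((m : ℝ) + 1) / m) ^ m * x ^ m / (1 - y) := by
      rw [hS, mul_pow, mul_pow, inv_pow, hRm]; rfl
    have h2 : (((m : ℝ) + 1) * σ * S ^ m) ^ (m + 1) =
        ((m : ℝ) + 1) ^ (m + 1) * σ ^ (m + 1) * (κ ^ m * y ^ m) / (1 - y) ^ (m + 1) := by
      rw [hSm, ← hxy, hκ, mul_pow, mul_pow, div_pow _ (1 - x ^ (m + 1)), mul_pow _ (x ^ m), ← pow_mul, ← pow_mul, ← pow_mul,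
        ← pow_mul, mul_comm m (m + 1)]
      ring
    rw [h2, isoPow, ← hσd]
    have hV' : V = σ * (κ * (y / (1 - y))) := by rw [hyk, hν, mul_div_cancel₀ _ hσ.ne']
    have hmκ : (m : ℝ) ^ (m + 1) * κ = ((m : ℝ) + 1) ^ (m + 1) := by
      rw [hκ, ← mul_pow, mul_div_cancel₀ _ hm0.ne']
    rw [hV', mul_pow, ← hmκ, pow_succ (σ * (κ * (y / (1 - y)))), mul_pow σ, mul_pow κ, div_pow,
      pow_succ (1 - y), pow_succ σ]
    have : (1 - y) ^ m ≠ 0 := by positivity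
    field_simp
    ring
  · rw [hP]; positivity

theorem isoPow_mono (m : ℕ) {V W : ℝ} (hV : 0 ≤ V) (h : V ≤ W) : isoPow m V ≤ isoPow m W := by
  have hσ := unitBallVol_pos (m + 1)
  unfold isoPow
  gcongr

theorem isoPow_nonneg (m : ℕ) {V : ℝ} (hV : 0 ≤ V) : 0 ≤ isoPow m V := by
  have hσ := unitBallVol_pos (m + 1)
  unfold isoPow
  positivity

/-- The isoperimetric lower bound for the perimeter of a set of volume `V`. -/
noncomputable def iso (m : ℕ) (V : ℝ) : ℝ := isoPow m V ^ (1 / ((m : ℝ) + 1))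

/-- The error coefficient in the capacity estimate. -/
noncomputable def isoErr (m : ℕ) (V : ℝ) : ℝ :=
  ((m : ℝ) + 1) * (2 + (unitBallVol (m + 1) / V) ^ (1 / ((m : ℝ) + 1)))

theorem iso_sub_le_integral {m : ℕ} (hm : 1 ≤ m) {w : Euc (m + 1) → ℝ} (hw : ContDiff ℝ 1 w)
    (hs : HasCompactSupport w) (hpos : ∀ x ∈ tsupport w, 0 < x 0) (hw0 : ∀ x, 0 ≤ w x)
    (hw1 : ∀ x, w x ≤ 1) {V h : ℝ} (hV : 0 < V) (hmass : V ≤ ∫ x, w x * (x 0 ^ (m + 1))⁻¹)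
    (hh0 : 0 ≤ h) (hh : ∫ x in {x | 0 < w x ∧ w x < 1}, (x 0 ^ (m + 1))⁻¹ ≤ h) :
    iso m V - isoErr m V * h ≤ ∫ x, ‖fderiv ℝ w x‖ * (x 0 ^ m)⁻¹ := by
  have hσ := unitBallVol_pos (m + 1)
  set W := ∫ x, w x * (x 0 ^ (m + 1))⁻¹ with hW
  have hW0 : 0 < W := hV.trans_le hmass
  obtain ⟨c, hc1, hcW, hiso, hper⟩ := exists_hypVol_eq hm hW0
  have h1 := hypPer_sub_le_integral hm hw hs hpos hw0 hw1 hc1 hcW.symm hh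
  refine le_trans (sub_le_sub ?_ ?_) h1
  · have h2 : isoPow m V ≤ hypPer m c ^ (m + 1) := (isoPow_mono m hV.le hmass).trans hiso
    have h3 := Real.rpow_le_rpow (isoPow_nonneg m hV.le) h2
      (by positivity : 0 ≤ 1 / ((m : ℝ) + 1))
    rwa [← Real.rpow_natCast (hypPer m c), ← Real.rpow_mul hper, Nat.cast_add_one,
      mul_one_div_cancel (by positivity), Real.rpow_one] at h3
  · have h2 := hypVol_nonneg_le hm hc1
    have h3 : (c - 1) ^ (m + 1) ≤ unitBallVol (m + 1) / V := by
      rw [le_div_iff₀ hV, mul_comm]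
      refine le_trans (mul_le_mul_of_nonneg_right (hmass.trans hcW.ge) ?_) h2
      exact pow_nonneg (by linarith) _
    have h4 := Real.rpow_le_rpow (pow_nonneg (by linarith) _) h3
      (by positivity : 0 ≤ 1 / ((m : ℝ) + 1))
    rw [← Real.rpow_natCast, ← Real.rpow_mul (by linarith), Nat.cast_add_one,
      mul_one_div_cancel (by positivity), Real.rpow_one] at h4
    exact mul_le_mul_of_nonneg_right (mul_le_mul_of_nonneg_left (by linarith) (by positivity)) hh0

/-- The distribution function of `F`. -/
noncomputable def distr {X : Type*} [MeasurableSpace X] (μ : Measure X) (F : X → ℝ) (τ : ℝ) : ℝ :=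
  μ.real {x | τ < F x}

/-- The decreasing rearrangement of `F`. -/
noncomputable def rearr {X : Type*} [MeasurableSpace X] (μ : Measure X) (F : X → ℝ) (V : ℝ) : ℝ :=
  sInf {τ | 0 ≤ τ ∧ distr μ F τ ≤ V}

/-- Nonnegative bounded measurable functions supported on a set of finite measure. -/
structure IsProfile {X : Type*} [MeasurableSpace X] (μ : Measure X) (F : X → ℝ) (B : ℝ) : Prop where
  meas : Measurable F
  nonneg : ∀ x, 0 ≤ F x
  le : ∀ x, F x ≤ B
  fin : μ {x | 0 < F x} < ⊤

namespace IsProfile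

variable {X : Type*} [MeasurableSpace X] {μ : Measure X} {F : X → ℝ} {B : ℝ}

theorem fin_lt (hF : IsProfile μ F B) {τ : ℝ} (hτ : 0 ≤ τ) : μ {x | τ < F x} < ⊤ :=
  (measure_mono fun _ hx => hτ.trans_lt hx).trans_lt hF.fin

theorem fin_le (hF : IsProfile μ F B) {τ : ℝ} (hτ : 0 < τ) : μ {x | τ ≤ F x} < ⊤ :=
  (measure_mono fun _ hx => hτ.trans_le hx).trans_lt hF.fin

theorem meas_lt (hF : IsProfile μ F B) (τ : ℝ) : MeasurableSet {x | τ < F x} :=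
  measurableSet_lt measurable_const hF.meas

theorem distr_antitoneOn (hF : IsProfile μ F B) : AntitoneOn (distr μ F) (Ici 0) := fun _ hτ _ _ h =>
  measureReal_mono (fun _ hx => h.trans_lt hx) (hF.fin_lt hτ).ne

theorem distr_max (hF : IsProfile μ F B) : distr μ F (max B 0) = 0 := by
  have : {x | max B 0 < F x} = ∅ := by
    ext x; simp [hF.le x]
  rw [distr, this, measureReal_empty]

theorem rearr_nonneg (μ : Measure X) (F : X → ℝ) (V : ℝ) : 0 ≤ rearr μ F V := Real.sInf_nonneg fun _ h => h.1

theorem mem_of_nonneg (hF : IsProfile μ F B) {V : ℝ} (hV : 0 ≤ V) :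
    max B 0 ∈ {τ | 0 ≤ τ ∧ distr μ F τ ≤ V} := ⟨le_max_right _ _, hF.distr_max.trans_le hV⟩

theorem rearr_le_of {V τ : ℝ} (hτ : 0 ≤ τ) (h : distr μ F τ ≤ V) : rearr μ F V ≤ τ :=
  csInf_le ⟨0, fun _ h => h.1⟩ ⟨hτ, h⟩

theorem rearr_le (hF : IsProfile μ F B) {V : ℝ} (hV : 0 ≤ V) : rearr μ F V ≤ max B 0 :=
  rearr_le_of (le_max_right _ _) (hF.distr_max.trans_le hV)

theorem rearr_antitoneOn (hF : IsProfile μ F B) : AntitoneOn (rearr μ F) (Ici 0) := fun _ hV _ _ h =>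
  csInf_le_csInf ⟨0, fun _ h => h.1⟩ ⟨_, hF.mem_of_nonneg hV⟩ fun _ hτ => ⟨hτ.1, hτ.2.trans h⟩

theorem lt_rearr_iff (hF : IsProfile μ F B) {V τ : ℝ} (hV : 0 ≤ V) (hτ : 0 ≤ τ) :
    τ < rearr μ F V ↔ V < distr μ F τ := by
  constructor
  · intro h
    by_contra! h'
    exact absurd (rearr_le_of hτ h') (not_le.2 h)
  · intro h
    have hmono : Monotone fun k : ℕ => {x | τ + 1 / ((k : ℝ) + 1) < F x} := fun j k hjk x hx => by
      have hx' : τ + 1 / ((j : ℝ) + 1) < F x := hx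
      have hjk' : (j : ℝ) ≤ k := by exact_mod_cast hjk
      have h2 : 1 / ((k : ℝ) + 1) ≤ 1 / ((j : ℝ) + 1) :=
        one_div_le_one_div_of_le (by positivity) (by linarith)
      show τ + 1 / ((k : ℝ) + 1) < F x
      linarith
    have hU : ⋃ k : ℕ, {x | τ + 1 / ((k : ℝ) + 1) < F x} = {x | τ < F x} := by
      ext x
      simp only [mem_iUnion, mem_ofPred_eq]
      constructor
      · rintro ⟨k, hk⟩
        have : 0 < 1 / ((k : ℝ) + 1) := by positivity
        linarith
      · intro hx
        obtain ⟨k, hk⟩ := exists_nat_one_div_lt (sub_pos.2 hx)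
        exact ⟨k, by linarith⟩
    have ht := tendsto_measure_iUnion_atTop (μ := μ) hmono
    rw [hU] at ht
    have ht' := (ENNReal.tendsto_toReal (hF.fin_lt hτ).ne).comp ht
    obtain ⟨k, hk⟩ := (ht'.eventually (lt_mem_nhds h)).exists
    have hk' : V < distr μ F (τ + 1 / ((k : ℝ) + 1)) := hk
    have hp : 0 < 1 / ((k : ℝ) + 1) := by positivity
    refine lt_of_lt_of_le (lt_add_of_pos_right τ hp) (le_csInf ⟨_, hF.mem_of_nonneg hV⟩ fun σ hσ => ?_)
    by_contra! hlt
    have := hF.distr_antitoneOn hσ.1 (show (0 : ℝ) ≤ τ + 1 / ((k : ℝ) + 1) by positivity) hlt.le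
    linarith [hσ.2]

theorem distr_rearr_le (hF : IsProfile μ F B) {V : ℝ} (hV : 0 ≤ V) : distr μ F (rearr μ F V) ≤ V := by
  by_contra! h
  exact lt_irrefl _ ((hF.lt_rearr_iff hV (rearr_nonneg μ F V)).2 h)

theorem le_measureReal_rearr_le (hF : IsProfile μ F B) {V : ℝ} (hV : 0 ≤ V) (hpos : 0 < rearr μ F V) :
    V ≤ μ.real {x | rearr μ F V ≤ F x} := by
  set t := rearr μ F V
  have hanti : Antitone fun k : ℕ => {x | t - t / ((k : ℝ) + 1) < F x} := fun j k hjk x hx => by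
    have hjk' : (j : ℝ) ≤ k := by exact_mod_cast hjk
    have h2 : t / ((k : ℝ) + 1) ≤ t / ((j : ℝ) + 1) :=
      div_le_div_of_nonneg_left hpos.le (by positivity) (by linarith)
    have hx' : t - t / ((k : ℝ) + 1) < F x := hx
    show t - t / ((j : ℝ) + 1) < F x
    linarith
  have hU : ⋂ k : ℕ, {x | t - t / ((k : ℝ) + 1) < F x} = {x | t ≤ F x} := by
    ext x
    simp only [mem_iInter, mem_ofPred_eq]
    constructor
    · intro h
      by_contra! hlt
      obtain ⟨k, hk⟩ := exists_nat_one_div_lt (div_pos (sub_pos.2 hlt) hpos)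
      have := h k
      rw [lt_div_iff₀ hpos, one_div_mul_eq_div] at hk
      linarith
    · intro h k
      have : 0 < t / ((k : ℝ) + 1) := by positivity
      linarith
  have hnn : ∀ k : ℕ, 0 ≤ t - t / ((k : ℝ) + 1) := fun k =>
    sub_nonneg.2 (div_le_self hpos.le (by simp))
  have ht := tendsto_measure_iInter_atTop (μ := μ) (fun k => (hF.meas_lt _).nullMeasurableSet) hanti
    ⟨0, (hF.fin_lt (hnn 0)).ne⟩
  rw [hU] at ht
  have ht' := (ENNReal.tendsto_toReal (hF.fin_le hpos).ne).comp ht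
  refine ge_of_tendsto' ht' fun k => ?_
  have hp : 0 < t / ((k : ℝ) + 1) := by positivity
  exact ((hF.lt_rearr_iff hV (hnn k)).1 (by linarith)).le

theorem measure_between_le (hF : IsProfile μ F B) {V h : ℝ} (hV : 0 < V) (hh : 0 ≤ h)
    (hlt : rearr μ F (V + h) < rearr μ F V) :
    μ {x | rearr μ F (V + h) < F x ∧ F x < rearr μ F V} ≤ ENNReal.ofReal h := by
  have hs := rearr_nonneg μ F (V + h)
  have ht : 0 < rearr μ F V := hs.trans_lt hlt
  have h1 := hF.le_measureReal_rearr_le hV.le ht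
  have h2 := hF.distr_rearr_le (add_nonneg hV.le hh)
  set s := rearr μ F (V + h)
  set t := rearr μ F V
  have h3 : {x | s < F x} = {x | s < F x ∧ F x < t} ∪ {x | t ≤ F x} := by
    ext x
    simp only [mem_union, mem_ofPred_eq]
    constructor
    · intro h
      rcases lt_or_ge (F x) t with h' | h'
      · exact Or.inl ⟨h, h'⟩
      · exact Or.inr h'
    · rintro (h | h)
      · exact h.1
      · exact hlt.trans_le h
  have hd : Disjoint {x | s < F x ∧ F x < t} {x | t ≤ F x} :=
    Set.disjoint_left.2 fun x hx hx' => absurd hx.2 (not_lt.2 hx')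
  have hfin1 : μ {x | s < F x ∧ F x < t} ≠ ⊤ := ((measure_mono fun x hx => hx.1).trans_lt (hF.fin_lt hs)).ne
  have h4 : μ.real {x | s < F x} = μ.real {x | s < F x ∧ F x < t} + μ.real {x | t ≤ F x} := by
    rw [h3]
    exact measureReal_union hd (measurableSet_le measurable_const hF.meas) hfin1 (hF.fin_le ht).ne
  have h5 : μ.real {x | s < F x ∧ F x < t} ≤ h := by
    have : μ.real {x | s < F x} ≤ V + h := h2
    linarith
  rw [← ENNReal.ofReal_toReal hfin1]
  exact ENNReal.ofReal_le_ofReal h5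

theorem volume_between_le (hF : IsProfile μ F B) {c h : ℝ} (hc : 0 ≤ c) (hh : 0 ≤ h) :
    volume {V | 0 < V ∧ rearr μ F (V + h) < c ∧ c < rearr μ F V} ≤ ENNReal.ofReal h := by
  have : {V | 0 < V ∧ rearr μ F (V + h) < c ∧ c < rearr μ F V} ⊆ Ico (distr μ F c - h) (distr μ F c) := by
    rintro V ⟨hV, h1, h2⟩
    refine ⟨?_, (hF.lt_rearr_iff hV.le hc).1 h2⟩
    have := (hF.lt_rearr_iff (add_nonneg hV.le hh) hc).not.1 (not_lt.2 h1.le)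
    linarith
  refine (measure_mono this).trans ?_
  rw [Real.volume_Ico]
  exact ENNReal.ofReal_le_ofReal (by linarith)

theorem measurable_rearr_restrict (hF : IsProfile μ F B) :
    Measurable fun V => rearr μ F (max V 0) := by
  have : Antitone fun V => rearr μ F (max V 0) := fun V W h =>
    hF.rearr_antitoneOn (mem_Ici.2 (le_max_right _ _)) (mem_Ici.2 (le_max_right _ _))
      (max_le_max_right 0 h)
  exact this.measurable

theorem lintegral_rearr_rpow (hF : IsProfile μ F B) {q : ℝ} (hq : 0 < q) :
    ∫⁻ V in Ioi 0, ENNReal.ofReal (rearr μ F V ^ q) = ∫⁻ x, ENNReal.ofReal (F x ^ q) ∂μ := by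
  have hm : AEMeasurable (rearr μ F) (volume.restrict (Ioi 0)) := by
    refine ⟨_, hF.measurable_rearr_restrict, ?_⟩
    filter_upwards [ae_restrict_mem measurableSet_Ioi] with V hV
    rw [max_eq_left (le_of_lt hV)]
  rw [lintegral_rpow_eq_lintegral_meas_lt_mul _ (ae_of_all _ fun V => rearr_nonneg μ F V) hm hq,
    lintegral_rpow_eq_lintegral_meas_lt_mul μ (ae_of_all _ hF.nonneg) hF.meas.aemeasurable hq]
  congr 1
  refine setLIntegral_congr_fun measurableSet_Ioi fun t ht => ?_
  have ht0 : (0 : ℝ) < t := ht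
  have e : {V | t < rearr μ F V} ∩ Ioi 0 = Ioo 0 (distr μ F t) := by
    ext V
    constructor
    · rintro ⟨h1, h2⟩
      exact ⟨h2, (hF.lt_rearr_iff (le_of_lt h2) ht0.le).1 h1⟩
    · rintro ⟨h1, h2⟩
      exact ⟨(hF.lt_rearr_iff h1.le ht0.le).2 h2, h1⟩
  rw [Measure.restrict_apply₀' measurableSet_Ioi.nullMeasurableSet, e, Real.volume_Ioo, sub_zero, distr,
    ofReal_measureReal (hF.fin_lt ht0.le).ne]

end IsProfile

/-- Capacity lower bound for the layers `{s < F < t}` of `F`, with gradient `D`, isoperimetric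
function `A` and error coefficient `C`. -/
structure CapacityBound {X : Type*} [MeasurableSpace X] (μ : Measure X) (F : X → ℝ) (D : X → ENNReal)
    (A C : ℝ → ℝ) : Prop where
  bound : ∀ V h s t, 0 < V → 0 < h → 0 ≤ s → s < t → V ≤ μ.real {x | t ≤ F x} →
    μ.real {x | s < F x} ≤ V + h →
    ENNReal.ofReal ((t - s) * (A V - C V * h)) ≤ ∫⁻ x in {x | s < F x ∧ F x < t}, D x ∂μ
  pos : ∀ V, 0 < V → 0 < A V
  mono : ∀ V W, 0 < V → V ≤ W → A V ≤ A W
  err_nonneg : ∀ V, 0 < V → 0 ≤ C V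
  err_anti : ∀ V W, 0 < V → V ≤ W → C W ≤ C V

namespace IsProfile

variable {X : Type*} [MeasurableSpace X] {μ : Measure X} {F : X → ℝ} {B : ℝ}
  {D : X → ENNReal} {A C : ℝ → ℝ}

theorem ofReal_sub_mul_le (hF : IsProfile μ F B) (hcap : CapacityBound μ F D A C) {V h : ℝ}
    (hV : 0 < V) (hh : 0 < h) (hlt : rearr μ F (V + h) < rearr μ F V) :
    ENNReal.ofReal ((rearr μ F V - rearr μ F (V + h)) * (A V - C V * h)) ≤
      ∫⁻ x in {x | rearr μ F (V + h) < F x ∧ F x < rearr μ F V}, D x ∂μ :=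
  hcap.bound V h _ _ hV hh (rearr_nonneg _ _ _) hlt
    (hF.le_measureReal_rearr_le hV.le ((rearr_nonneg _ _ _).trans_lt hlt))
    (hF.distr_rearr_le (by positivity))

theorem exists_lipschitzOnWith (hF : IsProfile μ F B) (hcap : CapacityBound μ F D A C) {L : ℝ}
    (hL : 0 ≤ L) (hD : ∀ x, D x ≤ ENNReal.ofReal L) {a : ℝ} (ha : 0 < a) :
    ∃ K, LipschitzOnWith K (rearr μ F) (Ici a) := by
  have hAa := hcap.pos a ha
  have hCa := hcap.err_nonneg a ha
  set δ := A a / (2 * (C a + 1)) with hδ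
  have hδ0 : 0 < δ := by positivity
  set K := 2 * L / A a with hK
  have hK0 : 0 ≤ K := by positivity
  have hstep : ∀ V, a ≤ V → ∀ h, 0 ≤ h → h ≤ δ → rearr μ F V - rearr μ F (V + h) ≤ K * h := by
    intro V hV h hh hhδ
    rcases hh.eq_or_lt with rfl | hh0
    · simp
    rcases le_or_gt (rearr μ F V) (rearr μ F (V + h)) with hle | hlt
    · have : 0 ≤ K * h := by positivity
      linarith
    have hV0 : 0 < V := ha.trans_le hV
    have h1 := hF.ofReal_sub_mul_le hcap hV0 hh0 hlt
    have h2 : ∫⁻ x in {x | rearr μ F (V + h) < F x ∧ F x < rearr μ F V}, D x ∂μ ≤ ENNReal.ofReal (L * h) := by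
      calc _ ≤ ∫⁻ x in {x | rearr μ F (V + h) < F x ∧ F x < rearr μ F V}, ENNReal.ofReal L ∂μ :=
            lintegral_mono fun x => hD x
        _ = ENNReal.ofReal L * μ {x | rearr μ F (V + h) < F x ∧ F x < rearr μ F V} := by
            rw [setLIntegral_const]
        _ ≤ ENNReal.ofReal L * ENNReal.ofReal h := mul_le_mul_right (hF.measure_between_le hV0 hh hlt) _
        _ = _ := (ENNReal.ofReal_mul hL).symm
    have h3 := (ENNReal.ofReal_le_ofReal_iff (by positivity)).1 (h1.trans h2)
    have h4 : A a / 2 ≤ A V - C V * h := by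
      have e1 := hcap.mono a V ha hV
      have e2 := mul_le_mul (hcap.err_anti a V ha hV) hhδ hh hCa
      have e3 : C a * δ ≤ A a / 2 := by
        rw [hδ, mul_div_assoc', div_le_div_iff₀ (by positivity) (by norm_num)]
        nlinarith
      linarith
    have h5 := mul_le_mul_of_nonneg_left h4 (sub_nonneg.2 hlt.le)
    have h6 : K * h = 2 / A a * (L * h) := by rw [hK]; ring
    rw [h6]
    have h7 := mul_le_mul_of_nonneg_left (h5.trans h3) (by positivity : 0 ≤ 2 / A a)
    refine le_trans (le_of_eq ?_) h7
    field_simp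
  have hind : ∀ N : ℕ, ∀ V, a ≤ V → ∀ h, 0 ≤ h → h ≤ N * δ →
      rearr μ F V - rearr μ F (V + h) ≤ K * h := by
    intro N
    induction N with
    | zero =>
      intro V hV h hh hhN
      have : h = 0 := by simp at hhN; linarith
      simp [this]
    | succ N ih =>
      intro V hV h hh hhN
      rcases le_or_gt h δ with hle | hlt
      · exact hstep V hV h hh hle
      push_cast at hhN
      have h1 := hstep V hV δ hδ0.le le_rfl
      have h2 := ih (V + δ) (by linarith) (h - δ) (by linarith) (by linarith)
      rw [show V + δ + (h - δ) = V + h by ring] at h2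
      linarith
  have hfull : ∀ V W, a ≤ V → V ≤ W → |rearr μ F V - rearr μ F W| ≤ K * |V - W| := by
    intro V W hV hVW
    obtain ⟨N, hN⟩ := exists_nat_ge ((W - V) / δ)
    have h1 := hind N V hV (W - V) (by linarith) ((div_le_iff₀ hδ0).1 hN)
    rw [add_sub_cancel] at h1
    have hm := hF.rearr_antitoneOn (ha.le.trans hV : (0 : ℝ) ≤ V) (ha.le.trans (hV.trans hVW) : (0 : ℝ) ≤ W) hVW
    rw [abs_of_nonneg (sub_nonneg.2 hm), abs_of_nonpos (by linarith)]
    linarith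
  refine ⟨K.toNNReal, LipschitzOnWith.of_dist_le_mul fun V hV W hW => ?_⟩
  rw [Real.dist_eq, Real.dist_eq, Real.coe_toNNReal K hK0]
  rcases le_total V W with h | h
  · exact hfull V W hV h
  · rw [abs_sub_comm, abs_sub_comm V W]
    exact hfull W V hW h

theorem ae_differentiableAt_rearr (hF : IsProfile μ F B) :
    ∀ᵐ V ∂volume.restrict (Ioi (0 : ℝ)), DifferentiableAt ℝ (rearr μ F) V := by
  have hanti : Antitone fun V => rearr μ F (max V 0) := fun V W h =>
    hF.rearr_antitoneOn (mem_Ici.2 (le_max_right _ _)) (mem_Ici.2 (le_max_right _ _)) (max_le_max_right 0 h)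
  have hmono : Monotone fun V => -rearr μ F (max V 0) := hanti.neg
  filter_upwards [ae_restrict_of_ae hmono.ae_differentiableAt, ae_restrict_mem measurableSet_Ioi] with V hV hV0
  have h1 : DifferentiableAt ℝ (fun V => rearr μ F (max V 0)) V := by simpa using hV.neg
  refine h1.congr_of_eventuallyEq ?_
  filter_upwards [Ioi_mem_nhds hV0] with W hW
  rw [max_eq_left (le_of_lt hW)]

theorem rpow_difference_quotient_le (hF : IsProfile μ F B) (hcap : CapacityBound μ F D A C)
    (hDm : Measurable D) {p : ℝ} (hp : 1 < p) {V h : ℝ} (hV : 0 < V) (hh : 0 < h) :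
    ENNReal.ofReal (((rearr μ F V - rearr μ F (V + h)) / h * max 0 (A V - C V * h)) ^ p) ≤
      (∫⁻ x in {x | rearr μ F (V + h) < F x ∧ F x < rearr μ F V}, D x ^ p ∂μ) * (ENNReal.ofReal h)⁻¹ := by
  have hp0 : 0 < p := by linarith
  rcases le_or_gt (rearr μ F V) (rearr μ F (V + h)) with hle | hlt
  · have := hF.rearr_antitoneOn (mem_Ici.2 hV.le) (mem_Ici.2 (by positivity)) (by linarith : V ≤ V + h)
    rw [le_antisymm hle this, sub_self, zero_div, zero_mul, Real.zero_rpow hp0.ne']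
    simp
  set E := {x | rearr μ F (V + h) < F x ∧ F x < rearr μ F V} with hE
  have h1 := hF.ofReal_sub_mul_le hcap hV hh hlt
  have hpq : p.HolderConjugate (p / (p - 1)) := Real.HolderConjugate.conjExponent hp
  have h2 := ENNReal.lintegral_mul_le_Lp_mul_Lq (μ.restrict E) hpq hDm.aemeasurable
    (aemeasurable_const (b := (1 : ENNReal)))
  simp only [Pi.mul_apply, mul_one, ENNReal.one_rpow, lintegral_const, one_mul,
    Measure.restrict_apply_univ] at h2
  have h3 : (∫⁻ x in E, D x ∂μ) ^ p ≤ (∫⁻ x in E, D x ^ p ∂μ) * ENNReal.ofReal h ^ (p - 1) := by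
    calc (∫⁻ x in E, D x ∂μ) ^ p ≤ ((∫⁻ x in E, D x ^ p ∂μ) ^ (1 / p) * μ E ^ (1 / (p / (p - 1)))) ^ p :=
          ENNReal.rpow_le_rpow h2 hp0.le
      _ = (∫⁻ x in E, D x ^ p ∂μ) * μ E ^ (p - 1) := by
          rw [ENNReal.mul_rpow_of_nonneg _ _ hp0.le, ← ENNReal.rpow_mul, ← ENNReal.rpow_mul,
            one_div_mul_cancel hp0.ne', ENNReal.rpow_one]
          congr 2
          field_simp
      _ ≤ _ := mul_le_mul' le_rfl
          (ENNReal.rpow_le_rpow (hF.measure_between_le hV hh.le hlt) (by linarith))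
  have h4 : ENNReal.ofReal (((rearr μ F V - rearr μ F (V + h)) / h * max 0 (A V - C V * h)) ^ p) =
      ENNReal.ofReal ((rearr μ F V - rearr μ F (V + h)) * (A V - C V * h)) ^ p *
        (ENNReal.ofReal h ^ p)⁻¹ := by
    have e0 : 0 ≤ rearr μ F V - rearr μ F (V + h) := sub_nonneg.2 hlt.le
    have e : (rearr μ F V - rearr μ F (V + h)) / h * max 0 (A V - C V * h) =
        max 0 ((rearr μ F V - rearr μ F (V + h)) * (A V - C V * h)) / h := by
      rw [div_mul_eq_mul_div, mul_max_of_nonneg _ _ e0, mul_zero]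
    rw [e, ← ENNReal.ofReal_rpow_of_nonneg (by positivity) hp0.le, ENNReal.ofReal_div_of_pos hh,
      ENNReal.div_rpow_of_nonneg _ _ hp0.le, ENNReal.div_eq_inv_mul, mul_comm]
    congr 2
    rw [max_comm, ENNReal.ofReal_max]
    simp
  rw [h4]
  have hh' : ENNReal.ofReal h ≠ 0 := (ENNReal.ofReal_pos.2 hh).ne'
  calc _ ≤ (∫⁻ x in E, D x ∂μ) ^ p * (ENNReal.ofReal h ^ p)⁻¹ := by
        gcongr
    _ ≤ (∫⁻ x in E, D x ^ p ∂μ) * ENNReal.ofReal h ^ (p - 1) * (ENNReal.ofReal h ^ p)⁻¹ := by gcongr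
    _ = _ := by
        rw [mul_assoc, ← ENNReal.rpow_neg, ← ENNReal.rpow_add _ _ hh' ENNReal.ofReal_ne_top,
          ← ENNReal.rpow_neg_one]
        congr 2
        ring

theorem lintegral_rearr_deriv_le [SFinite μ] (hF : IsProfile μ F B) (hcap : CapacityBound μ F D A C)
    (hDm : Measurable D) (hA : Measurable A) (hC : Measurable C) {p : ℝ} (hp : 1 < p) :
    ∫⁻ V in Ioi 0, ENNReal.ofReal ((A V * |deriv (rearr μ F) V|) ^ p) ≤ ∫⁻ x, D x ^ p ∂μ := by
  have hp0 : 0 < p := by linarith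
  set vv : ℝ → ℝ := fun V => rearr μ F (max V 0) with hvv
  have hvm : Measurable vv := hF.measurable_rearr_restrict
  have hvp : ∀ V, 0 < V → vv V = rearr μ F V := fun V hV => by rw [hvv]; simp only; rw [max_eq_left hV.le]
  set δ : ℕ → ℝ := fun k => 1 / ((k : ℝ) + 1) with hδ
  have hδ0 : ∀ k, 0 < δ k := fun k => by rw [hδ]; positivity
  set f : ℕ → ℝ → ENNReal := fun k V =>
    ENNReal.ofReal (((vv V - vv (V + δ k)) / δ k * max 0 (A V - C V * δ k)) ^ p) with hf
  have hfm : ∀ k, Measurable (f k) := fun k => by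
    have : Measurable fun V => vv (V + δ k) := hvm.comp (measurable_id.add_const _)
    exact ((((hvm.sub this).div_const _).mul (measurable_const.max (hA.sub (hC.mul_const _)))).pow_const p).ennreal_ofReal
  have hbound : ∀ k, ∫⁻ V in Ioi 0, f k V ≤ ∫⁻ x, D x ^ p ∂μ := by
    intro k
    have hS : MeasurableSet {z : ℝ × X | vv (z.1 + δ k) < F z.2 ∧ F z.2 < vv z.1} := by
      have h1 : Measurable fun z : ℝ × X => vv (z.1 + δ k) := hvm.comp (measurable_fst.add_const _)
      have h2 : Measurable fun z : ℝ × X => vv z.1 := hvm.comp measurable_fst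
      have h3 : Measurable fun z : ℝ × X => F z.2 := hF.meas.comp measurable_snd
      exact (measurableSet_lt h1 h3).inter (measurableSet_lt h3 h2)
    set S := {z : ℝ × X | vv (z.1 + δ k) < F z.2 ∧ F z.2 < vv z.1} with hSd
    set g : ℝ → X → ENNReal := fun V x => S.indicator (fun z => D z.2 ^ p * (ENNReal.ofReal (δ k))⁻¹) (V, x) with hg
    have hgm : Measurable (Function.uncurry g) :=
      (((hDm.comp measurable_snd).pow_const p).mul_const _).indicator hS
    calc ∫⁻ V in Ioi 0, f k V ≤ ∫⁻ V in Ioi 0, ∫⁻ x, g V x ∂μ := by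
          refine setLIntegral_mono' measurableSet_Ioi fun V hV => ?_
          have h := hF.rpow_difference_quotient_le hcap hDm hp hV (hδ0 k)
          have e : ∫⁻ x, g V x ∂μ = (∫⁻ x in {x | rearr μ F (V + δ k) < F x ∧ F x < rearr μ F V}, D x ^ p ∂μ) *
              (ENNReal.ofReal (δ k))⁻¹ := by
            rw [← lintegral_mul_const _ (hDm.pow_const p), ← lintegral_indicator]
            · refine lintegral_congr fun x => ?_
              simp only [hg, hSd, indicator, mem_ofPred_eq]
              rw [hvp V hV, hvp (V + δ k) (add_pos hV (hδ0 k))]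
            · exact (measurableSet_lt measurable_const hF.meas).inter (measurableSet_lt hF.meas measurable_const)
          rw [e]
          simp only [hf]
          rw [hvp V hV, hvp (V + δ k) (add_pos hV (hδ0 k))]
          exact h
      _ = ∫⁻ x, (∫⁻ V in Ioi 0, g V x) ∂μ := lintegral_lintegral_swap hgm.aemeasurable
      _ ≤ ∫⁻ x, D x ^ p ∂μ := by
          refine lintegral_mono fun x => ?_
          have hT : MeasurableSet {V | vv (V + δ k) < F x ∧ F x < vv V} :=
            (measurableSet_lt (hvm.comp (measurable_id.add_const _)) measurable_const).inter
              (measurableSet_lt measurable_const hvm)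
          have e : ∀ V, g V x = {V | vv (V + δ k) < F x ∧ F x < vv V}.indicator
              (fun _ => D x ^ p * (ENNReal.ofReal (δ k))⁻¹) V := fun V => by
            simp only [hg, hSd, indicator, mem_ofPred_eq]
          simp_rw [e]
          rw [lintegral_indicator_const hT, Measure.restrict_apply hT]
          have hv := hF.volume_between_le (hF.nonneg x) (hδ0 k).le
          have hsub : {V | vv (V + δ k) < F x ∧ F x < vv V} ∩ Ioi 0 ⊆
              {V | 0 < V ∧ rearr μ F (V + δ k) < F x ∧ F x < rearr μ F V} := by
            rintro V ⟨h1, h2⟩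
            rw [mem_ofPred_eq, hvp V h2, hvp (V + δ k) (add_pos h2 (hδ0 k))] at h1
            exact ⟨h2, h1⟩
          calc _ ≤ D x ^ p * (ENNReal.ofReal (δ k))⁻¹ * ENNReal.ofReal (δ k) := by
                gcongr
                exact (measure_mono hsub).trans hv
            _ = _ := by
                rw [mul_assoc, ENNReal.inv_mul_cancel (ENNReal.ofReal_pos.2 (hδ0 k)).ne' ENNReal.ofReal_ne_top,
                  mul_one]
  have hδt : Tendsto δ atTop (𝓝 0) := tendsto_one_div_add_atTop_nhds_zero_nat
  have hlim : ∀ᵐ V ∂volume.restrict (Ioi (0 : ℝ)),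
      ENNReal.ofReal ((A V * |deriv (rearr μ F) V|) ^ p) = liminf (fun k => f k V) atTop := by
    filter_upwards [hF.ae_differentiableAt_rearr, ae_restrict_mem measurableSet_Ioi] with V hV hV0
    refine (Tendsto.liminf_eq ?_).symm
    have hd := hV.hasDerivAt
    set v' := deriv (rearr μ F) V
    have hδt' : Tendsto δ atTop (𝓝[≠] 0) :=
      tendsto_nhdsWithin_iff.2 ⟨hδt, Eventually.of_forall fun k => (hδ0 k).ne'⟩
    have h1 : Tendsto (fun k => (vv V - vv (V + δ k)) / δ k) atTop (𝓝 (-v')) := by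
      have h := ((hasDerivAt_iff_tendsto_slope_zero.1 hd).comp hδt').neg
      refine h.congr fun k => ?_
      rw [hvp V hV0, hvp (V + δ k) (add_pos hV0 (hδ0 k)), Function.comp, smul_eq_mul]
      ring
    have hv' : 0 ≤ -v' := by
      refine ge_of_tendsto' h1 fun k => div_nonneg (sub_nonneg.2 ?_) (hδ0 k).le
      rw [hvp V hV0, hvp (V + δ k) (add_pos hV0 (hδ0 k))]
      exact hF.rearr_antitoneOn (mem_Ici.2 (le_of_lt hV0)) (mem_Ici.2 (add_pos hV0 (hδ0 k)).le)
        (by linarith [hδ0 k])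
    have h2 : Tendsto (fun k => max 0 (A V - C V * δ k)) atTop (𝓝 (A V)) := by
      have h := (tendsto_const_nhds (x := (0 : ℝ))).max ((hδt.const_mul (C V)).const_sub (A V))
      rwa [mul_zero, sub_zero, max_eq_right (hcap.pos V hV0).le] at h
    have h3 := (h1.mul h2).rpow_const (p := p) (Or.inr hp0.le)
    have e : A V * |v'| = -v' * A V := by rw [abs_of_nonpos (by linarith)]; ring
    rw [e]
    exact ENNReal.tendsto_ofReal h3
  calc _ = ∫⁻ V in Ioi 0, liminf (fun k => f k V) atTop := lintegral_congr_ae hlim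
    _ ≤ liminf (fun k => ∫⁻ V in Ioi 0, f k V) atTop := lintegral_liminf_le hfm
    _ ≤ _ := liminf_le_of_le (by isBoundedDefault) fun b hb => by
        obtain ⟨k, hk⟩ := hb.exists
        exact hk.trans (hbound k)

end IsProfile

/-- Bounded antitone functions on `[0, ∞)`, positive exactly on `[0, V₀)`, and locally Lipschitz
on `(0, ∞)`. -/
structure IsDecrProfile (v : ℝ → ℝ) (B V₀ : ℝ) : Prop where
  anti : AntitoneOn v (Ici 0)
  nonneg : ∀ V, 0 ≤ v V
  le : ∀ V, 0 ≤ V → v V ≤ B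
  zero : ∀ V, 0 ≤ V → V₀ ≤ V → v V = 0
  pos : ∀ V, 0 ≤ V → V < V₀ → 0 < v V
  lip : ∀ a, 0 < a → ∃ K, LipschitzOnWith K v (Ici a)
  diff : ∀ᵐ V ∂volume.restrict (Ioi (0 : ℝ)), DifferentiableAt ℝ v V

namespace IsDecrProfile

variable {v : ℝ → ℝ} {B V₀ : ℝ}

theorem continuousOn (hv : IsDecrProfile v B V₀) : ContinuousOn v (Ioi 0) := fun V hV => by
  have hV0 : (0 : ℝ) < V := hV
  obtain ⟨K, hK⟩ := hv.lip (V / 2) (by positivity)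
  exact (hK.continuousOn.continuousAt (Ici_mem_nhds (by linarith))).continuousWithinAt

theorem deriv_nonpos (hv : IsDecrProfile v B V₀) {V : ℝ} (hV : 0 < V) : deriv v V ≤ 0 := by
  by_cases hd : DifferentiableAt ℝ v V
  · have h := hasDerivAt_iff_tendsto_slope_zero.1 hd.hasDerivAt
    have hsub : Ioi (0 : ℝ) ⊆ {0}ᶜ := fun x hx => (ne_of_gt hx : x ≠ 0)
    have h2 := h.mono_left (nhdsWithin_mono 0 hsub)
    refine le_of_tendsto h2 ?_
    filter_upwards [self_mem_nhdsWithin] with t ht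
    have ht0 : (0 : ℝ) < t := ht
    have := hv.anti (mem_Ici.2 hV.le) (mem_Ici.2 (by positivity)) (by linarith : V ≤ V + t)
    rw [smul_eq_mul]
    exact mul_nonpos_of_nonneg_of_nonpos (by positivity) (by linarith)
  · rw [deriv_zero_of_not_differentiableAt hd]

theorem lipschitzOnWith_rpow {s : ℝ} (hs : 1 ≤ s) (B : ℝ) :
    ∃ K, LipschitzOnWith K (fun x : ℝ => x ^ s) (Icc 0 B) := by
  refine ⟨(s * |B| ^ (s - 1)).toNNReal, Convex.lipschitzOnWith_of_nnnorm_hasDerivWithin_le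
    (f' := fun x => s * x ^ (s - 1)) (convex_Icc 0 B)
    (fun x _ => (Real.hasDerivAt_rpow_const (Or.inr hs)).hasDerivWithinAt) fun x hx => ?_⟩
  have hx0 := hx.1
  rw [← NNReal.coe_le_coe, coe_nnnorm, Real.coe_toNNReal _ (by positivity), Real.norm_of_nonneg (by positivity)]
  exact mul_le_mul_of_nonneg_left (Real.rpow_le_rpow hx0 (hx.2.trans (le_abs_self B)) (by linarith)) (by linarith)

theorem rpow_le_lintegral (hv : IsDecrProfile v B V₀) {s : ℝ} (hs : 1 ≤ s) {V : ℝ} (hV : 0 < V)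
    (hV₀ : V < V₀) :
    ENNReal.ofReal (v V ^ s) ≤
      ∫⁻ y in Ioo V V₀, ENNReal.ofReal (s * v y ^ (s - 1) * |deriv v y|) := by
  obtain ⟨K, hK⟩ := hv.lip V hV
  obtain ⟨K', hK'⟩ := lipschitzOnWith_rpow hs B
  have hmaps : MapsTo v (Ici V) (Icc 0 B) := fun y hy => ⟨hv.nonneg y, hv.le y (hV.le.trans hy)⟩
  have hlip : LipschitzOnWith (K' * K) (fun y => v y ^ s) (uIcc V V₀) := by
    rw [uIcc_of_le hV₀.le]
    exact (hK'.comp hK hmaps).mono Icc_subset_Ici_self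
  have hac := hlip.absolutelyContinuousOnInterval
  have hftc := hac.integral_deriv_eq_sub
  rw [hv.zero V₀ (hV.le.trans hV₀.le) le_rfl, Real.zero_rpow (by linarith), zero_sub,
    intervalIntegral.integral_of_le hV₀.le, ← neg_eq_iff_eq_neg, ← integral_neg,
    integral_Ioc_eq_integral_Ioo] at hftc
  rw [← hftc]
  have hcongr : ∀ᵐ y ∂volume.restrict (Ioo V V₀),
      -deriv (fun y => v y ^ s) y = s * v y ^ (s - 1) * |deriv v y| := by
    have hd := ae_restrict_of_ae_restrict_of_subset
      (fun y hy => hV.trans hy.1 : Ioo V V₀ ⊆ Ioi 0) hv.diff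
    filter_upwards [hd, ae_restrict_mem measurableSet_Ioo] with y hy hyV
    have h := hy.hasDerivAt.rpow_const (p := s) (Or.inr hs)
    rw [h.deriv, abs_of_nonpos (hv.deriv_nonpos (hV.trans hyV.1))]
    ring
  rw [integral_congr_ae hcongr]
  have hnn : 0 ≤ᵐ[volume.restrict (Ioo V V₀)] fun y => s * v y ^ (s - 1) * |deriv v y| :=
    ae_of_all _ fun y => by
      have := hv.nonneg y
      positivity
  have hInt : IntegrableOn (fun y => s * v y ^ (s - 1) * |deriv v y|) (Ioo V V₀) := by
    have h1 := hac.intervalIntegrable_deriv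
    rw [intervalIntegrable_iff_integrableOn_Ioo_of_le hV₀.le] at h1
    exact h1.neg.congr hcongr
  rw [ofReal_integral_eq_lintegral_ofReal hInt hnn]

theorem hardy_type (hv : IsDecrProfile v B V₀) {s p q : ℝ} (hs : 1 ≤ s) (hpq : p.HolderConjugate q)
    {H' H G : ℝ → ENNReal} {a : ℝ → ℝ} (hH'm : AEMeasurable H' (volume.restrict (Ioo 0 V₀)))
    (hGm : AEMeasurable G (volume.restrict (Ioo 0 V₀))) (ha : Measurable a) (ha0 : ∀ y ∈ Ioo 0 V₀, 0 ≤ a y)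
    (hH : ∀ y ∈ Ioo 0 V₀, ∫⁻ V in Ioo 0 y, H' V ≤ H y)
    (hG : ∀ y ∈ Ioo 0 V₀, ENNReal.ofReal (v y ^ (s - 1)) * H y ≤ ENNReal.ofReal (a y) * G y ^ (1 / q)) :
    ∫⁻ V in Ioo 0 V₀, H' V * ENNReal.ofReal (v V ^ s) ≤
      ENNReal.ofReal s * ((∫⁻ y in Ioo 0 V₀, ENNReal.ofReal ((a y * |deriv v y|) ^ p)) ^ (1 / p) *
        (∫⁻ y in Ioo 0 V₀, G y) ^ (1 / q)) := by
  have hp0 := hpq.pos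
  have hq0 := hpq.symm.pos
  have hvm : AEMeasurable v (volume.restrict (Ioo 0 V₀)) :=
    (hv.continuousOn.mono Ioo_subset_Ioi_self).aemeasurable measurableSet_Ioo
  set g : ℝ → ENNReal := fun y => ENNReal.ofReal (s * v y ^ (s - 1) * |deriv v y|) with hg
  have hgm : AEMeasurable g (volume.restrict (Ioo 0 V₀)) :=
    (((hvm.pow_const (s - 1)).const_mul s).mul (measurable_deriv v).aemeasurable.abs).ennreal_ofReal
  have hT : MeasurableSet {z : ℝ × ℝ | z.1 < z.2} := measurableSet_lt measurable_fst measurable_snd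
  set Φ : ℝ → ℝ → ENNReal := fun V y => {z : ℝ × ℝ | z.1 < z.2}.indicator (fun z => H' z.1 * g z.2) (V, y) with hΦ
  have hΦm : AEMeasurable (Function.uncurry Φ)
      ((volume.restrict (Ioo 0 V₀)).prod (volume.restrict (Ioo 0 V₀))) :=
    AEMeasurable.indicator (hH'm.comp_fst.mul hgm.comp_snd) hT
  calc ∫⁻ V in Ioo 0 V₀, H' V * ENNReal.ofReal (v V ^ s)
      ≤ ∫⁻ V in Ioo 0 V₀, ∫⁻ y in Ioo 0 V₀, Φ V y := by
        refine setLIntegral_mono' measurableSet_Ioo fun V hV => ?_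
        have h1 := hv.rpow_le_lintegral hs hV.1 hV.2
        have hsub : Ioo V V₀ ⊆ Ioo 0 V₀ := Ioo_subset_Ioo_left hV.1.le
        calc _ ≤ H' V * ∫⁻ y in Ioo V V₀, g y := mul_le_mul' le_rfl h1
          _ = ∫⁻ y in Ioo V V₀, H' V * g y := (lintegral_const_mul'' _ (hgm.mono_measure (Measure.restrict_mono hsub le_rfl))).symm
          _ = ∫⁻ y in Ioo V V₀, Φ V y := by
            refine setLIntegral_congr_fun measurableSet_Ioo fun y hy => ?_
            simp only [hΦ]
            rw [indicator_of_mem (show (V, y) ∈ {z : ℝ × ℝ | z.1 < z.2} from hy.1)]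
          _ ≤ _ := lintegral_mono_set hsub
    _ = ∫⁻ y in Ioo 0 V₀, ∫⁻ V in Ioo 0 V₀, Φ V y := lintegral_lintegral_swap hΦm
    _ ≤ ∫⁻ y in Ioo 0 V₀, ENNReal.ofReal s * (ENNReal.ofReal (a y * |deriv v y|) * G y ^ (1 / q)) := by
        refine setLIntegral_mono' measurableSet_Ioo fun y hy => ?_
        have hsub : Ioo 0 y ⊆ Ioo 0 V₀ := Ioo_subset_Ioo_right hy.2.le
        have h1 : ∫⁻ V in Ioo 0 V₀, Φ V y ≤ (∫⁻ V in Ioo 0 y, H' V) * g y := by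
          have e : ∀ V, Φ V y = (Iio y).indicator (fun V => H' V * g y) V := fun V => rfl
          simp_rw [e]
          rw [lintegral_indicator measurableSet_Iio, Measure.restrict_restrict measurableSet_Iio]
          have e2 : Iio y ∩ Ioo 0 V₀ = Ioo 0 y := by
            ext V; constructor
            · rintro ⟨h1, h2⟩; exact ⟨h2.1, h1⟩
            · rintro h; exact ⟨h.2, hsub h⟩
          rw [e2, lintegral_mul_const'' _ (hH'm.mono_measure (Measure.restrict_mono hsub le_rfl))]
        refine h1.trans ?_
        have hvy : 0 ≤ v y ^ (s - 1) := Real.rpow_nonneg (hv.nonneg y) _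
        calc _ ≤ H y * g y := mul_le_mul' (hH y hy) le_rfl
          _ = ENNReal.ofReal s * (ENNReal.ofReal (v y ^ (s - 1)) * H y) * ENNReal.ofReal |deriv v y| := by
              rw [hg]; simp only
              rw [ENNReal.ofReal_mul (by positivity), ENNReal.ofReal_mul (by linarith)]
              ring
          _ ≤ ENNReal.ofReal s * (ENNReal.ofReal (a y) * G y ^ (1 / q)) * ENNReal.ofReal |deriv v y| :=
              mul_le_mul' (mul_le_mul' le_rfl (hG y hy)) le_rfl
          _ = _ := by rw [ENNReal.ofReal_mul (ha0 y hy)]; ring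
    _ ≤ _ := by
        have hfm : AEMeasurable (fun y => ENNReal.ofReal (a y * |deriv v y|)) (volume.restrict (Ioo 0 V₀)) :=
          (ha.mul (measurable_deriv v).abs).ennreal_ofReal.aemeasurable
        rw [lintegral_const_mul' _ _ ENNReal.ofReal_ne_top]
        refine mul_le_mul' le_rfl ?_
        refine (ENNReal.lintegral_mul_le_Lp_mul_Lq _ hpq hfm (hGm.pow_const (1 / q))).trans (le_of_eq ?_)
        congr 2
        · refine setLIntegral_congr_fun measurableSet_Ioo fun y hy => ?_
          exact ENNReal.ofReal_rpow_of_nonneg (mul_nonneg (ha0 y hy) (abs_nonneg _)) hp0.le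
        · refine lintegral_congr fun y => ?_
          rw [← ENNReal.rpow_mul, one_div_mul_cancel hq0.ne', ENNReal.rpow_one]

theorem lintegral_rpow_ne_top (hv : IsDecrProfile v B V₀) {s : ℝ} (hs : 0 ≤ s) :
    ∫⁻ V in Ioo 0 V₀, ENNReal.ofReal (v V ^ s) ≠ ⊤ := by
  refine ((setLIntegral_mono' (g := fun _ => ENNReal.ofReal (B ^ s)) measurableSet_Ioo fun V hV => ?_).trans_lt ?_).ne
  · exact ENNReal.ofReal_le_ofReal (Real.rpow_le_rpow (hv.nonneg V) (hv.le V hV.1.le) hs)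
  · rw [setLIntegral_const, Real.volume_Ioo]
    exact ENNReal.mul_lt_top ENNReal.ofReal_lt_top ENNReal.ofReal_lt_top

theorem hardy (hv : IsDecrProfile v B V₀) {p : ℝ} (hp : 1 < p) :
    ∫⁻ V in Ioo 0 V₀, ENNReal.ofReal (v V ^ p) ≤
      ENNReal.ofReal p ^ p * ∫⁻ V in Ioo 0 V₀, ENNReal.ofReal ((V * |deriv v V|) ^ p) := by
  have hpq : p.HolderConjugate (p / (p - 1)) := Real.HolderConjugate.conjExponent hp
  have hp0 := hpq.pos
  have hvm : AEMeasurable v (volume.restrict (Ioo 0 V₀)) :=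
    (hv.continuousOn.mono Ioo_subset_Ioi_self).aemeasurable measurableSet_Ioo
  have h := hv.hardy_type hp.le hpq (H' := fun _ => 1) (H := fun y => ENNReal.ofReal y)
    (G := fun y => ENNReal.ofReal (v y ^ p)) (a := fun y => y) aemeasurable_const
    (hvm.pow_const p).ennreal_ofReal measurable_id (fun y hy => hy.1.le) (fun y hy => by simp)
    (fun y hy => by
      rw [mul_comm, ENNReal.ofReal_rpow_of_nonneg (Real.rpow_nonneg (hv.nonneg y) _) (one_div_nonneg.2 hpq.symm.pos.le),
        ← Real.rpow_mul (hv.nonneg y)]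
      refine le_of_eq ?_
      congr 3
      have : p - 1 ≠ 0 := by linarith
      field_simp)
  simp only [one_mul] at h
  set N := ∫⁻ V in Ioo 0 V₀, ENNReal.ofReal (v V ^ p)
  set K := ∫⁻ V in Ioo 0 V₀, ENNReal.ofReal ((V * |deriv v V|) ^ p)
  have hN : N ≠ ⊤ := hv.lintegral_rpow_ne_top hp0.le
  rcases eq_or_ne N 0 with h0 | h0
  · rw [h0]; exact zero_le
  have hNN : N = N ^ (1 / p) * N ^ (1 / (p / (p - 1))) := by
    rw [← ENNReal.rpow_add _ _ h0 hN, one_div, one_div, hpq.inv_add_inv_eq_one, ENNReal.rpow_one]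
  have h1 : N ^ (1 / p) ≤ ENNReal.ofReal p * K ^ (1 / p) := by
    have hq0 : N ^ (1 / (p / (p - 1))) ≠ 0 := by
      simp [ENNReal.rpow_eq_zero_iff, h0, hN]
    have hqt : N ^ (1 / (p / (p - 1))) ≠ ⊤ := ENNReal.rpow_ne_top_of_nonneg (one_div_nonneg.2 hpq.symm.pos.le) hN
    refine (ENNReal.mul_le_mul_iff_left hq0 hqt).1 ?_
    rw [← hNN]
    refine h.trans (le_of_eq ?_)
    ring
  have h2 := ENNReal.rpow_le_rpow h1 hp0.le
  rwa [ENNReal.mul_rpow_of_nonneg _ _ hp0.le, ← ENNReal.rpow_mul, ← ENNReal.rpow_mul,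
    one_div_mul_cancel hp0.ne', ENNReal.rpow_one, ENNReal.rpow_one] at h2

end IsDecrProfile

theorem lintegral_rpow_mul_exp {c b β : ℝ} (hβ : 0 < β) (hc : -1 < c) (hb : 0 < b) :
    ∫⁻ x in Ioi (0 : ℝ), ENNReal.ofReal (x ^ c * exp (-b * x ^ β)) =
      ENNReal.ofReal (b ^ (-(c + 1) / β) * (1 / β) * Real.Gamma ((c + 1) / β)) := by
  have hG : 0 < b ^ (-(c + 1) / β) * (1 / β) * Real.Gamma ((c + 1) / β) := by
    have : 0 < (c + 1) / β := div_pos (by linarith) hβ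
    have := Real.Gamma_pos_of_pos this
    positivity
  have h := integral_rpow_mul_exp_neg_mul_rpow hβ hc hb
  rw [← h, ofReal_integral_eq_lintegral_ofReal]
  · by_contra hni
    rw [integral_undef hni] at h
    exact hG.ne h
  · filter_upwards [ae_restrict_mem measurableSet_Ioi] with x hx
    have : (0 : ℝ) < x := hx
    positivity

/-- Integrals of the Barenblatt type profile. -/
theorem lintegral_rpow_mul_one_add_rpow {c β ν : ℝ} (hβ : 0 < β) (hc : -1 < c) (hν : (c + 1) / β < ν) :
    ∫⁻ x in Ioi (0 : ℝ), ENNReal.ofReal (x ^ c * (1 + x ^ β) ^ (-ν)) =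
      ENNReal.ofReal ((1 / β) * Real.Gamma ((c + 1) / β) * Real.Gamma (ν - (c + 1) / β) / Real.Gamma ν) := by
  set t := (c + 1) / β with ht
  have ht0 : 0 < t := div_pos (by linarith) hβ
  have hν0 : 0 < ν := ht0.trans hν
  have hΓν := Real.Gamma_pos_of_pos hν0
  have hΓt := Real.Gamma_pos_of_pos ht0
  have hΓd := Real.Gamma_pos_of_pos (sub_pos.2 hν)
  have key : ∫⁻ x in Ioi (0 : ℝ), ENNReal.ofReal (x ^ c * (1 + x ^ β) ^ (-ν)) * ENNReal.ofReal (Real.Gamma ν) =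
      ENNReal.ofReal ((1 / β) * Real.Gamma t * Real.Gamma (ν - t)) := by
    calc _ = ∫⁻ x in Ioi (0 : ℝ), ∫⁻ y in Ioi (0 : ℝ),
          ENNReal.ofReal (x ^ c * (y ^ (ν - 1) * exp (-(1 + x ^ β) * y ^ (1 : ℝ)))) := by
          refine setLIntegral_congr_fun measurableSet_Ioi fun x hx => ?_
          have hx0 : (0 : ℝ) < x := hx
          have h1 := lintegral_rpow_mul_exp (c := ν - 1) (b := 1 + x ^ β) one_pos (by linarith) (by positivity)
          simp only [ENNReal.ofReal_mul (Real.rpow_nonneg hx0.le c)]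
          rw [lintegral_const_mul' _ _ ENNReal.ofReal_ne_top, h1, mul_assoc, ← ENNReal.ofReal_mul (by positivity)]
          congr 3
          · simp
          · rw [sub_add_cancel, div_one]
      _ = ∫⁻ y in Ioi (0 : ℝ), ∫⁻ x in Ioi (0 : ℝ),
          ENNReal.ofReal (x ^ c * (y ^ (ν - 1) * exp (-(1 + x ^ β) * y ^ (1 : ℝ)))) := by
          refine lintegral_lintegral_swap (Measurable.aemeasurable ?_)
          simp only [Function.uncurry_def]
          fun_prop
      _ = ∫⁻ y in Ioi (0 : ℝ), ENNReal.ofReal ((1 / β) * Real.Gamma t) *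
          ENNReal.ofReal (y ^ (ν - t - 1) * exp (-1 * y ^ (1 : ℝ))) := by
          refine setLIntegral_congr_fun measurableSet_Ioi fun y hy => ?_
          have hy0 : (0 : ℝ) < y := hy
          have h1 := lintegral_rpow_mul_exp (c := c) (b := y) hβ hc hy0
          have e : ∀ x : ℝ, x ^ c * (y ^ (ν - 1) * exp (-(1 + x ^ β) * y ^ (1 : ℝ))) =
              (y ^ (ν - 1) * exp (-y)) * (x ^ c * exp (-y * x ^ β)) := fun x => by
            rw [Real.rpow_one, show -(1 + x ^ β) * y = -y + -y * x ^ β by ring, Real.exp_add]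
            ring
          simp only [e]
          simp only [ENNReal.ofReal_mul (show 0 ≤ y ^ (ν - 1) * exp (-y) by positivity)]
          rw [lintegral_const_mul' _ _ ENNReal.ofReal_ne_top, h1, ← ENNReal.ofReal_mul (by positivity),
            ← ENNReal.ofReal_mul (by positivity)]
          congr 1
          rw [show ν - t - 1 = (ν - 1) + (-(c + 1) / β) by rw [ht]; ring, Real.rpow_add hy0, Real.rpow_one,
            neg_one_mul]
          ring
      _ = _ := by
          have h1 := lintegral_rpow_mul_exp (c := ν - t - 1) (b := 1) one_pos (by linarith) one_pos
          rw [lintegral_const_mul' _ _ ENNReal.ofReal_ne_top, h1, ← ENNReal.ofReal_mul (by positivity)]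
          congr 2
          simp
  rw [lintegral_mul_const' _ _ ENNReal.ofReal_ne_top] at key
  rw [ENNReal.ofReal_div_of_pos hΓν, ← key, ENNReal.mul_div_cancel_right (ENNReal.ofReal_pos.2 hΓν).ne' ENNReal.ofReal_ne_top]

theorem exists_strictMono_inverse {g : ℝ → ℝ} (hg : Continuous g) (hgpos : ∀ x, 0 < g x)
    (hgi : IntegrableOn g (Ioi 0)) :
    ∃ J : ℝ → ℝ, ∀ y ∈ Ioo 0 (∫ x in Ioi 0, g x), 0 < J y ∧ (∫ x in (0 : ℝ)..J y, g x) = y ∧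
      HasDerivAt J (g (J y))⁻¹ y := by
  set I : ℝ → ℝ := fun w => ∫ x in (0 : ℝ)..w, g x with hI
  set k := ∫ x in Ioi 0, g x with hk
  have hId : ∀ w, HasDerivAt I (g w) w := fun w => hg.integral_hasStrictDerivAt 0 w |>.hasDerivAt
  have hIc : Continuous I := continuous_iff_continuousAt.2 fun w => (hId w).continuousAt
  have hIm : StrictMono I := strictMono_of_deriv_pos fun w => by rw [(hId w).deriv]; exact hgpos w
  have hI0 : I 0 = 0 := intervalIntegral.integral_same
  have hIt : Tendsto I atTop (𝓝 k) := intervalIntegral_tendsto_integral_Ioi 0 hgi tendsto_id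
  have hIk : ∀ w, I w < k := fun w =>
    (hIm (lt_add_one w)).trans_le (hIm.monotone.ge_of_tendsto hIt (w + 1))
  have hex : ∀ y, y ∈ Ioo 0 k → ∃ w, 0 < w ∧ I w = y := by
    intro y hy
    obtain ⟨b, hb⟩ := (hIt.eventually (lt_mem_nhds hy.2)).exists
    have hb0 : 0 < b := hIm.lt_iff_lt.1 (by rw [hI0]; exact hy.1.trans hb)
    obtain ⟨w, hw, hwy⟩ := intermediate_value_Icc hb0.le hIc.continuousOn
      (show y ∈ Icc (I 0) (I b) from ⟨by rw [hI0]; exact hy.1.le, hb.le⟩)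
    exact ⟨w, hIm.lt_iff_lt.1 (by rw [hI0, hwy]; exact hy.1), hwy⟩
  choose! J hJ0 hJI using hex
  refine ⟨J, fun y hy => ⟨hJ0 y hy, hJI y hy, ?_⟩⟩
  have hJm : StrictMonoOn J (Ioo 0 k) := fun a ha b hb hab => hIm.lt_iff_lt.1 (by rwa [hJI a ha, hJI b hb])
  have himg : Ioi 0 ⊆ J '' Ioo 0 k := fun w hw => by
    have hm : I w ∈ Ioo 0 k := ⟨by rw [← hI0]; exact hIm hw, hIk w⟩
    exact ⟨I w, hm, hIm.injective (hJI _ hm)⟩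
  have hJc : ContinuousAt J y := hJm.continuousAt_of_image_mem_nhds (Ioo_mem_nhds hy.1 hy.2)
    (mem_of_superset (Ioi_mem_nhds (hJ0 y hy)) himg)
  refine HasDerivAt.of_local_left_inverse hJc (hId (J y)) (hgpos _).ne' ?_
  filter_upwards [Ioo_mem_nhds hy.1 hy.2] with z hz
  exact hJI z hz

theorem exists_transport {f g : ℝ → ℝ} {V₀ : ℝ} (hV₀ : 0 < V₀) (hf : ContinuousOn f (Ioo 0 V₀))
    (hfpos : ∀ V ∈ Ioo 0 V₀, 0 < f V) (hfi : IntegrableOn f (Ioo 0 V₀)) (hg : Continuous g)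
    (hgpos : ∀ x, 0 < g x) (hgi : IntegrableOn g (Ioi 0)) :
    ∃ W : ℝ → ℝ, (∀ V ∈ Ioo 0 V₀, 0 < W V ∧
      HasDerivAt W ((∫ x in Ioi 0, g x) / (∫ x in Ioo 0 V₀, f x) * f V / g (W V)) V) ∧
      StrictMonoOn W (Ioo 0 V₀) ∧ W '' Ioo 0 V₀ = Ioi 0 := by
  set k := ∫ x in Ioi 0, g x with hk
  set N := ∫ x in Ioo 0 V₀, f x with hN
  have hk0 : 0 < k := by
    rw [hk, setIntegral_pos_iff_support_of_nonneg_ae (ae_of_all _ fun x => (hgpos x).le) hgi]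
    have : Function.support g = univ := by ext x; simp [(hgpos x).ne']
    simp [this]
  have hfiv : IntervalIntegrable f volume 0 V₀ := (intervalIntegrable_iff_integrableOn_Ioo_of_le hV₀.le).2 hfi
  have hN' : N = ∫ x in (0 : ℝ)..V₀, f x := by
    rw [intervalIntegral.integral_of_le hV₀.le, integral_Ioc_eq_integral_Ioo]
  have hN0 : 0 < N := by
    rw [hN']
    exact intervalIntegral.intervalIntegral_pos_of_pos_on hfiv hfpos hV₀
  set c := k / N with hc
  have hc0 : 0 < c := by positivity
  set P : ℝ → ℝ := fun V => c * ∫ x in (0 : ℝ)..V, f x with hP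
  have hPd : ∀ V ∈ Ioo 0 V₀, HasDerivAt P (c * f V) V := fun V hV => by
    have hi : IntervalIntegrable f volume 0 V := hfiv.mono_set (by
      rw [uIcc_of_le hV.1.le, uIcc_of_le hV₀.le]; exact Icc_subset_Icc_right hV.2.le)
    refine (intervalIntegral.integral_hasDerivAt_right hi ?_ ?_).const_mul c
    · exact hf.stronglyMeasurableAtFilter isOpen_Ioo V hV
    · exact hf.continuousAt (Ioo_mem_nhds hV.1 hV.2)
  have hPc : ContinuousOn P (Icc 0 V₀) := by
    have := intervalIntegral.continuousOn_primitive_interval' hfiv left_mem_uIcc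
    rw [uIcc_of_le hV₀.le] at this
    exact continuousOn_const.mul this
  have hPm : StrictMonoOn P (Icc 0 V₀) := strictMonoOn_of_deriv_pos (convex_Icc _ _) hPc fun V hV => by
    rw [interior_Icc] at hV
    rw [(hPd V hV).deriv]
    exact mul_pos hc0 (hfpos V hV)
  have hP0 : P 0 = 0 := by simp [hP]
  have hP1 : P V₀ = k := by
    simp only [hP]
    rw [← hN', hc, div_mul_cancel₀ _ hN0.ne']
  have hPmem : ∀ V ∈ Ioo 0 V₀, P V ∈ Ioo 0 k := fun V hV => by
    have hV' : V ∈ Icc 0 V₀ := ⟨hV.1.le, hV.2.le⟩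
    refine ⟨?_, ?_⟩
    · rw [← hP0]; exact hPm (left_mem_Icc.2 hV₀.le) hV' hV.1
    · rw [← hP1]; exact hPm hV' (right_mem_Icc.2 hV₀.le) hV.2
  obtain ⟨J, hJ⟩ := exists_strictMono_inverse hg hgpos hgi
  have hIm : StrictMono fun w => ∫ x in (0 : ℝ)..w, g x := strictMono_of_deriv_pos fun w => by
    rw [(hg.integral_hasStrictDerivAt 0 w).hasDerivAt.deriv]; exact hgpos w
  refine ⟨fun V => J (P V), fun V hV => ⟨(hJ _ (hPmem V hV)).1, ?_⟩, ?_, ?_⟩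
  · have h := HasDerivAt.comp (h₂ := J) (h := P) V (hJ _ (hPmem V hV)).2.2 (hPd V hV)
    have e : c * f V / g (J (P V)) = (g (J (P V)))⁻¹ * (c * f V) := by ring
    rw [e]
    exact h
  · intro a ha b hb hab
    refine hIm.lt_iff_lt.1 ?_
    simp only
    rw [(hJ _ (hPmem a ha)).2.1, (hJ _ (hPmem b hb)).2.1]
    exact hPm ⟨ha.1.le, ha.2.le⟩ ⟨hb.1.le, hb.2.le⟩ hab
  · refine Subset.antisymm ?_ ?_
    · rintro _ ⟨V, hV, rfl⟩
      exact (hJ _ (hPmem V hV)).1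
    · intro w hw
      have hw0 : (0 : ℝ) < w := hw
      have hIt : Tendsto (fun w => ∫ x in (0 : ℝ)..w, g x) atTop (𝓝 k) :=
        intervalIntegral_tendsto_integral_Ioi 0 hgi tendsto_id
      have hm : (∫ x in (0 : ℝ)..w, g x) ∈ Ioo 0 k := by
        refine ⟨?_, (hIm (lt_add_one w)).trans_le (hIm.monotone.ge_of_tendsto hIt (w + 1))⟩
        have := hIm hw0
        simpa using this
      obtain ⟨V, hV, hVw⟩ := intermediate_value_Ioo hV₀.le hPc (by rw [hP0, hP1]; exact hm)
      refine ⟨V, hV, hIm.injective ?_⟩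
      simp only
      rw [(hJ _ (hPmem V hV)).2.1, hVw]

/-- The mass of the Bliss profile. -/
noncomputable def blissMass (n p : ℝ) : ℝ :=
  Real.Gamma (n - n / p + 1) * Real.Gamma (n / p) / Real.Gamma n

/-- The sharp constant in the one-dimensional inequality of Bliss. -/
noncomputable def blissConst (n p : ℝ) : ℝ :=
  blissMass n p ^ (1 / n) * (n * (p - 1) / (n - p)) ^ (-(1 - 1 / p))

section BlissProfile

variable {n p : ℝ}

theorem blissMass_pos (hp : 1 < p) (hpn : p < n) : 0 < blissMass n p := by
  have h1 : n / p < n := div_lt_self (by linarith) hp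
  have h2 : 0 < n / p := div_pos (by linarith) (by linarith)
  have := Real.Gamma_pos_of_pos (show 0 < n - n / p + 1 by linarith)
  have := Real.Gamma_pos_of_pos h2
  have := Real.Gamma_pos_of_pos (show 0 < n by linarith)
  unfold blissMass
  positivity

theorem sobolevConst_eq {m : ℕ} (hp : 1 < p) (hpn : p < m) :
    sobolevConst m p = m * unitBallVol m ^ (1 / (m : ℝ)) * blissConst m p := by
  have hm0 : (0 : ℝ) < m := by linarith
  have hk := blissMass_pos hp hpn
  have hσ := unitBallVol_pos m
  have hr : 0 < (m : ℝ) * (p - 1) / (m - p) := div_pos (mul_pos hm0 (by linarith)) (by linarith)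
  have e : Real.Gamma (m : ℝ) / (Real.Gamma ((m : ℝ) / p) * Real.Gamma ((m : ℝ) + 1 - (m : ℝ) / p) * unitBallVol m) =
      (blissMass m p * unitBallVol m)⁻¹ := by
    unfold blissMass
    rw [show (m : ℝ) + 1 - m / p = m - m / p + 1 by ring]
    rw [div_mul_eq_mul_div, inv_div]
    congr 1
    ring
  unfold sobolevConst blissConst
  rw [e, Real.inv_rpow (by positivity), Real.mul_rpow hk.le hσ.le, Real.rpow_neg hr.le]
  have := (Real.rpow_pos_of_pos hr (1 - 1 / p)).ne'
  field_simp

theorem lintegral_blissProfile (hp : 1 < p) (hpn : p < n) :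
    ∫⁻ x in Ioi (0 : ℝ), ENNReal.ofReal ((1 + x ^ (p / (p - 1) / n)) ^ (-n)) =
      ENNReal.ofReal (blissMass n p) := by
  have hp0 : p - 1 ≠ 0 := by linarith
  have hn0 : n ≠ 0 := by linarith
  have hp' : p ≠ 0 := by linarith
  have hnp : 1 < n / p := by rw [lt_div_iff₀ (by linarith)]; linarith
  have hnn : n / p < n := div_lt_self (by linarith) hp
  have hβ : 0 < p / (p - 1) / n := div_pos (div_pos (by linarith) (by linarith)) (by linarith)
  have e1 : (0 + 1) / (p / (p - 1) / n) = n - n / p := by field_simp; ring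
  have h := lintegral_rpow_mul_one_add_rpow (c := 0) (ν := n) hβ (by norm_num) (by rw [e1]; linarith)
  simp only [Real.rpow_zero, one_mul] at h
  rw [h, e1]
  congr 1
  rw [show 1 / (p / (p - 1) / n) = n - n / p by rw [← e1]; ring, sub_sub_cancel,
    ← Real.Gamma_add_one (by linarith), blissMass]

theorem lintegral_rpow_mul_blissProfile (hp : 1 < p) (hpn : p < n) :
    ∫⁻ x in Ioi (0 : ℝ), ENNReal.ofReal (x ^ (p / (p - 1) / n) * (1 + x ^ (p / (p - 1) / n)) ^ (-n)) =
      ENNReal.ofReal (blissMass n p * (n * (p - 1) / (n - p))) := by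
  have hp0 : p - 1 ≠ 0 := by linarith
  have hn0 : n ≠ 0 := by linarith
  have hnp0 : n - p ≠ 0 := by linarith
  have hp' : p ≠ 0 := by linarith
  have hnp : 1 < n / p := by rw [lt_div_iff₀ (by linarith)]; linarith
  have hnn : n / p < n := div_lt_self (by linarith) hp
  have hβ : 0 < p / (p - 1) / n := div_pos (div_pos (by linarith) (by linarith)) (by linarith)
  have e1 : (p / (p - 1) / n + 1) / (p / (p - 1) / n) = n - n / p + 1 := by field_simp; ring
  have e2 : 1 / (p / (p - 1) / n) = n - n / p := by field_simp
  rw [lintegral_rpow_mul_one_add_rpow hβ (by linarith) (by rw [e1]; linarith), e1, e2]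
  congr 1
  rw [show n - (n - n / p + 1) = n / p - 1 by ring, blissMass]
  have h3 := Real.Gamma_add_one (s := n / p - 1) (by linarith)
  rw [sub_add_cancel] at h3
  rw [h3]
  have h4 : n / p - 1 ≠ 0 := by linarith
  have h5 : n - n / p = (n / p - 1) * (n * (p - 1) / (n - p)) := by field_simp
  rw [h5]
  ring

theorem lintegral_blissProfile_rpow (hp : 1 < p) (hpn : p < n) :
    ∫⁻ x in Ioi (0 : ℝ), ENNReal.ofReal (((1 + x ^ (p / (p - 1) / n)) ^ (-n)) ^ (1 - 1 / n)) =
      ENNReal.ofReal (blissMass n p * (p * (n - 1) / (n - p))) := by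
  have hk := blissMass_pos hp hpn
  have hn0 : n ≠ 0 := by linarith
  have hnp0 : n - p ≠ 0 := by linarith
  have hr : 0 < n * (p - 1) / (n - p) := div_pos (mul_pos (by linarith) (by linarith)) (by linarith)
  rw [show blissMass n p * (p * (n - 1) / (n - p)) = blissMass n p + blissMass n p * (n * (p - 1) / (n - p)) by
      field_simp; ring,
    ENNReal.ofReal_add hk.le (by positivity), ← lintegral_blissProfile hp hpn, ← lintegral_rpow_mul_blissProfile hp hpn,
    ← lintegral_add_left (by fun_prop)]
  refine setLIntegral_congr_fun measurableSet_Ioi fun x hx => ?_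
  have hx0 : (0 : ℝ) < x := hx
  have h1 : 0 < 1 + x ^ (p / (p - 1) / n) := by positivity
  rw [← ENNReal.ofReal_add (by positivity) (by positivity), ← one_add_mul, ← Real.rpow_mul h1.le]
  congr 1
  rw [show -n * (1 - 1 / n) = 1 + -n by field_simp; ring, Real.rpow_add h1, Real.rpow_one]

end BlissProfile

namespace IsDecrProfile

variable {v : ℝ → ℝ} {B V₀ : ℝ}

theorem integrableOn_rpow (hv : IsDecrProfile v B V₀) {r : ℝ} (hr : 0 ≤ r) :
    IntegrableOn (fun V => v V ^ r) (Ioo 0 V₀) := by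
  have hvc : ContinuousOn v (Ioo 0 V₀) := hv.continuousOn.mono fun x hx => hx.1
  refine ⟨(hvc.rpow_const fun x _ => Or.inr hr).aestronglyMeasurable measurableSet_Ioo, ?_⟩
  rw [hasFiniteIntegral_iff_ofReal (Eventually.of_forall fun x => Real.rpow_nonneg (hv.nonneg x) _)]
  exact (hv.lintegral_rpow_ne_top hr).lt_top

theorem lintegral_rpow_eq (hv : IsDecrProfile v B V₀) {r : ℝ} (hr : 0 ≤ r) :
    ∫⁻ V in Ioo 0 V₀, ENNReal.ofReal (v V ^ r) = ENNReal.ofReal (∫ V in Ioo 0 V₀, v V ^ r) :=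
  (ofReal_integral_eq_lintegral_ofReal (hv.integrableOn_rpow hr)
    (Eventually.of_forall fun x => Real.rpow_nonneg (hv.nonneg x) _)).symm

theorem integral_rpow_pos (hv : IsDecrProfile v B V₀) (hV₀ : 0 < V₀) {r : ℝ} (hr : 0 ≤ r) :
    0 < ∫ V in Ioo 0 V₀, v V ^ r := by
  rw [setIntegral_pos_iff_support_of_nonneg_ae (Eventually.of_forall fun x => Real.rpow_nonneg (hv.nonneg x) _)
    (hv.integrableOn_rpow hr)]
  have : Function.support (fun V => v V ^ r) ∩ Ioo 0 V₀ = Ioo 0 V₀ :=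
    inter_eq_right.2 fun x hx => (Real.rpow_pos_of_pos (hv.pos x hx.1.le hx.2) _).ne'
  rw [this, Real.volume_Ioo]
  simpa using hV₀

/-- The inequality of Bliss, by one-dimensional mass transport. -/
theorem bliss (hv : IsDecrProfile v B V₀) (hV₀ : 0 < V₀) {n p : ℝ} (hp : 1 < p) (hpn : p < n) :
    ENNReal.ofReal (blissConst n p) *
        (∫⁻ V in Ioo 0 V₀, ENNReal.ofReal (v V ^ (n * p / (n - p)))) ^ ((n - p) / (n * p)) ≤
      (∫⁻ y in Ioo 0 V₀, ENNReal.ofReal ((y ^ (1 - 1 / n) * |deriv v y|) ^ p)) ^ (1 / p) := by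
  have hn1 : 1 < n := hp.trans hpn
  have hn0 : n ≠ 0 := by linarith
  have hp0 : p ≠ 0 := by linarith
  have hp10 : p - 1 ≠ 0 := by linarith
  have hnp0 : n - p ≠ 0 := by linarith
  set q := p / (p - 1) with hq
  have hpq : p.HolderConjugate q := by
    rw [Real.holderConjugate_iff]
    refine ⟨hp, ?_⟩
    rw [hq]; field_simp; ring
  have hq0 : 0 < q := hpq.symm.pos
  set β := q / n with hβdef
  have hβ : 0 < β := div_pos hq0 (by linarith)
  set r := n * p / (n - p) with hr
  have hr0 : 0 < r := div_pos (mul_pos (by linarith) (by linarith)) (by linarith)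
  set s := p * (n - 1) / (n - p) with hs
  have hs1 : 1 ≤ s := by
    rw [hs, le_div_iff₀ (by linarith)]; nlinarith
  have hsr : s = r * (1 - 1 / n) := by rw [hs, hr]; field_simp
  have hsq : (s - 1) * q = r := by rw [hs, hr, hq]; field_simp; ring
  set k := blissMass n p with hk
  have hk0 : 0 < k := blissMass_pos hp hpn
  set f : ℝ → ℝ := fun V => v V ^ r with hf
  set g : ℝ → ℝ := fun x => (1 + |x| ^ β) ^ (-n) with hg
  have hb : ∀ x : ℝ, 0 < 1 + |x| ^ β := fun x => by positivity
  have hgpos : ∀ x, 0 < g x := fun x => Real.rpow_pos_of_pos (hb x) _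
  have hgc : Continuous g := (continuous_const.add (continuous_abs.rpow_const fun x => Or.inr hβ.le)).rpow_const
    fun x => Or.inl (hb x).ne'
  have hg1 : ∫⁻ x in Ioi (0 : ℝ), ENNReal.ofReal (g x) = ENNReal.ofReal k := by
    rw [hk, ← lintegral_blissProfile hp hpn]
    refine setLIntegral_congr_fun measurableSet_Ioi fun x hx => ?_
    simp only [hg, abs_of_pos (show 0 < x from hx), hβdef, hq]
  have hg2 : ∫⁻ x in Ioi (0 : ℝ), ENNReal.ofReal (x ^ β * g x) = ENNReal.ofReal (k * (n * (p - 1) / (n - p))) := by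
    rw [hk, ← lintegral_rpow_mul_blissProfile hp hpn]
    refine setLIntegral_congr_fun measurableSet_Ioi fun x hx => ?_
    simp only [hg, abs_of_pos (show 0 < x from hx), hβdef, hq]
  have hg3 : ∫⁻ x in Ioi (0 : ℝ), ENNReal.ofReal (g x ^ (1 - 1 / n)) = ENNReal.ofReal (k * s) := by
    rw [hk, hs, ← lintegral_blissProfile_rpow hp hpn]
    refine setLIntegral_congr_fun measurableSet_Ioi fun x hx => ?_
    simp only [hg, abs_of_pos (show 0 < x from hx), hβdef, hq]
  have hgi : IntegrableOn g (Ioi 0) := by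
    refine ⟨hgc.aestronglyMeasurable, ?_⟩
    rw [hasFiniteIntegral_iff_ofReal (Eventually.of_forall fun x => (hgpos x).le), hg1]
    exact ENNReal.ofReal_lt_top
  have hgint : ∫ x in Ioi 0, g x = k := by
    rw [integral_eq_lintegral_of_nonneg_ae (Eventually.of_forall fun x => (hgpos x).le) hgc.aestronglyMeasurable, hg1,
      ENNReal.toReal_ofReal hk0.le]
  have hfpos : ∀ V ∈ Ioo 0 V₀, 0 < f V := fun V hV => Real.rpow_pos_of_pos (hv.pos V hV.1.le hV.2) _
  have hvc : ContinuousOn v (Ioo 0 V₀) := hv.continuousOn.mono fun x hx => hx.1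
  have hfc : ContinuousOn f (Ioo 0 V₀) := hvc.rpow_const fun x hx => Or.inr hr0.le
  have hfi : IntegrableOn f (Ioo 0 V₀) := hv.integrableOn_rpow hr0.le
  obtain ⟨W, hW, hWm, hWi⟩ := exists_transport hV₀ hfc hfpos hfi hgc hgpos hgi
  rw [hgint] at hW
  set N := ∫ x in Ioo 0 V₀, f x with hN
  have hN0 : 0 < N := hv.integral_rpow_pos hV₀ hr0.le
  have hNl : ∫⁻ V in Ioo 0 V₀, ENNReal.ofReal (v V ^ r) = ENNReal.ofReal N := hv.lintegral_rpow_eq hr0.le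
  set c := k / N with hc
  have hc0 : 0 < c := div_pos hk0 hN0
  set W' : ℝ → ℝ := fun V => c * f V / g (W V) with hW'
  have hW'0 : ∀ V ∈ Ioo 0 V₀, 0 < W' V := fun V hV => div_pos (mul_pos hc0 (hfpos V hV)) (hgpos _)
  have hWd : ∀ V ∈ Ioo 0 V₀, HasDerivWithinAt W (W' V) (Ioo 0 V₀) V := fun V hV => (hW V hV).2.hasDerivWithinAt
  have hWc : ContinuousOn W (Ioo 0 V₀) := fun V hV => (hWd V hV).continuousWithinAt
  have hW'c : ContinuousOn W' (Ioo 0 V₀) :=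
    (continuousOn_const.mul hfc).div (hgc.comp_continuousOn hWc) fun x _ => (hgpos _).ne'
  have hcov : ∀ φ : ℝ → ENNReal, ∫⁻ x in Ioi 0, φ x = ∫⁻ V in Ioo 0 V₀, ENNReal.ofReal (W' V) * φ (W V) := fun φ => by
    rw [← hWi, lintegral_image_eq_lintegral_abs_deriv_mul measurableSet_Ioo hWd hWm.injOn]
    exact setLIntegral_congr_fun measurableSet_Ioo fun V hV => by rw [abs_of_pos (hW'0 V hV)]
  have hn' : 0 < 1 / n := by positivity
  have hn'' : 0 < 1 - 1 / n := by
    rw [sub_pos, div_lt_one (by linarith)]; exact hn1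
  have hfW : ∀ V ∈ Ioo 0 V₀, f V = c⁻¹ * (W' V * g (W V)) := fun V hV => by
    have := (hgpos (W V)).ne'
    simp only [hW']; field_simp
  -- the two sides after the change of variables
  have hL : ∫⁻ V in Ioo 0 V₀, ENNReal.ofReal (W' V ^ (1 / n)) * ENNReal.ofReal (v V ^ s) =
      ENNReal.ofReal (c⁻¹ ^ (1 - 1 / n)) * ENNReal.ofReal (k * s) := by
    rw [← hg3, hcov, ← lintegral_const_mul' _ _ ENNReal.ofReal_ne_top]
    refine setLIntegral_congr_fun measurableSet_Ioo fun V hV => ?_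
    have h0 := hW'0 V hV
    have hg0 := hgpos (W V)
    rw [← ENNReal.ofReal_mul (by positivity), ← ENNReal.ofReal_mul h0.le, ← ENNReal.ofReal_mul (by positivity),
      hsr, Real.rpow_mul (hv.nonneg V), show v V ^ r = f V from rfl, hfW V hV,
      Real.mul_rpow (by positivity) (by positivity), Real.mul_rpow h0.le hg0.le]
    congr 1
    have : W' V ^ (1 / n) * W' V ^ (1 - 1 / n) = W' V := by
      rw [← Real.rpow_add h0, add_sub_cancel, Real.rpow_one]
    linear_combination (c⁻¹ ^ (1 - 1 / n) * g (W V) ^ (1 - 1 / n)) * this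
  have hR : ∫⁻ V in Ioo 0 V₀, ENNReal.ofReal (v V ^ r * W V ^ β) =
      ENNReal.ofReal (c⁻¹ * (k * (n * (p - 1) / (n - p)))) := by
    rw [ENNReal.ofReal_mul (by positivity), ← hg2, hcov, ← lintegral_const_mul' _ _ ENNReal.ofReal_ne_top]
    refine setLIntegral_congr_fun measurableSet_Ioo fun V hV => ?_
    have h0 := hW'0 V hV
    rw [← ENNReal.ofReal_mul h0.le, ← ENNReal.ofReal_mul (by positivity), show v V ^ r = f V from rfl, hfW V hV]
    congr 1
    ring
  have hmain := hv.hardy_type hs1 hpq (H' := fun V => ENNReal.ofReal (W' V ^ (1 / n)))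
    (H := fun y => ENNReal.ofReal (y ^ (1 - 1 / n) * W y ^ (1 / n)))
    (G := fun V => ENNReal.ofReal (v V ^ r * W V ^ β)) (a := fun y => y ^ (1 - 1 / n))
    ((hW'c.aemeasurable measurableSet_Ioo).pow_const _).ennreal_ofReal
    (((hvc.aemeasurable measurableSet_Ioo).pow_const _).mul
      ((hWc.aemeasurable measurableSet_Ioo).pow_const _)).ennreal_ofReal (by fun_prop)
    (fun y hy => Real.rpow_nonneg hy.1.le _) (fun y hy => ?_) (fun y hy => ?_)
  · rw [hL, hR] at hmain
    rw [hNl]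
    have hr' : 0 < n * (p - 1) / (n - p) := div_pos (mul_pos (by linarith) (by linarith)) (by linarith)
    have hs0 : 0 < s := by linarith
    have hbc : 0 < blissConst n p := mul_pos (Real.rpow_pos_of_pos hk0 _) (Real.rpow_pos_of_pos hr' _)
    have hpow : 0 ≤ (n - p) / (n * p) := div_nonneg (by linarith) (mul_nonneg (by linarith) (by linarith))
    set X := (∫⁻ y in Ioo 0 V₀, ENNReal.ofReal ((y ^ (1 - 1 / n) * |deriv v y|) ^ p)) ^ (1 / p)
    rw [ENNReal.ofReal_rpow_of_nonneg (by positivity) hpq.symm.one_div_nonneg, ← ENNReal.ofReal_mul (by positivity),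
      mul_comm X, ← mul_assoc (ENNReal.ofReal s), ← ENNReal.ofReal_mul hs0.le] at hmain
    rw [ENNReal.ofReal_rpow_of_nonneg hN0.le hpow, ← ENNReal.ofReal_mul hbc.le]
    set b := s * (c⁻¹ * (k * (n * (p - 1) / (n - p)))) ^ (1 / q) with hbdef
    have hb0 : 0 < b := by positivity
    have hid : c⁻¹ ^ (1 - 1 / n) * (k * s) = b * (blissConst n p * N ^ ((n - p) / (n * p))) := by
      refine Real.log_injOn_pos (mem_Ioi.2 (by positivity)) (mem_Ioi.2 (by positivity)) ?_
      set ρ := n * (p - 1) / (n - p)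
      have hbl : blissConst n p = k ^ (1 / n) * ρ ^ (-(1 - 1 / p)) := rfl
      rw [hbdef, hbl, hc, inv_div]
      have h1 := (Real.rpow_pos_of_pos hk0 (1 / n)).ne'
      have h2 := (Real.rpow_pos_of_pos hr' (-(1 - 1 / p))).ne'
      rw [Real.log_mul (by positivity) (by positivity), Real.log_mul (by positivity) (by positivity),
        Real.log_mul (by positivity) (by positivity), Real.log_mul (by positivity) (by positivity),
        Real.log_mul (by positivity) (by positivity), Real.log_mul h1 h2,
        Real.log_rpow (by positivity), Real.log_rpow (by positivity), Real.log_rpow (by positivity),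
        Real.log_rpow (by positivity), Real.log_rpow (by positivity),
        Real.log_mul (by positivity) (by positivity), Real.log_mul (by positivity) (by positivity),
        Real.log_div (by positivity) (by positivity), hq]
      field_simp
      ring
    rw [hid, ENNReal.ofReal_mul hb0.le] at hmain
    exact (ENNReal.mul_le_mul_iff_right (ENNReal.ofReal_pos.2 hb0).ne' ENNReal.ofReal_ne_top).1 hmain
  · -- Hölder
    have hWy := (hW y hy).1
    have hsub : Ioo 0 y ⊆ Ioo 0 V₀ := fun x hx => ⟨hx.1, hx.2.trans hy.2⟩
    have hnconj : n.HolderConjugate (n / (n - 1)) := by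
      rw [Real.holderConjugate_iff]
      refine ⟨hn1, ?_⟩
      have : n - 1 ≠ 0 := by linarith
      field_simp; ring
    have h1 := ENNReal.lintegral_mul_le_Lp_mul_Lq (volume.restrict (Ioo 0 y)) hnconj
      (f := fun V => ENNReal.ofReal (W' V ^ (1 / n))) (g := fun _ => 1)
      (((hW'c.mono hsub).aemeasurable measurableSet_Ioo).pow_const _).ennreal_ofReal aemeasurable_const
    simp only [Pi.mul_apply, mul_one, ENNReal.one_rpow, lintegral_const, Measure.restrict_apply_univ, Real.volume_Ioo,
      one_mul, sub_zero] at h1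
    refine h1.trans ?_
    have h2 : ∫⁻ V in Ioo 0 y, ENNReal.ofReal (W' V ^ (1 / n)) ^ n ≤ ENNReal.ofReal (W y) := by
      calc _ = ∫⁻ V in Ioo 0 y, ENNReal.ofReal |W' V| * 1 := by
            refine setLIntegral_congr_fun measurableSet_Ioo fun V hV => ?_
            have h0 := hW'0 V (hsub hV)
            rw [ENNReal.ofReal_rpow_of_nonneg (by positivity) (by linarith), ← Real.rpow_mul h0.le, one_div,
              inv_mul_cancel₀ hn0, Real.rpow_one, abs_of_pos h0, mul_one]
        _ = ∫⁻ x in W '' Ioo 0 y, 1 :=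
            (lintegral_image_eq_lintegral_abs_deriv_mul measurableSet_Ioo
              (fun V hV => (hW V (hsub hV)).2.hasDerivWithinAt) (hWm.injOn.mono hsub) (fun _ => 1)).symm
        _ ≤ ∫⁻ x in Ioo 0 (W y), 1 := by
            refine lintegral_mono_set ?_
            rintro _ ⟨V, hV, rfl⟩
            exact ⟨(hW V (hsub hV)).1, hWm (hsub hV) hy hV.2⟩
        _ = _ := by simp
    rw [ENNReal.ofReal_mul (Real.rpow_nonneg hy.1.le _), mul_comm, ← ENNReal.ofReal_rpow_of_nonneg hy.1.le hn''.le,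
      ← ENNReal.ofReal_rpow_of_nonneg hWy.le hn'.le]
    refine mul_le_mul' (le_of_eq ?_) (ENNReal.rpow_le_rpow h2 hn'.le)
    congr 1
    field_simp
  · have hWy := (hW y hy).1
    have hvy := hv.nonneg y
    have hy0 := hy.1
    rw [ENNReal.ofReal_rpow_of_nonneg (by positivity) hpq.symm.one_div_nonneg, ← ENNReal.ofReal_mul (by positivity),
      ← ENNReal.ofReal_mul (by positivity), Real.mul_rpow (by positivity) (by positivity), ← Real.rpow_mul hvy,
      ← Real.rpow_mul hWy.le, ← hsq, mul_assoc, mul_one_div_cancel hq0.ne', mul_one, hβdef,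
      show q / n * (1 / q) = 1 / n by field_simp]
    refine le_of_eq ?_
    congr 1
    ring

end IsDecrProfile

theorem add_rpow_ge_of_weights {a b l θ : ℝ} (ha : 0 ≤ a) (hb : 0 ≤ b) (hl0 : 0 < l) (hl1 : l < 1) (hθ0 : 0 ≤ θ)
    (hθ1 : θ ≤ 1) : l ^ (1 - θ) * a ^ θ + (1 - l) ^ (1 - θ) * b ^ θ ≤ (a + b) ^ θ := by
  have hl1' : 0 < 1 - l := by linarith
  have h := (Real.concaveOn_rpow hθ0 hθ1).2 (x := a / l) (y := b / (1 - l)) (mem_Ici.2 (by positivity))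
    (mem_Ici.2 (by positivity)) hl0.le hl1'.le (by ring)
  simp only [smul_eq_mul, mul_div_cancel₀ _ hl0.ne', mul_div_cancel₀ _ hl1'.ne'] at h
  refine le_trans (le_of_eq ?_) h
  rw [Real.div_rpow ha hl0.le, Real.div_rpow hb hl1'.le, Real.rpow_sub hl0, Real.rpow_sub hl1', Real.rpow_one,
    Real.rpow_one]
  ring

theorem iso_rpow_ge (m : ℕ) {V l p : ℝ} (hV : 0 < V) (hl0 : 0 < l) (hl1 : l < 1) (hp : 0 ≤ p) (hpm : p ≤ (m : ℝ) + 1) :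
    l ^ (1 - p / ((m : ℝ) + 1)) * (m * V) ^ p + (1 - l) ^ (1 - p / ((m : ℝ) + 1)) *
      (((m : ℝ) + 1) * unitBallVol (m + 1) ^ (1 / ((m : ℝ) + 1)) * V ^ (1 - 1 / ((m : ℝ) + 1))) ^ p ≤
      iso m V ^ p := by
  have hσ := unitBallVol_pos (m + 1)
  have hn : (0 : ℝ) < (m : ℝ) + 1 := by positivity
  have h := add_rpow_ge_of_weights (a := ((m : ℝ) * V) ^ (m + 1))
    (b := ((m : ℝ) + 1) ^ (m + 1) * unitBallVol (m + 1) * V ^ m) (by positivity) (by positivity) hl0 hl1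
    (div_nonneg hp hn.le) ((div_le_one hn).2 hpm)
  have e1 : iso m V ^ p = isoPow m V ^ (p / ((m : ℝ) + 1)) := by
    rw [iso, ← Real.rpow_mul (isoPow_nonneg m hV.le), one_div_mul_eq_div]
  rw [e1]
  refine le_trans (le_of_eq ?_) h
  congr 2
  · rw [← Real.rpow_natCast, ← Real.rpow_mul (by positivity)]
    congr 1
    push_cast
    field_simp
  · rw [show p / ((m : ℝ) + 1) = 1 / ((m : ℝ) + 1) * p by ring, Real.rpow_mul (by positivity)]
    congr 1
    rw [Real.mul_rpow (by positivity) (by positivity), Real.mul_rpow (by positivity) (by positivity),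
      ← Real.rpow_natCast, ← Real.rpow_natCast V, ← Real.rpow_mul hn.le, ← Real.rpow_mul hV.le]
    push_cast
    rw [mul_one_div_cancel hn.ne', Real.rpow_one]
    congr 2
    field_simp
    ring

namespace IsDecrProfile

variable {v : ℝ → ℝ} {B V₀ : ℝ}

theorem sobolev_type (hv : IsDecrProfile v B V₀) (hV₀ : 0 < V₀) {m : ℕ} (hm : 1 ≤ m) {p : ℝ} (hp : 1 < p)
    (hpm : p < (m : ℝ) + 1) :
    ENNReal.ofReal (((m : ℝ) / p) ^ ((m : ℝ) + 1)) *
        (∫⁻ V in Ioo 0 V₀, ENNReal.ofReal (v V ^ p)) ^ (((m : ℝ) + 1) / p) +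
      ENNReal.ofReal (sobolevConst (m + 1) p ^ ((m : ℝ) + 1)) *
        (∫⁻ V in Ioo 0 V₀, ENNReal.ofReal (v V ^ (((m : ℝ) + 1) * p / ((m : ℝ) + 1 - p)))) ^
          (((m : ℝ) + 1 - p) / p) ≤
      (∫⁻ V in Ioo 0 V₀, ENNReal.ofReal ((iso m V * |deriv v V|) ^ p)) ^ (((m : ℝ) + 1) / p) := by
  have hσ := unitBallVol_pos (m + 1)
  have hm0 : (0 : ℝ) < m := by exact_mod_cast hm
  have hhardy := hv.hardy hp
  have hbliss := hv.bliss hV₀ hp hpm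
  have hS : sobolevConst (m + 1) p =
      ((m : ℝ) + 1) * unitBallVol (m + 1) ^ (1 / ((m : ℝ) + 1)) * blissConst ((m : ℝ) + 1) p := by
    have := sobolevConst_eq (m := m + 1) hp (by push_cast; exact hpm)
    push_cast at this
    exact this
  set n : ℝ := (m : ℝ) + 1 with hn
  have hn0 : 0 < n := by positivity
  have hp0 : 0 < p := by linarith
  have hnp : 0 < n - p := by linarith
  have hvc : ContinuousOn v (Ioo 0 V₀) := hv.continuousOn.mono fun x hx => hx.1
  have hr0 : 0 < n * p / (n - p) := by positivity
  rw [hv.lintegral_rpow_eq hp0.le, hv.lintegral_rpow_eq hr0.le]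
  rw [hv.lintegral_rpow_eq hp0.le] at hhardy
  rw [hv.lintegral_rpow_eq hr0.le] at hbliss
  have hP := hv.integral_rpow_pos hV₀ hp0.le
  have hN := hv.integral_rpow_pos hV₀ hr0.le
  set P := ∫ V in Ioo 0 V₀, v V ^ p
  set N := ∫ V in Ioo 0 V₀, v V ^ (n * p / (n - p))
  have hbc : 0 < blissConst n p := mul_pos (Real.rpow_pos_of_pos (blissMass_pos hp hpm) _)
    (Real.rpow_pos_of_pos (div_pos (mul_pos hn0 (by linarith)) hnp) _)
  set X := ((m : ℝ) / p) ^ n * P ^ (n / p) with hX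
  set Y := sobolevConst (m + 1) p ^ n * N ^ ((n - p) / p) with hY
  have hS0 : 0 < sobolevConst (m + 1) p := by rw [hS]; positivity
  have hX0 : 0 < X := by positivity
  have hY0 : 0 < Y := by positivity
  set T := X + Y with hT
  have hT0 : 0 < T := by positivity
  set l := X / T with hl
  have hl0 : 0 < l := by positivity
  have hl1 : l < 1 := by rw [hl, div_lt_one hT0]; linarith
  have h1l : 1 - l = Y / T := by rw [hl]; field_simp; ring
  set θ := p / n with hθ
  have hθ0 : 0 < θ := by positivity
  set κ := n * unitBallVol (m + 1) ^ (1 / n) with hκ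
  have hκ0 : 0 < κ := by positivity
  have hx : ENNReal.ofReal (X ^ θ) ≤ ∫⁻ y in Ioo 0 V₀, ENNReal.ofReal ((m * y * |deriv v y|) ^ p) := by
    have e : X ^ θ = (m / p) ^ p * P := by
      rw [hX, Real.mul_rpow (by positivity) (by positivity), ← Real.rpow_mul (by positivity), ← Real.rpow_mul hP.le, hθ]
      rw [show n * (p / n) = p by field_simp, show n / p * (p / n) = 1 by field_simp, Real.rpow_one]
    have e2 : ∫⁻ y in Ioo 0 V₀, ENNReal.ofReal ((m * y * |deriv v y|) ^ p) =
        ENNReal.ofReal ((m : ℝ) ^ p) * ∫⁻ y in Ioo 0 V₀, ENNReal.ofReal ((y * |deriv v y|) ^ p) := by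
      rw [← lintegral_const_mul' _ _ ENNReal.ofReal_ne_top]
      refine setLIntegral_congr_fun measurableSet_Ioo fun y hy => ?_
      have hy0 := hy.1
      rw [mul_assoc, Real.mul_rpow hm0.le (by positivity), ENNReal.ofReal_mul (by positivity)]
    rw [e, e2, Real.div_rpow hm0.le hp0.le, div_mul_eq_mul_div, mul_div_assoc, ENNReal.ofReal_mul (by positivity)]
    refine mul_le_mul' le_rfl ?_
    rw [ENNReal.ofReal_div_of_pos (by positivity), ← ENNReal.ofReal_rpow_of_pos hp0]
    exact ENNReal.div_le_of_le_mul' hhardy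
  have hy : ENNReal.ofReal (Y ^ θ) ≤ ∫⁻ y in Ioo 0 V₀, ENNReal.ofReal ((κ * y ^ (1 - 1 / n) * |deriv v y|) ^ p) := by
    have e : Y ^ θ = κ ^ p * (blissConst n p * N ^ ((n - p) / (n * p))) ^ p := by
      rw [← Real.mul_rpow (by positivity) (by positivity), ← mul_assoc, ← hS, hY,
        Real.mul_rpow (by positivity) (by positivity), Real.mul_rpow (by positivity) (by positivity),
        ← Real.rpow_mul hS0.le, ← Real.rpow_mul hN.le, ← Real.rpow_mul hN.le, hθ]
      congr 2 <;> field_simp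
    have e2 : ∫⁻ y in Ioo 0 V₀, ENNReal.ofReal ((κ * y ^ (1 - 1 / n) * |deriv v y|) ^ p) =
        ENNReal.ofReal (κ ^ p) * ∫⁻ y in Ioo 0 V₀, ENNReal.ofReal ((y ^ (1 - 1 / n) * |deriv v y|) ^ p) := by
      rw [← lintegral_const_mul' _ _ ENNReal.ofReal_ne_top]
      refine setLIntegral_congr_fun measurableSet_Ioo fun y hy => ?_
      have hy0 := hy.1
      rw [mul_assoc, Real.mul_rpow hκ0.le (by positivity), ENNReal.ofReal_mul (by positivity)]
    rw [e, e2, ENNReal.ofReal_mul (by positivity)]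
    refine mul_le_mul' le_rfl ?_
    have := ENNReal.rpow_le_rpow hbliss hp0.le
    rw [← ENNReal.rpow_mul, one_div_mul_cancel hp0.ne', ENNReal.rpow_one, ENNReal.ofReal_rpow_of_pos hN,
      ← ENNReal.ofReal_mul hbc.le, ENNReal.ofReal_rpow_of_pos (by positivity)] at this
    exact this
  have hK : ENNReal.ofReal (T ^ θ) ≤ ∫⁻ V in Ioo 0 V₀, ENNReal.ofReal ((iso m V * |deriv v V|) ^ p) := by
    calc ENNReal.ofReal (T ^ θ) = ENNReal.ofReal (l ^ (1 - θ)) * ENNReal.ofReal (X ^ θ) +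
          ENNReal.ofReal ((1 - l) ^ (1 - θ)) * ENNReal.ofReal (Y ^ θ) := by
          have h1l0 : 0 < 1 - l := by linarith
          rw [← ENNReal.ofReal_mul (by positivity), ← ENNReal.ofReal_mul (by positivity),
            ← ENNReal.ofReal_add (by positivity) (by positivity), h1l, hl, Real.div_rpow hX0.le hT0.le,
            Real.div_rpow hY0.le hT0.le, div_mul_eq_mul_div, div_mul_eq_mul_div, ← Real.rpow_add hX0,
            ← Real.rpow_add hY0, sub_add_cancel, Real.rpow_one, Real.rpow_one, ← add_div, ← hT]
          congr 1
          rw [eq_div_iff (by positivity), ← Real.rpow_add hT0, add_sub_cancel, Real.rpow_one]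
      _ ≤ ENNReal.ofReal (l ^ (1 - θ)) * (∫⁻ y in Ioo 0 V₀, ENNReal.ofReal ((m * y * |deriv v y|) ^ p)) +
          ENNReal.ofReal ((1 - l) ^ (1 - θ)) *
            ∫⁻ y in Ioo 0 V₀, ENNReal.ofReal ((κ * y ^ (1 - 1 / n) * |deriv v y|) ^ p) :=
          add_le_add (mul_le_mul' le_rfl hx) (mul_le_mul' le_rfl hy)
      _ = ∫⁻ y in Ioo 0 V₀, (ENNReal.ofReal (l ^ (1 - θ)) * ENNReal.ofReal ((m * y * |deriv v y|) ^ p) +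
          ENNReal.ofReal ((1 - l) ^ (1 - θ)) * ENNReal.ofReal ((κ * y ^ (1 - 1 / n) * |deriv v y|) ^ p)) := by
          rw [lintegral_add_left (by fun_prop), lintegral_const_mul' _ _ ENNReal.ofReal_ne_top,
            lintegral_const_mul' _ _ ENNReal.ofReal_ne_top]
      _ ≤ _ := by
          refine setLIntegral_mono' measurableSet_Ioo fun y hy => ?_
          have hy0 := hy.1
          have h1l0 : 0 < 1 - l := by linarith
          have hiso := iso_rpow_ge m hy0 hl0 hl1 hp0.le hpm.le
          have hisopos : 0 ≤ iso m y := Real.rpow_nonneg (isoPow_nonneg m hy0.le) _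
          rw [← ENNReal.ofReal_mul (by positivity), ← ENNReal.ofReal_mul (by positivity),
            ← ENNReal.ofReal_add (by positivity) (by positivity)]
          refine ENNReal.ofReal_le_ofReal ?_
          rw [Real.mul_rpow (by positivity) (abs_nonneg _), Real.mul_rpow (by positivity) (abs_nonneg _),
            Real.mul_rpow hisopos (abs_nonneg _), ← mul_assoc, ← mul_assoc, ← add_mul]
          exact mul_le_mul_of_nonneg_right hiso (by positivity)
  have hfin := ENNReal.rpow_le_rpow hK (show 0 ≤ n / p by positivity)
  rw [ENNReal.ofReal_rpow_of_pos (by positivity), ← Real.rpow_mul hT0.le, hθ,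
    show p / n * (n / p) = 1 by field_simp, Real.rpow_one] at hfin
  refine le_trans (le_of_eq ?_) hfin
  rw [ENNReal.ofReal_rpow_of_pos hP, ENNReal.ofReal_rpow_of_pos hN, ← ENNReal.ofReal_mul (by positivity),
    ← ENNReal.ofReal_mul (by positivity), ← ENNReal.ofReal_add (by positivity) (by positivity)]

end IsDecrProfile

theorem measurable_iso (m : ℕ) : Measurable (iso m) := by
  unfold iso isoPow
  fun_prop

theorem measurable_isoErr (m : ℕ) : Measurable (isoErr m) := by
  unfold isoErr
  fun_prop

namespace IsProfile

variable {X : Type*} [MeasurableSpace X] {μ : Measure X} {F : X → ℝ} {B : ℝ} {D : X → ENNReal} {A C : ℝ → ℝ}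

theorem isDecrProfile_rearr (hF : IsProfile μ F B) (hcap : CapacityBound μ F D A C) {L : ℝ} (hL : 0 ≤ L)
    (hD : ∀ x, D x ≤ ENNReal.ofReal L) : IsDecrProfile (rearr μ F) (max B 0) (distr μ F 0) where
  anti := hF.rearr_antitoneOn
  nonneg := rearr_nonneg μ F
  le := fun _ hV => hF.rearr_le hV
  zero := fun V hV h => le_antisymm
    (not_lt.1 fun h' => absurd ((hF.lt_rearr_iff hV le_rfl).1 h') (not_lt.2 h)) (rearr_nonneg μ F V)
  pos := fun _ hV h => (hF.lt_rearr_iff hV le_rfl).2 h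
  lip := fun _ ha => hF.exists_lipschitzOnWith hcap hL hD ha
  diff := hF.ae_differentiableAt_rearr

theorem sobolev_type [SFinite μ] {m : ℕ} (hF : IsProfile μ F B) (hcap : CapacityBound μ F D (iso m) (isoErr m)) {L : ℝ} (hL : 0 ≤ L) (hD : ∀ x, D x ≤ ENNReal.ofReal L)
    (hDm : Measurable D) (hm : 1 ≤ m) {p : ℝ} (hp : 1 < p) (hpm : p < (m : ℝ) + 1) :
    ENNReal.ofReal (((m : ℝ) / p) ^ ((m : ℝ) + 1)) *
        (∫⁻ x, ENNReal.ofReal (F x ^ p) ∂μ) ^ (((m : ℝ) + 1) / p) +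
      ENNReal.ofReal (sobolevConst (m + 1) p ^ ((m : ℝ) + 1)) *
        (∫⁻ x, ENNReal.ofReal (F x ^ (((m : ℝ) + 1) * p / ((m : ℝ) + 1 - p))) ∂μ) ^ (((m : ℝ) + 1 - p) / p) ≤
      (∫⁻ x, D x ^ p ∂μ) ^ (((m : ℝ) + 1) / p) := by
  have hv := hF.isDecrProfile_rearr hcap hL hD
  have hnp : 0 < (m : ℝ) + 1 - p := by linarith
  have hV₀' : 0 ≤ distr μ F 0 := measureReal_nonneg
  have hr : ∀ r : ℝ, 0 < r → ∫⁻ x, ENNReal.ofReal (F x ^ r) ∂μ =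
      ∫⁻ V in Ioo 0 (distr μ F 0), ENNReal.ofReal (rearr μ F V ^ r) := fun r hr => by
    rw [← hF.lintegral_rearr_rpow hr]
    rw [← lintegral_indicator measurableSet_Ioi, ← lintegral_indicator measurableSet_Ioo]
    refine lintegral_congr fun V => ?_
    by_cases hV : V ∈ Ioo 0 (distr μ F 0)
    · rw [indicator_of_mem hV, indicator_of_mem (show V ∈ Ioi 0 from hV.1)]
    · rw [indicator_of_notMem hV]
      refine indicator_apply_eq_zero.2 fun hV0 => ?_
      rw [hv.zero V (le_of_lt hV0) (not_lt.1 fun h => hV ⟨hV0, h⟩), Real.zero_rpow hr.ne', ENNReal.ofReal_zero]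
  rw [hr p (by linarith), hr _ (by positivity)]
  rcases hV₀'.eq_or_lt with h0 | h0
  · rw [← h0]
    have h1 : (0 : ℝ) < ((m : ℝ) + 1) / p := by positivity
    have h2 : (0 : ℝ) < ((m : ℝ) + 1 - p) / p := by positivity
    simp [ENNReal.zero_rpow_of_pos h1, ENNReal.zero_rpow_of_pos h2]
  · refine (hv.sobolev_type h0 hm hp hpm).trans (ENNReal.rpow_le_rpow ?_ (by positivity))
    exact (lintegral_mono_set fun x hx => hx.1).trans
      (hF.lintegral_rearr_deriv_le hcap hDm (measurable_iso m) (measurable_isoErr m) hp)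

end IsProfile

/-- Even `C¹` truncations between the levels `s` and `t` with almost optimal slope. -/
theorem exists_even_truncation {s t ε : ℝ} (hs : 0 ≤ s) (hε : 0 < ε) (hst : 2 * ε < t - s) :
    ∃ Ψ Ψ' : ℝ → ℝ, (∀ τ, HasDerivAt Ψ (Ψ' τ) τ) ∧ Continuous Ψ' ∧ (∀ τ, 0 ≤ Ψ τ) ∧ (∀ τ, Ψ τ ≤ 1) ∧
      (∀ τ, |τ| ≤ s → Ψ τ = 0) ∧ (∀ τ, t ≤ |τ| → Ψ τ = 1) ∧ (∀ τ, |Ψ' τ| ≤ (t - s - 2 * ε)⁻¹) ∧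
      ∀ τ, ¬(s < |τ| ∧ |τ| < t) → Ψ' τ = 0 := by
  set φ : ℝ → ℝ := fun τ => max 0 (min 1 (min ((τ - s) / ε) ((t - τ) / ε))) with hφ
  have hφc : Continuous φ := by fun_prop
  have hφ0 : ∀ τ, 0 ≤ φ τ := fun τ => le_max_left _ _
  have hφ1 : ∀ τ, φ τ ≤ 1 := fun τ => max_le zero_le_one (min_le_left _ _)
  have hφl : ∀ τ, τ ≤ s → φ τ = 0 := fun τ h => max_eq_left
    ((min_le_right _ _).trans ((min_le_left _ _).trans (div_nonpos_of_nonpos_of_nonneg (by linarith) hε.le)))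
  have hφr : ∀ τ, t ≤ τ → φ τ = 0 := fun τ h => max_eq_left
    ((min_le_right _ _).trans ((min_le_right _ _).trans (div_nonpos_of_nonpos_of_nonneg (by linarith) hε.le)))
  have hφm : ∀ τ, s + ε ≤ τ → τ ≤ t - ε → 1 ≤ φ τ := fun τ h h' => le_max_of_le_right
    (le_min le_rfl (le_min ((one_le_div hε).2 (by linarith)) ((one_le_div hε).2 (by linarith))))
  set Φ : ℝ → ℝ := fun τ => ∫ x in (0 : ℝ)..τ, φ x with hΦ
  have hΦd : ∀ τ, HasDerivAt Φ (φ τ) τ := fun τ => (hφc.integral_hasStrictDerivAt 0 τ).hasDerivAt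
  have hsub : ∀ a b, Φ b - Φ a = ∫ x in a..b, φ x := fun a b =>
    intervalIntegral.integral_interval_sub_left (hφc.intervalIntegrable _ _) (hφc.intervalIntegrable _ _)
  have hΦm : Monotone Φ := monotone_of_deriv_nonneg (fun τ => (hΦd τ).differentiableAt)
    fun τ => by rw [(hΦd τ).deriv]; exact hφ0 τ
  have hΦl : ∀ τ, τ ≤ s → Φ τ = 0 := fun τ h => by
    simp only [hΦ]
    rw [intervalIntegral.integral_congr (g := fun _ => (0 : ℝ)), intervalIntegral.integral_zero]
    intro x hx
    exact hφl x (hx.2.trans (max_le hs h))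
  have hΦr : ∀ τ, t ≤ τ → Φ τ = Φ t := fun τ h => by
    rw [← sub_eq_zero, hsub, intervalIntegral.integral_congr (g := fun _ => (0 : ℝ)), intervalIntegral.integral_zero]
    intro x hx
    rw [uIcc_of_le h] at hx
    exact hφr x hx.1
  have hc : t - s - 2 * ε ≤ Φ t := by
    have h1 : Φ (t - ε) ≤ Φ t := hΦm (by linarith)
    have h2 : 0 ≤ Φ (s + ε) := (hΦl s le_rfl).symm.le.trans (hΦm (by linarith))
    have h3 : t - s - 2 * ε ≤ Φ (t - ε) - Φ (s + ε) := by
      rw [hsub]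
      calc t - s - 2 * ε = ∫ _ in (s + ε)..(t - ε), (1 : ℝ) := by simp; ring
        _ ≤ _ := intervalIntegral.integral_mono_on (by linarith) intervalIntegrable_const (hφc.intervalIntegrable _ _)
            fun x hx => hφm x hx.1 hx.2
    linarith
  have hd0 : 0 < t - s - 2 * ε := by linarith
  have hc0 : 0 < Φ t := by linarith
  have hΦ0 : ∀ τ, 0 ≤ Φ τ := fun τ => by
    rcases le_total τ s with h | h
    · exact (hΦl τ h).symm.le
    · exact (hΦl s le_rfl).symm.le.trans (hΦm h)
  have hΦ1 : ∀ τ, Φ τ ≤ Φ t := fun τ => by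
    rcases le_total τ t with h | h
    · exact hΦm h
    · exact (hΦr τ h).le
  have habs : ∀ τ, Φ τ + Φ (-τ) = Φ |τ| := fun τ => by
    rcases le_total 0 τ with h | h
    · rw [abs_of_nonneg h, hΦl (-τ) (by linarith), add_zero]
    · rw [abs_of_nonpos h, hΦl τ (by linarith), zero_add]
  have hφabs : ∀ τ, |φ τ - φ (-τ)| = φ |τ| := fun τ => by
    rcases le_total 0 τ with h | h
    · rw [abs_of_nonneg h, hφl (-τ) (by linarith), sub_zero, abs_of_nonneg (hφ0 τ)]
    · rw [abs_of_nonpos h, hφl τ (by linarith), zero_sub, abs_neg, abs_of_nonneg (hφ0 _)]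
  refine ⟨fun τ => (Φ τ + Φ (-τ)) / Φ t, fun τ => (φ τ - φ (-τ)) / Φ t, fun τ => ?_, by fun_prop, fun τ => ?_,
    fun τ => ?_, fun τ h => ?_, fun τ h => ?_, fun τ => ?_, fun τ h => ?_⟩
  · have h1 : HasDerivAt (fun τ => Φ (-τ)) (φ (-τ) * -1) τ :=
      HasDerivAt.comp (h₂ := Φ) (h := fun τ => -τ) τ (hΦd (-τ)) (hasDerivAt_neg τ)
    have h2 := ((hΦd τ).add h1).div_const (Φ t)
    rwa [mul_neg_one, ← sub_eq_add_neg] at h2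
  · dsimp only
    rw [habs]; exact div_nonneg (hΦ0 _) hc0.le
  · dsimp only
    rw [habs]; exact (div_le_one hc0).2 (hΦ1 _)
  · dsimp only
    rw [habs, hΦl _ h, zero_div]
  · dsimp only
    rw [habs, hΦr _ h, div_self hc0.ne']
  · dsimp only
    rw [abs_div, hφabs, abs_of_pos hc0, div_eq_mul_inv]
    have := inv_anti₀ hd0 hc
    have h2 : 0 ≤ (Φ t)⁻¹ := by positivity
    nlinarith [hφ1 |τ|, hφ0 |τ|]
  · have h1 : φ |τ| = 0 := by
      rcases le_or_gt |τ| s with h' | h'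
      · exact hφl _ h'
      · exact hφr _ (not_lt.1 fun h'' => h ⟨h', h''⟩)
    dsimp only
    rw [← hφabs, abs_eq_zero] at h1
    rw [h1, zero_div]

/-- The hyperbolic volume measure of the upper half-space. -/
noncomputable def hypVolume (m : ℕ) : Measure (Euc (m + 1)) :=
  (volume.restrict {x | 0 < x 0}).withDensity fun x => ENNReal.ofReal (x 0 ^ (m + 1))⁻¹

section HypVolume

variable {m : ℕ}

instance : SFinite (hypVolume m) := by unfold hypVolume; infer_instance

theorem measurableSet_upper : MeasurableSet {x : Euc (m + 1) | 0 < x 0} :=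
  measurableSet_lt measurable_const (by fun_prop)

theorem lintegral_hypVolume {φ : Euc (m + 1) → ENNReal} (hφ : Measurable φ) :
    ∫⁻ x, φ x ∂hypVolume m = ∫⁻ x in {x | 0 < x 0}, ENNReal.ofReal (x 0 ^ (m + 1))⁻¹ * φ x := by
  rw [hypVolume, lintegral_withDensity_eq_lintegral_mul _ (by fun_prop) hφ]
  rfl

theorem setLIntegral_hypVolume {S : Set (Euc (m + 1))} (hS : MeasurableSet S) (hpos : ∀ x ∈ S, 0 < x 0)
    {φ : Euc (m + 1) → ENNReal} (hφ : Measurable φ) :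
    ∫⁻ x in S, φ x ∂hypVolume m = ∫⁻ x in S, ENNReal.ofReal (x 0 ^ (m + 1))⁻¹ * φ x := by
  rw [hypVolume, restrict_withDensity hS, Measure.restrict_restrict hS,
    lintegral_withDensity_eq_lintegral_mul _ (by fun_prop) hφ, inter_eq_left.2 (show S ⊆ {x | 0 < x 0} from hpos)]
  rfl

theorem hypVolume_apply {S : Set (Euc (m + 1))} (hS : MeasurableSet S) (hpos : ∀ x ∈ S, 0 < x 0) :
    hypVolume m S = ∫⁻ x in S, ENNReal.ofReal (x 0 ^ (m + 1))⁻¹ := by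
  rw [← setLIntegral_one, setLIntegral_hypVolume hS hpos measurable_const]
  simp

theorem hypVolume_lt_top {K : Set (Euc (m + 1))} (hK : IsCompact K) (hpos : ∀ x ∈ K, 0 < x 0) :
    hypVolume m K < ⊤ := by
  rw [hypVolume_apply hK.measurableSet hpos]
  refine IntegrableOn.setLIntegral_lt_top (ContinuousOn.integrableOn_compact hK ?_)
  exact ContinuousOn.inv₀ (by fun_prop) fun x hx => (pow_pos (hpos x hx) _).ne'

end HypVolume

section HalfSpace

variable {m : ℕ} {f : Euc (m + 1) → ℝ}

theorem measurable_upperGrad (hf : ContDiff ℝ 1 f) :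
    Measurable fun x : Euc (m + 1) => ENNReal.ofReal (x 0 * ‖fderiv ℝ f x‖) := by
  have := (hf.continuous_fderiv one_ne_zero).measurable
  fun_prop

theorem isProfile_abs (hf : ContDiff ℝ 1 f) (hs : HasCompactSupport f) (hpos : ∀ x ∈ tsupport f, 0 < x 0) :
    ∃ B, IsProfile (hypVolume m) (fun x => |f x|) B := by
  obtain ⟨B, hB⟩ := hs.exists_bound_of_continuous hf.continuous
  refine ⟨B, hf.continuous.abs.measurable, fun x => abs_nonneg _, hB, ?_⟩
  refine (measure_mono fun x hx => ?_).trans_lt (hypVolume_lt_top hs hpos)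
  exact subset_tsupport f (abs_pos.1 hx)

theorem exists_upperGrad_le (hf : ContDiff ℝ 1 f) (hs : HasCompactSupport f) :
    ∃ L, 0 ≤ L ∧ ∀ x : Euc (m + 1), ENNReal.ofReal (x 0 * ‖fderiv ℝ f x‖) ≤ ENNReal.ofReal L := by
  have hc := hf.continuous_fderiv one_ne_zero
  obtain ⟨L, hL⟩ := (hs.fderiv (𝕜 := ℝ)).norm.mul_left.exists_bound_of_continuous
    (f := fun x : Euc (m + 1) => x 0 * ‖fderiv ℝ f x‖) (by fun_prop)
  exact ⟨L, (norm_nonneg _).trans (hL 0), fun x => ENNReal.ofReal_le_ofReal ((le_abs_self _).trans (hL x))⟩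

theorem setLIntegral_layer_ge (hm : 1 ≤ m) (hf : ContDiff ℝ 1 f) (hs : HasCompactSupport f)
    (hpos : ∀ x ∈ tsupport f, 0 < x 0) {V h s t ε : ℝ} (hV : 0 < V) (hh : 0 < h) (hs0 : 0 ≤ s) (hε : 0 < ε)
    (hst : 2 * ε < t - s) (ht : V ≤ (hypVolume m).real {x | t ≤ |f x|})
    (hsV : (hypVolume m).real {x | s < |f x|} ≤ V + h) :
    ENNReal.ofReal ((t - s - 2 * ε) * (iso m V - isoErr m V * h)) ≤
      ∫⁻ x in {x | s < |f x| ∧ |f x| < t}, ENNReal.ofReal (x 0 * ‖fderiv ℝ f x‖) ∂hypVolume m := by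
  obtain ⟨Ψ, Ψ', hΨd, hΨ'c, hΨ0, hΨ1, hΨs, hΨt, hΨ'b, hΨ'0⟩ := exists_even_truncation hs0 hε hst
  have hd0 : 0 < t - s - 2 * ε := by linarith
  have hfm : Measurable fun x => |f x| := hf.continuous.abs.measurable
  have hSm : MeasurableSet {x | s < |f x|} := measurableSet_lt measurable_const hfm
  have hTm : MeasurableSet {x | t ≤ |f x|} := measurableSet_le measurable_const hfm
  have hLm : MeasurableSet {x | s < |f x| ∧ |f x| < t} := hSm.inter (measurableSet_lt hfm measurable_const)
  have hSpos : ∀ x, s < |f x| → 0 < x 0 := fun x hx =>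
    hpos x (subset_tsupport f (abs_pos.1 (hs0.trans_lt hx)))
  have hSfin : hypVolume m {x | s < |f x|} < ⊤ :=
    (measure_mono fun x hx => subset_tsupport f (abs_pos.1 (hs0.trans_lt hx))).trans_lt (hypVolume_lt_top hs hpos)
  have hΨc : ContDiff ℝ 1 Ψ := by
    rw [contDiff_one_iff_deriv]
    refine ⟨fun τ => (hΨd τ).differentiableAt, ?_⟩
    rwa [show deriv Ψ = Ψ' from funext fun τ => (hΨd τ).deriv]
  have hΨz : Ψ 0 = 0 := hΨs 0 (by simpa using hs0)
  set w : Euc (m + 1) → ℝ := fun x => Ψ (f x) with hw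
  have hwc : ContDiff ℝ 1 w := hΨc.comp hf
  have hws : HasCompactSupport w := hs.comp_left hΨz
  have hwt : tsupport w ⊆ tsupport f := closure_mono fun x hx hfx => hx (by simp only [hw, hfx, hΨz])
  have hwpos : ∀ x, 0 < w x → s < |f x| := fun x hx => not_le.1 fun h' => hx.ne' (hΨs _ h')
  have hw1 : ∀ x, w x < 1 → |f x| < t := fun x hx => not_le.1 fun h' => hx.ne (hΨt _ h')
  have hwd : ∀ x, HasFDerivAt w (Ψ' (f x) • fderiv ℝ f x) x := fun x =>
    HasDerivAt.comp_hasFDerivAt (h₂ := Ψ) (f := f) x (hΨd (f x)) (hf.differentiable one_ne_zero x).hasFDerivAt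
  have hmass : V ≤ ∫ x, w x * (x 0 ^ (m + 1))⁻¹ := by
    have hnn : ∀ x, 0 ≤ w x * (x 0 ^ (m + 1))⁻¹ := fun x => by
      rcases (hΨ0 (f x)).eq_or_lt with h' | h'
      · simp only [hw, ← h', zero_mul, le_refl]
      · have := hSpos x (hwpos x h')
        have := hΨ0 (f x)
        simp only [hw]; positivity
    rw [integral_eq_lintegral_of_nonneg_ae (Eventually.of_forall hnn)
      (by have := hwc.continuous.measurable; exact Measurable.aestronglyMeasurable (by fun_prop))]
    refine ht.trans (ENNReal.toReal_mono (ne_of_lt ?_) ?_)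
    · calc ∫⁻ x, ENNReal.ofReal (w x * (x 0 ^ (m + 1))⁻¹) ≤
            ∫⁻ x, {x | s < |f x|}.indicator (fun x => ENNReal.ofReal (x 0 ^ (m + 1))⁻¹) x := by
            refine lintegral_mono fun x => ?_
            by_cases hx : s < |f x|
            · rw [indicator_of_mem (by exact hx)]
              have := hSpos x hx
              exact ENNReal.ofReal_le_ofReal (mul_le_of_le_one_left (by positivity) (hΨ1 _))
            · simp only [hw, hΨs _ (not_lt.1 hx), zero_mul, ENNReal.ofReal_zero, zero_le]
        _ = hypVolume m {x | s < |f x|} := by rw [lintegral_indicator hSm, hypVolume_apply hSm fun x hx => hSpos x hx]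
        _ < ⊤ := hSfin
    · rw [hypVolume_apply hTm fun x hx => hSpos x (lt_of_lt_of_le (show s < t by linarith) hx), ← lintegral_indicator hTm]
      refine lintegral_mono fun x => ?_
      by_cases hx : t ≤ |f x|
      · rw [indicator_of_mem (by exact hx)]
        simp only [hw, hΨt _ hx, one_mul, le_refl]
      · rw [indicator_of_notMem (by exact hx)]
        exact zero_le
  have hlay : ∫ x in {x | 0 < w x ∧ w x < 1}, (x 0 ^ (m + 1))⁻¹ ≤ h := by
    have hWm : MeasurableSet {x | 0 < w x ∧ w x < 1} :=
      (measurableSet_lt measurable_const hwc.continuous.measurable).inter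
        (measurableSet_lt hwc.continuous.measurable measurable_const)
    have hWpos : ∀ x ∈ {x | 0 < w x ∧ w x < 1}, 0 < x 0 := fun x hx => hSpos x (hwpos x hx.1)
    rw [integral_eq_lintegral_of_nonneg_ae
      (ae_restrict_of_forall_mem hWm fun x hx => inv_nonneg.2 (pow_nonneg (hWpos x hx).le _))
      (Measurable.aestronglyMeasurable (by fun_prop)), ← hypVolume_apply hWm hWpos]
    have hsub : {x | t ≤ |f x|} ⊆ {x | s < |f x|} := fun x hx => lt_of_lt_of_le (show s < t by linarith) hx
    have h1 : (hypVolume m).real ({x | s < |f x|} \ {x | t ≤ |f x|}) ≤ h := by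
      rw [measureReal_sdiff hsub hTm hSfin.ne]
      linarith
    refine le_trans (ENNReal.toReal_mono (measure_ne_top_of_subset sdiff_subset hSfin.ne) (measure_mono fun x hx => ?_)) h1
    exact ⟨hwpos x hx.1, not_le.2 (hw1 x hx.2)⟩
  have hmain := iso_sub_le_integral hm hwc hws (fun x hx => hpos x (hwt hx)) (fun x => hΨ0 _) (fun x => hΨ1 _) hV
    hmass hh.le hlay
  have hdz : ∀ x, ¬(s < |f x| ∧ |f x| < t) → fderiv ℝ w x = 0 := fun x hx => by
    rw [(hwd x).fderiv, hΨ'0 _ hx, zero_smul]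
  have hgrad : ENNReal.ofReal (∫ x, ‖fderiv ℝ w x‖ * (x 0 ^ m)⁻¹) ≤
      ENNReal.ofReal (t - s - 2 * ε)⁻¹ *
        ∫⁻ x in {x | s < |f x| ∧ |f x| < t}, ENNReal.ofReal (x 0 * ‖fderiv ℝ f x‖) ∂hypVolume m := by
    have hcw := hwc.continuous_fderiv one_ne_zero
    rw [integral_eq_lintegral_of_nonneg_ae]
    rotate_left
    · refine Eventually.of_forall fun x => ?_
      by_cases hx : s < |f x| ∧ |f x| < t
      · have := hSpos x hx.1
        dsimp only [Pi.zero_apply]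
        positivity
      · simp only [hdz x hx, norm_zero, zero_mul, Pi.zero_apply, le_refl]
    · have := hcw.measurable
      exact Measurable.aestronglyMeasurable (by fun_prop)
    refine ENNReal.ofReal_toReal_le.trans ?_
    rw [setLIntegral_hypVolume hLm (fun x hx => hSpos x hx.1) (measurable_upperGrad hf),
      ← lintegral_const_mul' _ _ ENNReal.ofReal_ne_top, ← lintegral_indicator hLm]
    refine lintegral_mono fun x => ?_
    by_cases hx : s < |f x| ∧ |f x| < t
    · rw [indicator_of_mem (by exact hx)]
      have h0 := hSpos x hx.1
      rw [← ENNReal.ofReal_mul (by positivity), ← ENNReal.ofReal_mul (by positivity)]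
      refine ENNReal.ofReal_le_ofReal ?_
      rw [(hwd x).fderiv, norm_smul, Real.norm_eq_abs]
      have e : (x 0 ^ (m + 1))⁻¹ * (x 0 * ‖fderiv ℝ f x‖) = ‖fderiv ℝ f x‖ * (x 0 ^ m)⁻¹ := by
        rw [pow_succ]; field_simp
      rw [e, mul_assoc]
      exact mul_le_mul_of_nonneg_right (hΨ'b _) (by positivity)
    · simp only [hdz x hx, norm_zero, zero_mul, ENNReal.ofReal_zero, zero_le]
  rw [ENNReal.ofReal_mul hd0.le]
  calc _ ≤ ENNReal.ofReal (t - s - 2 * ε) * (ENNReal.ofReal (t - s - 2 * ε)⁻¹ *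
        ∫⁻ x in {x | s < |f x| ∧ |f x| < t}, ENNReal.ofReal (x 0 * ‖fderiv ℝ f x‖) ∂hypVolume m) :=
        mul_le_mul' le_rfl ((ENNReal.ofReal_le_ofReal hmain).trans hgrad)
    _ = _ := by
        rw [← mul_assoc, ← ENNReal.ofReal_mul hd0.le, mul_inv_cancel₀ hd0.ne', ENNReal.ofReal_one, one_mul]

theorem capacityBound_abs (hm : 1 ≤ m) (hf : ContDiff ℝ 1 f) (hs : HasCompactSupport f)
    (hpos : ∀ x ∈ tsupport f, 0 < x 0) :
    CapacityBound (hypVolume m) (fun x => |f x|) (fun x => ENNReal.ofReal (x 0 * ‖fderiv ℝ f x‖)) (iso m)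
      (isoErr m) where
  bound := fun V h s t hV hh hs0 hst ht hsV => by
    have h1 : Tendsto (fun ε : ℝ => ENNReal.ofReal ((t - s - 2 * ε) * (iso m V - isoErr m V * h))) (𝓝[>] 0)
        (𝓝 (ENNReal.ofReal ((t - s - 2 * 0) * (iso m V - isoErr m V * h)))) :=
      (Continuous.tendsto (ENNReal.continuous_ofReal.comp (by fun_prop)) 0).mono_left nhdsWithin_le_nhds
    rw [mul_zero, sub_zero] at h1
    refine le_of_tendsto h1 ?_
    have h2 : Ioo (0 : ℝ) ((t - s) / 2) ∈ 𝓝[>] (0 : ℝ) := Ioo_mem_nhdsGT (by linarith)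
    filter_upwards [h2] with ε hε
    exact setLIntegral_layer_ge hm hf hs hpos hV hh hs0 hε.1 (by linarith [hε.2]) ht hsV
  pos := fun V hV => by
    have hσ := unitBallVol_pos (m + 1)
    unfold iso isoPow
    positivity
  mono := fun V W hV h => Real.rpow_le_rpow (isoPow_nonneg m hV.le) (isoPow_mono m hV.le h) (by positivity)
  err_nonneg := fun V hV => by
    have hσ := unitBallVol_pos (m + 1)
    unfold isoErr
    positivity
  err_anti := fun V W hV h => by
    have hσ := unitBallVol_pos (m + 1)
    have hW := hV.trans_le h
    unfold isoErr
    gcongr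

/-- The Mugelli-Talenti inequality in the upper half-space model. -/
theorem sobolev_upper (hm : 1 ≤ m) (hf : ContDiff ℝ 1 f) (hs : HasCompactSupport f)
    (hpos : ∀ x ∈ tsupport f, 0 < x 0) {p : ℝ} (hp : 1 < p) (hpm : p < (m : ℝ) + 1) :
    ENNReal.ofReal (((m : ℝ) / p) ^ ((m : ℝ) + 1)) *
        (∫⁻ x, ENNReal.ofReal (|f x| ^ p) ∂hypVolume m) ^ (((m : ℝ) + 1) / p) +
      ENNReal.ofReal (sobolevConst (m + 1) p ^ ((m : ℝ) + 1)) *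
        (∫⁻ x, ENNReal.ofReal (|f x| ^ (((m : ℝ) + 1) * p / ((m : ℝ) + 1 - p))) ∂hypVolume m) ^
          (((m : ℝ) + 1 - p) / p) ≤
      (∫⁻ x, ENNReal.ofReal (x 0 * ‖fderiv ℝ f x‖) ^ p ∂hypVolume m) ^ (((m : ℝ) + 1) / p) := by
  obtain ⟨B, hB⟩ := isProfile_abs hf hs hpos
  obtain ⟨L, hL, hD⟩ := exists_upperGrad_le hf hs
  exact hB.sobolev_type (capacityBound_abs hm hf hs hpos) hL hD (measurable_upperGrad hf) hm hp hpm

end HalfSpace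

/-- The center of the inversion exchanging the unit ball and the upper half-space. -/
noncomputable def southPole (m : ℕ) : Euc (m + 1) := -EuclideanSpace.single 0 1

/-- The inversion exchanging the unit ball and the upper half-space. -/
noncomputable def cayley (m : ℕ) : Euc (m + 1) → Euc (m + 1) :=
  EuclideanGeometry.inversion (southPole m) √2

section Cayley

variable {m : ℕ}

theorem sqrt_two_ne_zero : √(2 : ℝ) ≠ 0 := by positivity

theorem cayley_cayley (x : Euc (m + 1)) : cayley m (cayley m x) = x :=
  EuclideanGeometry.inversion_inversion _ sqrt_two_ne_zero x

theorem cayley_injective : Function.Injective (cayley m) := EuclideanGeometry.inversion_injective _ sqrt_two_ne_zero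

theorem norm_southPole : ‖southPole m‖ = 1 := by simp [southPole]

theorem inner_southPole (x : Euc (m + 1)) : inner ℝ x (southPole m) = -x 0 := by
  simp [southPole, inner_neg_right, EuclideanSpace.inner_single_right]

theorem ne_southPole {x : Euc (m + 1)} (hx : 0 < x 0) : x ≠ southPole m := by
  rintro rfl
  simp [southPole] at hx
  linarith

theorem one_sub_norm_cayley_sq (x : Euc (m + 1)) :
    1 - ‖cayley m x‖ ^ 2 = 4 * x 0 / ‖x - southPole m‖ ^ 2 := by
  have e : cayley m x = (2 / ‖x - southPole m‖ ^ 2) • (x - southPole m) + southPole m := by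
    simp [cayley, EuclideanGeometry.inversion, div_pow, dist_eq_norm]
  rw [e, norm_add_sq_real, inner_smul_left, inner_sub_left, inner_southPole, real_inner_self_eq_norm_sq,
    norm_southPole, norm_smul, mul_pow]
  rcases eq_or_ne (‖x - southPole m‖) 0 with h | h
  · simp [h]
  · simp
    field_simp
    ring

theorem cayley_mem_ball_iff {x : Euc (m + 1)} : cayley m x ∈ Metric.ball (0 : Euc (m + 1)) 1 ↔ 0 < x 0 := by
  rw [mem_ball_zero_iff, ← sq_lt_one_iff₀ (norm_nonneg _), ← sub_pos, one_sub_norm_cayley_sq]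
  constructor
  · intro h
    by_contra h'
    exact absurd h (not_lt.2 (div_nonpos_of_nonpos_of_nonneg (by linarith) (sq_nonneg _)))
  · intro h
    have := norm_pos_iff.2 (sub_ne_zero.2 (ne_southPole h))
    positivity

theorem cayley_image : cayley m '' {x | 0 < x 0} = Metric.ball (0 : Euc (m + 1)) 1 := by
  ext y
  constructor
  · rintro ⟨x, hx, rfl⟩
    exact cayley_mem_ball_iff.2 hx
  · intro hy
    refine ⟨cayley m y, ?_, cayley_cayley y⟩
    rw [← cayley_cayley y, cayley_mem_ball_iff] at hy
    exact hy

theorem hasFDerivAt_cayley {x : Euc (m + 1)} (hx : 0 < x 0) :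
    HasFDerivAt (cayley m) ((2 / ‖x - southPole m‖ ^ 2) •
      ((Submodule.span ℝ {x - southPole m})ᗮ.reflection : Euc (m + 1) →L[ℝ] Euc (m + 1))) x := by
  have h := EuclideanGeometry.hasFDerivAt_inversion (R := √2) (ne_southPole hx)
  rwa [div_pow, Real.sq_sqrt zero_le_two, dist_eq_norm] at h

theorem abs_det_smul_reflection (r : ℝ) (hr : 0 ≤ r) (K : Submodule ℝ (Euc (m + 1)))
    [K.HasOrthogonalProjection] :
    |(r • (K.reflection : Euc (m + 1) →L[ℝ] Euc (m + 1))).det| = r ^ (m + 1) := by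
  have h : ((K.reflection : Euc (m + 1) →L[ℝ] Euc (m + 1))).det = (-1) ^ Module.finrank ℝ Kᗮ := K.det_reflection
  have e : (r • (K.reflection : Euc (m + 1) →L[ℝ] Euc (m + 1))).det =
      r ^ (m + 1) * ((K.reflection : Euc (m + 1) →L[ℝ] Euc (m + 1))).det := by
    rw [ContinuousLinearMap.det, ContinuousLinearMap.det]
    have := LinearMap.det_smul r ((K.reflection : Euc (m + 1) →L[ℝ] Euc (m + 1)) : Euc (m + 1) →ₗ[ℝ] Euc (m + 1))
    rw [finrank_euclideanSpace_fin] at this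
    exact this
  rw [e, h, abs_mul, abs_pow, abs_pow, abs_neg, abs_one, one_pow, mul_one, abs_of_nonneg hr]

theorem setLIntegral_ball (φ : Euc (m + 1) → ENNReal) :
    ∫⁻ y in Metric.ball (0 : Euc (m + 1)) 1, ENNReal.ofReal ((2 / (1 - ‖y‖ ^ 2)) ^ (m + 1)) * φ y =
      ∫⁻ x in {x : Euc (m + 1) | 0 < x 0}, ENNReal.ofReal (x 0 ^ (m + 1))⁻¹ * φ (cayley m x) := by
  rw [← cayley_image, lintegral_image_eq_lintegral_abs_det_fderiv_mul volume measurableSet_upper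
    (fun x hx => (hasFDerivAt_cayley hx).hasFDerivWithinAt) cayley_injective.injOn]
  refine setLIntegral_congr_fun measurableSet_upper fun x hx => ?_
  have hx0 : 0 < x 0 := hx
  have hd := norm_pos_iff.2 (sub_ne_zero.2 (ne_southPole hx0))
  rw [abs_det_smul_reflection _ (by positivity), ← mul_assoc, ← ENNReal.ofReal_mul (by positivity),
    one_sub_norm_cayley_sq, ← mul_pow, ← inv_pow]
  congr 3
  field_simp
  norm_num

theorem norm_fderiv_comp_cayley {u : Euc (m + 1) → ℝ} (hu : Differentiable ℝ u) {x : Euc (m + 1)} (hx : 0 < x 0) :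
    x 0 * ‖fderiv ℝ (u ∘ cayley m) x‖ = (1 - ‖cayley m x‖ ^ 2) / 2 * ‖fderiv ℝ u (cayley m x)‖ := by
  have h := (hu (cayley m x)).hasFDerivAt.comp x (hasFDerivAt_cayley hx)
  have hd := norm_pos_iff.2 (sub_ne_zero.2 (ne_southPole hx))
  rw [h.fderiv, ContinuousLinearMap.comp_smul, norm_smul, ContinuousLinearMap.opNorm_comp_linearIsometryEquiv,
    one_sub_norm_cayley_sq, Real.norm_of_nonneg (by positivity)]
  ring

variable {u : Euc (m + 1) → ℝ}

theorem isCompact_cayley_image (hsupp : tsupport u ⊆ Metric.ball (0 : Euc (m + 1)) 1) :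
    IsCompact (cayley m '' tsupport u) ∧ ∀ x ∈ cayley m '' tsupport u, 0 < x 0 := by
  have hK : IsCompact (tsupport u) := (isCompact_closedBall (0 : Euc (m + 1)) 1).of_isClosed_subset
    (isClosed_tsupport u) (hsupp.trans Metric.ball_subset_closedBall)
  have hne : ∀ y ∈ tsupport u, y ≠ southPole m := by
    rintro y hy rfl
    have := mem_ball_zero_iff.1 (hsupp hy)
    rw [norm_southPole] at this
    exact lt_irrefl _ this
  refine ⟨hK.image_of_continuousOn fun y hy => ?_, ?_⟩
  · exact (EuclideanGeometry.hasFDerivAt_inversion (R := √2) (hne y hy)).continuousAt.continuousWithinAt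
  · rintro _ ⟨y, hy, rfl⟩
    rw [← cayley_mem_ball_iff, cayley_cayley]
    exact hsupp hy

theorem tsupport_comp_cayley (hsupp : tsupport u ⊆ Metric.ball (0 : Euc (m + 1)) 1) :
    tsupport (u ∘ cayley m) ⊆ cayley m '' tsupport u :=
  closure_minimal (fun x hx => ⟨cayley m x, subset_tsupport u hx, cayley_cayley x⟩)
    (isCompact_cayley_image hsupp).1.isClosed

theorem contDiff_comp_cayley (hu : ContDiff ℝ 1 u) (hsupp : tsupport u ⊆ Metric.ball (0 : Euc (m + 1)) 1) :
    ContDiff ℝ 1 (u ∘ cayley m) := by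
  obtain ⟨hK, hpos⟩ := isCompact_cayley_image hsupp
  rw [contDiff_iff_contDiffAt]
  intro x
  by_cases hx : x ∈ cayley m '' tsupport u
  · exact hu.contDiffAt.comp x (ContDiffAt.inversion (n := 1) contDiffAt_const contDiffAt_const contDiffAt_id
      (ne_southPole (hpos x hx)))
  · refine (contDiffAt_const (c := (0 : ℝ))).congr_of_eventuallyEq ?_
    filter_upwards [hK.isClosed.isOpen_compl.mem_nhds hx] with z hz
    by_contra h
    exact hz ⟨cayley m z, subset_tsupport u h, cayley_cayley z⟩

end Cayley

section Ball

variable {m : ℕ}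

theorem setIntegral_ball_eq {g : Euc (m + 1) → ℝ} (hg : Measurable g)
    (hg0 : ∀ y ∈ Metric.ball (0 : Euc (m + 1)) 1, 0 ≤ g y) {φ : Euc (m + 1) → ENNReal} (hφ : Measurable φ)
    (h : ∀ x : Euc (m + 1), 0 < x 0 → φ x = ENNReal.ofReal (g (cayley m x))) :
    ∫ y in Metric.ball (0 : Euc (m + 1)) 1, g y * (2 / (1 - ‖y‖ ^ 2)) ^ ((m : ℝ) + 1) =
      (∫⁻ x, φ x ∂hypVolume m).toReal := by
  have hw : ∀ y ∈ Metric.ball (0 : Euc (m + 1)) 1, 0 ≤ 2 / (1 - ‖y‖ ^ 2) := fun y hy => by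
    have h1 := (sq_lt_one_iff₀ (norm_nonneg _)).2 (mem_ball_zero_iff.1 hy)
    exact div_nonneg zero_le_two (by linarith)
  have hmeas : Measurable fun y : Euc (m + 1) => g y * (2 / (1 - ‖y‖ ^ 2)) ^ ((m : ℝ) + 1) := by fun_prop
  rw [integral_eq_lintegral_of_nonneg_ae _ hmeas.aestronglyMeasurable]
  · congr 1
    have e : ∫⁻ y in Metric.ball (0 : Euc (m + 1)) 1,
          ENNReal.ofReal (g y * (2 / (1 - ‖y‖ ^ 2)) ^ ((m : ℝ) + 1)) =
        ∫⁻ y in Metric.ball (0 : Euc (m + 1)) 1,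
          ENNReal.ofReal ((2 / (1 - ‖y‖ ^ 2)) ^ (m + 1)) * ENNReal.ofReal (g y) := by
      refine setLIntegral_congr_fun measurableSet_ball fun y hy => ?_
      have hexp : (2 / (1 - ‖y‖ ^ 2)) ^ ((m : ℝ) + 1) = (2 / (1 - ‖y‖ ^ 2)) ^ (m + 1) := by
        rw [← Nat.cast_add_one m]
        exact Real.rpow_natCast _ _
      rw [hexp, mul_comm, ENNReal.ofReal_mul (pow_nonneg (hw y hy) _)]
    rw [e, setLIntegral_ball, lintegral_hypVolume hφ]
    exact setLIntegral_congr_fun measurableSet_upper fun x hx => by rw [h x hx]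
  · refine ae_restrict_of_forall_mem measurableSet_ball fun y hy => ?_
    exact mul_nonneg (hg0 y hy) (Real.rpow_nonneg (hw y hy) _)

theorem lintegral_upperGrad_rpow_lt_top {f : Euc (m + 1) → ℝ} (hf : ContDiff ℝ 1 f) (hs : HasCompactSupport f)
    (hpos : ∀ x ∈ tsupport f, 0 < x 0) {p : ℝ} (hp : 0 < p) :
    ∫⁻ x, ENNReal.ofReal (x 0 * ‖fderiv ℝ f x‖) ^ p ∂hypVolume m < ⊤ := by
  obtain ⟨L, -, hL⟩ := exists_upperGrad_le hf hs
  have hle : ∀ x, ENNReal.ofReal (x 0 * ‖fderiv ℝ f x‖) ^ p ≤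
      (tsupport f).indicator (fun _ => ENNReal.ofReal L ^ p) x := by
    intro x
    by_cases hx : x ∈ tsupport f
    · rw [indicator_of_mem hx]
      exact ENNReal.rpow_le_rpow (hL x) hp.le
    · rw [indicator_of_notMem hx, image_eq_zero_of_notMem_tsupport (f := fderiv ℝ f)
        fun h => hx (tsupport_fderiv_subset ℝ h)]
      simp [hp]
  refine (lintegral_mono hle).trans_lt ?_
  rw [lintegral_indicator (isClosed_tsupport f).measurableSet, setLIntegral_const]
  exact ENNReal.mul_lt_top (ENNReal.rpow_lt_top_of_nonneg hp.le ENNReal.ofReal_ne_top) (hypVolume_lt_top hs hpos)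

theorem sobolevConst_nonneg {n : ℕ} {p : ℝ} (hp : 1 < p) (hpn : p < n) : 0 ≤ sobolevConst n p := by
  have h0 : (0 : ℝ) < n := by linarith
  have h1 : 0 ≤ (n : ℝ) / p := by positivity
  have h2 : (n : ℝ) / p < n := div_lt_self h0 hp
  have h3 : 0 ≤ unitBallVol n := div_nonneg (by positivity) (Real.Gamma_nonneg_of_nonneg (by positivity))
  have h4 : 0 ≤ (n : ℝ) * (p - 1) / (n - p) := div_nonneg (mul_nonneg h0.le (by linarith)) (by linarith)
  have h5 : 0 ≤ Real.Gamma ((n : ℝ) + 1 - n / p) := Real.Gamma_nonneg_of_nonneg (by linarith)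
  have h6 := Real.Gamma_nonneg_of_nonneg h1
  have h7 := Real.Gamma_nonneg_of_nonneg h0.le
  unfold sobolevConst
  positivity

end Ball

end

/-- The Mugelli–Talenti type Sobolev inequality in `ℍⁿ` for `1 < p < n`. -/
theorem mugelli_talenti_hyperbolic (n : ℕ) (hn : 2 ≤ n) (p : ℝ)
    (hp1 : 1 < p) (hp2 : p < n)
    (u : EuclideanSpace ℝ (Fin n) → ℝ) (hu : ContDiff ℝ (⊤ : ℕ∞) u)
    (hsupp : tsupport u ⊆ Metric.ball (0 : EuclideanSpace ℝ (Fin n)) 1) :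
    (((n : ℝ) - 1) / p) ^ (n : ℝ) *
        (∫ x in Metric.ball (0 : EuclideanSpace ℝ (Fin n)) 1,
            |u x| ^ p * (2 / (1 - ‖x‖ ^ 2)) ^ (n : ℝ)) ^ ((n : ℝ) / p)
      + sobolevConst n p ^ (n : ℝ) *
        (∫ x in Metric.ball (0 : EuclideanSpace ℝ (Fin n)) 1,
            |u x| ^ ((n : ℝ) * p / ((n : ℝ) - p)) * (2 / (1 - ‖x‖ ^ 2)) ^ (n : ℝ)) ^
          (((n : ℝ) - p) / p)
      ≤ (∫ x in Metric.ball (0 : EuclideanSpace ℝ (Fin n)) 1,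
            ((1 - ‖x‖ ^ 2) / 2) ^ p * ‖fderiv ℝ u x‖ ^ p * (2 / (1 - ‖x‖ ^ 2)) ^ (n : ℝ)) ^
          ((n : ℝ) / p) := by
  obtain ⟨m, rfl⟩ : ∃ m, n = m + 1 := ⟨n - 1, by omega⟩
  have hS := sobolevConst_nonneg hp1 hp2
  have hm : 1 ≤ m := by omega
  push_cast at hp2 ⊢
  have hp0 : 0 < p := by linarith
  have hu1 : ContDiff ℝ 1 u := hu.of_le (by exact_mod_cast le_top)
  obtain ⟨hK, hKpos⟩ := isCompact_cayley_image hsupp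
  have hts := tsupport_comp_cayley hsupp
  set f := u ∘ cayley m with hfdef
  have hf : ContDiff ℝ 1 f := contDiff_comp_cayley hu1 hsupp
  have hs : HasCompactSupport f := hK.of_isClosed_subset (isClosed_tsupport f) hts
  have hpos : ∀ x ∈ tsupport f, 0 < x 0 := fun x hx => hKpos x (hts hx)
  have key := sobolev_upper hm hf hs hpos hp1 hp2
  have hD := lintegral_upperGrad_rpow_lt_top hf hs hpos hp0
  have hfm : Measurable f := hf.continuous.measurable
  have hum : Measurable u := hu1.continuous.measurable
  have hdm : Measurable (fderiv ℝ u) := (hu1.continuous_fderiv one_ne_zero).measurable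
  have e : ∀ q : ℝ, ∫ y in Metric.ball (0 : Euc (m + 1)) 1, |u y| ^ q * (2 / (1 - ‖y‖ ^ 2)) ^ ((m : ℝ) + 1) =
      (∫⁻ x, ENNReal.ofReal (|f x| ^ q) ∂hypVolume m).toReal := fun q =>
    setIntegral_ball_eq (by fun_prop) (fun y _ => by positivity) (by fun_prop) fun x _ => rfl
  have eD : ∫ y in Metric.ball (0 : Euc (m + 1)) 1,
        ((1 - ‖y‖ ^ 2) / 2) ^ p * ‖fderiv ℝ u y‖ ^ p * (2 / (1 - ‖y‖ ^ 2)) ^ ((m : ℝ) + 1) =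
      (∫⁻ x, ENNReal.ofReal (x 0 * ‖fderiv ℝ f x‖) ^ p ∂hypVolume m).toReal := by
    have hw : ∀ y ∈ Metric.ball (0 : Euc (m + 1)) 1, 0 ≤ (1 - ‖y‖ ^ 2) / 2 := fun y hy => by
      have h1 := (sq_lt_one_iff₀ (norm_nonneg _)).2 (mem_ball_zero_iff.1 hy)
      linarith
    refine setIntegral_ball_eq (by fun_prop) (fun y hy => ?_) ((measurable_upperGrad hf).pow_const p) fun x hx => ?_
    · exact mul_nonneg (Real.rpow_nonneg (hw y hy) _) (by positivity)
    · rw [norm_fderiv_comp_cayley (hu1.differentiable one_ne_zero) hx,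
        ← Real.mul_rpow (hw _ (cayley_mem_ball_iff.2 hx)) (norm_nonneg _)]
      exact ENNReal.ofReal_rpow_of_nonneg (mul_nonneg (hw _ (cayley_mem_ball_iff.2 hx)) (norm_nonneg _)) hp0.le
  have htop := ENNReal.rpow_lt_top_of_nonneg (y := ((m : ℝ) + 1) / p) (by positivity) hD.ne
  have h1 := (le_self_add.trans key).trans_lt htop
  have h2 := (le_add_self.trans key).trans_lt htop
  have h := ENNReal.toReal_mono htop.ne key
  rw [ENNReal.toReal_add h1.ne h2.ne, ENNReal.toReal_mul, ENNReal.toReal_mul, ← ENNReal.toReal_rpow,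
    ← ENNReal.toReal_rpow, ← ENNReal.toReal_rpow, ENNReal.toReal_ofReal (by positivity),
    ENNReal.toReal_ofReal (by positivity), ← e, ← e, ← eD] at h
  rwa [add_sub_cancel_right]
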